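/- arXiv:1811.07413 — 3 statements merged into one kernel-verified Lean document; each statement's English description precedes it below -/
import Mathlib

section
/- Let (J, m) be a MaxT instance with all time windows contained in [1,T] (T ≥ 2), with p_j ≤ λ·|χ_j| for every j ∈ J, where λ ∈ (0, 1/4 − 1/(2(m+2))), and let W denote the maximum of Σ_{j∈S} w_j over all feasibly schedulable subsets S ⊆ J. Set ω = 1/2 − 4λ·(1/2 + 1/m). Then: (i) every subset S ⊆ J satisfying, for every χ ∈ L(T), Σ_{j∈S : 𝔏(χ_j) ⊆ χ} a_j ≤ (ω + 4λ/m)·m·|χ| admits a feasible schedule on the m hosts in which every job j ∈ S is scheduled entirely within the time slots of 𝔏(χ_j); and (ii) there exists such a subset S with Σ_{j∈S} w_j ≥ (ω/4)·W = (1/8 − λ·(1/2 + 1/m))·W. In particular, there is a feasibly schedulable subset of weight at least (1/8 − λ·(1/2 + 1/m))·W. -/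
open Finset

/-- A subset `S` of jobs is feasibly schedulable on `m` identical hosts:
for each job `j ∈ S` one can pick a set of exactly `p j` time slots inside its
time window `[r j, d j]` and a host for each chosen slot, so that at every host
and every time slot, the total size of jobs running there is at most `1`. -/
def Schedulable {ι : Type*} (m : ℕ) (r d : ι → ℤ) (p : ι → ℕ) (s : ι → ℝ)
    (S : Finset ι) : Prop :=
  ∃ (Tj : ι → Finset ℤ) (h : ι → ℤ → Fin m),
    (∀ j ∈ S, Tj j ⊆ Finset.Icc (r j) (d j) ∧ (Tj j).card = p j) ∧
    ∀ (i : Fin m) (t : ℤ),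
      ∑ j ∈ S.filter (fun j => t ∈ Tj j ∧ h j t = i), s j ≤ 1

/-- The binary laminar family `L(T)` of subintervals of `[1,T]`. -/
inductive BinLam (T : ℤ) : ℤ → ℤ → Prop
  | root : BinLam T 1 T
  | left {l r : ℤ} : BinLam T l r → 1 < r - l → BinLam T l ((l + r) / 2)
  | right {l r : ℤ} : BinLam T l r → 1 < r - l → BinLam T ((l + r) / 2 + 1) r

/-- `[l,r]` is the interval `𝔏([a,b])`: the largest interval of the binary laminar
family `L(T)` contained in `[a,b]`, ties broken by taking the rightmost one. -/
def IsLMap (T a b l r : ℤ) : Prop :=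
  BinLam T l r ∧ a ≤ l ∧ r ≤ b ∧
  ∀ l' r' : ℤ, BinLam T l' r' → a ≤ l' → r' ≤ b →
    (r' - l' < r - l ∨ (r' - l' = r - l ∧ r' ≤ r))


namespace MaxT

lemma BinLam.bounds {T l r : ℤ} (hT : 2 ≤ T) (h : BinLam T l r) : 1 ≤ l ∧ l ≤ r ∧ r ≤ T := by
  induction h with
  | root => omega
  | left _ _ ih => omega
  | right _ _ ih => omega

/-- position of `(a,b)` relative to `(l,r)` -/
def Rel (l r a b : ℤ) : Prop :=
  b < l ∨ r < a ∨ (a ≤ l ∧ r ≤ b) ∨ (1 < r - l ∧ l ≤ a ∧ b ≤ (l + r) / 2) ∨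
    (1 < r - l ∧ (l + r) / 2 + 1 ≤ a ∧ b ≤ r)

lemma rel_left {l r a b : ℤ} (hlr : l ≤ r) (hab : a ≤ b) (h1 : Rel l r a b) (h2 : Rel a b l r)
    (h : 1 < b - a) : Rel l r a ((a + b) / 2) := by
  unfold Rel at *; omega

lemma rel_right {l r a b : ℤ} (hlr : l ≤ r) (hab : a ≤ b) (h1 : Rel l r a b) (h2 : Rel a b l r)
    (h : 1 < b - a) : Rel l r ((a + b) / 2 + 1) b := by
  unfold Rel at *; omega

lemma rel_both {T l r : ℤ} (hT : 2 ≤ T) (h : BinLam T l r) :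
    ∀ a b, BinLam T a b → Rel l r a b ∧ Rel a b l r := by
  have key : ∀ {l r : ℤ}, BinLam T l r → (∀ a b, BinLam T a b → Rel a b l r) →
      ∀ a b, BinLam T a b → Rel l r a b := by
    intro l r h hh a b hab
    have hb := BinLam.bounds hT h
    induction hab with
    | root => unfold Rel; omega
    | left h' h1 ih => exact rel_left hb.2.1 (BinLam.bounds hT h').2.1 ih (hh _ _ h') h1
    | right h' h1 ih => exact rel_right hb.2.1 (BinLam.bounds hT h').2.1 ih (hh _ _ h') h1
  have main : ∀ a b, BinLam T a b → Rel a b l r := by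
    induction h with
    | root =>
      intro a b hab
      have := BinLam.bounds hT hab
      unfold Rel; omega
    | left h' h1 ih =>
      intro a b hab
      exact rel_left (BinLam.bounds hT hab).2.1 (BinLam.bounds hT h').2.1 (ih a b hab)
        (key h' ih a b hab) h1
    | right h' h1 ih =>
      intro a b hab
      exact rel_right (BinLam.bounds hT hab).2.1 (BinLam.bounds hT h').2.1 (ih a b hab)
        (key h' ih a b hab) h1
  exact fun a b hab => ⟨key h main a b hab, main a b hab⟩

lemma rel {T l r a b : ℤ} (hT : 2 ≤ T) (h : BinLam T l r) (h' : BinLam T a b) : Rel l r a b :=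
  (rel_both hT h a b h').1

lemma suffix_aux {T : ℤ} (n : ℕ) : ∀ l r a : ℤ, BinLam T l r → (r - l).toNat ≤ n → l ≤ a →
    a ≤ r - 1 → ∃ l', BinLam T l' r ∧ a ≤ l' ∧ r - a + 1 ≤ 2 * (r - l' + 1) := by
  induction n with
  | zero => intro l r a h hn h1 h2; omega
  | succ n ih =>
    intro l r a h hn h1 h2
    rcases eq_or_lt_of_le h1 with h3 | h3
    · exact ⟨l, h, by omega, by omega⟩
    · have hc := BinLam.right h (by omega)
      by_cases h4 : (l + r) / 2 + 1 ≤ a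
      · exact ih _ r a hc (by omega) h4 h2
      · exact ⟨_, hc, by omega, by omega⟩

lemma prefix_aux {T : ℤ} (n : ℕ) : ∀ l r b : ℤ, BinLam T l r → (r - l).toNat ≤ n → b ≤ r →
    l + 1 ≤ b → ∃ r', BinLam T l r' ∧ r' ≤ b ∧ b - l + 1 ≤ 2 * (r' - l + 1) := by
  induction n with
  | zero => intro l r a h hn h1 h2; omega
  | succ n ih =>
    intro l r b h hn h1 h2
    rcases eq_or_lt_of_le h1 with h3 | h3
    · exact ⟨r, h, by omega, by omega⟩
    · have hc := BinLam.left h (by omega)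
      by_cases h4 : b ≤ (l + r) / 2
      · exact ih _ _ b hc (by omega) h4 h2
      · exact ⟨_, hc, by omega, by omega⟩

lemma quarter_aux {T : ℤ} (n : ℕ) : ∀ l r a b : ℤ, BinLam T l r → (r - l).toNat ≤ n → l ≤ a →
    b ≤ r → a + 2 ≤ b → ∃ l' r', BinLam T l' r' ∧ a ≤ l' ∧ r' ≤ b ∧
      b - a + 1 ≤ 4 * (r' - l' + 1) := by
  induction n with
  | zero => intro l r a b h hn h1 h2 h3; omega
  | succ n ih =>
    intro l r a b h hn h1 h2 h3
    have hl := BinLam.left h (by omega)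
    have hr := BinLam.right h (by omega)
    by_cases h4 : b ≤ (l + r) / 2
    · exact ih _ _ a b hl (by omega) h1 h4 h3
    by_cases h5 : (l + r) / 2 + 1 ≤ a
    · exact ih _ _ a b hr (by omega) h5 h2 h3
    by_cases h6 : b - (l + r) / 2 ≤ (l + r) / 2 - a + 1
    · obtain ⟨l', q1, q2, q3⟩ := suffix_aux _ _ _ a hl le_rfl (by omega) (by omega)
      exact ⟨l', _, q1, by omega, by omega, by omega⟩
    · obtain ⟨r', q1, q2, q3⟩ := prefix_aux _ _ _ b hr le_rfl (by omega) (by omega)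
      exact ⟨_, r', q1, by omega, by omega, by omega⟩

lemma quarter {T a b l r : ℤ} (ha : 1 ≤ a) (hb : b ≤ T) (hab : a + 2 ≤ b)
    (h : IsLMap T a b l r) : b - a + 1 ≤ 4 * (r - l + 1) := by
  obtain ⟨l', r', q1, q2, q3, q4⟩ := quarter_aux _ 1 T a b BinLam.root le_rfl ha hb hab
  have := h.2.2.2 l' r' q1 q2 q3
  omega

lemma left_nb {T l r : ℤ} (h : BinLam T l r) : l + 2 ≤ r → 1 < l →
    ∃ l', BinLam T l' (l - 1) ∧ r - l - 1 ≤ l - 1 - l' ∧ l - 1 - l' ≤ r - l + 1 := by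
  induction h with
  | root => intro _ h; omega
  | @left l r h h1 ih =>
    intro h2 h3
    obtain ⟨l', q1, q2, q3⟩ := ih (by omega) h3
    exact ⟨_, BinLam.right q1 (by omega), by omega, by omega⟩
  | @right l r h h1 ih =>
    intro h2 h3
    refine ⟨l, ?_, by omega, by omega⟩
    have := BinLam.left h h1
    simpa using this

lemma right_nb {T l r : ℤ} (h : BinLam T l r) : l + 2 ≤ r → r < T →
    ∃ r', BinLam T (r + 1) r' ∧ r - l - 1 ≤ r' - (r + 1) ∧ r' - (r + 1) ≤ r - l + 1 := by
  induction h with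
  | root => intro _ h; omega
  | @right l r h h1 ih =>
    intro h2 h3
    obtain ⟨l', q1, q2, q3⟩ := ih (by omega) h3
    exact ⟨_, BinLam.left q1 (by omega), by omega, by omega⟩
  | @left l r h h1 ih =>
    intro h2 h3
    exact ⟨r, BinLam.right h h1, by omega, by omega⟩

/-- A left neighbour with at least three slots. -/
lemma left_nb3 {T l r : ℤ} (h : BinLam T l r) (h2 : l + 2 ≤ r) (h1l : 1 < l) :
    ∃ l', BinLam T l' (l - 1) ∧ (l + r) / 2 - l < l - 1 - l' ∧
      (l - 1 - l') + (r - l) ≤ 4 * ((l + r) / 2 - l + 1) := by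
  by_cases h3 : l + 3 ≤ r
  · obtain ⟨l', q1, q2, q3⟩ := left_nb h h2 h1l
    exact ⟨l', q1, by omega, by omega⟩
  · cases h with
    | root => omega
    | @left _ r h h1 =>
      obtain ⟨l', q1, q2, q3⟩ := left_nb h (by omega) h1l
      exact ⟨l', q1, by omega, by omega⟩
    | @right l r h h1 =>
      refine ⟨l, ?_, by omega, by omega⟩
      have := BinLam.left h h1
      simpa using this

lemma extent {T l r : ℤ} (hT : 2 ≤ T) (h : BinLam T l r) (h2 : l + 1 ≤ r) :
    ∃ A B : ℤ, A ≤ B ∧ B - A + 1 ≤ 4 * (r - l + 1) ∧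
      ∀ a b x y, 1 ≤ a → b ≤ T → IsLMap T a b x y → l ≤ x → y ≤ r → A ≤ a ∧ b ≤ B := by
  cases h with
  | root => exact ⟨1, T, by omega, by omega, fun a b x y h1 h2 _ _ _ => ⟨h1, h2⟩⟩
  | @left _ r h h1 =>
    have hb := BinLam.bounds hT h
    have hB : ∀ a b x y, IsLMap T a b x y → l ≤ x → y ≤ (l + r) / 2 → b ≤ r - 1 := by
      intro a b x y hL hx hy
      by_contra hbr
      have hxy := BinLam.bounds hT hL.1
      have e1 := hL.2.2.2 _ _ (BinLam.right h h1) (by have := hL.2.1; omega) (by omega)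
      have e2 := hL.2.2.2 _ _ h (by have := hL.2.1; omega) (by omega)
      omega
    by_cases hl : l = 1
    · exact ⟨1, r - 1, by omega, by omega, fun a b x y q1 q2 q3 q4 q5 => ⟨q1, hB a b x y q3 q4 q5⟩⟩
    · obtain ⟨l', q1, q2, q3⟩ := left_nb3 h (by omega) (by omega)
      refine ⟨l' + 1, r - 1, by omega, by omega, fun a b x y p1 p2 p3 p4 p5 =>
        ⟨?_, hB a b x y p3 p4 p5⟩⟩
      by_contra hA
      have hxy := BinLam.bounds hT p3.1
      have e1 := p3.2.2.2 _ _ q1 (by omega) (by have := p3.2.2.1; omega)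
      omega
  | @right l _ h h1 =>
    have hb := BinLam.bounds hT h
    have hA : ∀ a b x y, IsLMap T a b x y → (l + r) / 2 + 1 ≤ x → y ≤ r → l + 1 ≤ a := by
      intro a b x y hL hx hy
      by_contra hbr
      have hxy := BinLam.bounds hT hL.1
      have e1 := hL.2.2.2 _ _ (BinLam.left h h1) (by omega) (by have := hL.2.2.1; omega)
      have e2 := hL.2.2.2 _ _ h (by omega) (by have := hL.2.2.1; omega)
      omega
    by_cases hr : r = T
    · exact ⟨l + 1, T, by omega, by omega, fun a b x y q1 q2 q3 q4 q5 => ⟨hA a b x y q3 q4 q5, q2⟩⟩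
    · obtain ⟨r', q1, q2, q3⟩ := right_nb h (by omega) (by omega)
      refine ⟨l + 1, (r + 1 + r') / 2 - 1, by omega, by omega, fun a b x y p1 p2 p3 p4 p5 =>
        ⟨hA a b x y p3 p4 p5, ?_⟩⟩
      by_contra hB
      have hxy := BinLam.bounds hT p3.1
      have e1 := p3.2.2.2 _ _ (BinLam.left q1 (by omega)) (by have := p3.2.1; omega) (by omega)
      omega

/-- items of `X` fit into `m` unit bins -/
def Packable {ι : Type*} (s : ι → ℝ) (m : ℕ) (X : Finset ι) : Prop :=
  ∃ h : ι → Fin m, ∀ i, ∑ j ∈ X with h j = i, s j ≤ 1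

lemma packable_of_sum {ι : Type*} [DecidableEq ι] (s : ι → ℝ) (hs0 : ∀ j, 0 < s j)
    (hs1 : ∀ j, s j ≤ 1) (k : ℕ) (hk : 1 ≤ k) (X : Finset ι) :
    ∑ j ∈ X, s j ≤ ((k : ℝ) + 1) / 2 → Packable s k X := by
  induction X using Finset.induction_on_min_value s with
  | empty => intro _; exact ⟨fun _ => ⟨0, hk⟩, fun i => by simp⟩
  | insert a X haX hmin ih =>
    intro hsum
    rw [Finset.sum_insert haX] at hsum
    obtain ⟨h, hh⟩ := ih (by have := hs0 a; linarith)
    by_cases hex : ∃ i, ∑ j ∈ X with h j = i, s j ≤ 1 - s a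
    · obtain ⟨i, hi⟩ := hex
      refine ⟨Function.update h a i, fun i' => ?_⟩
      have hcong : ∀ i', X.filter (fun j => Function.update h a i j = i') =
          X.filter (fun j => h j = i') := by
        intro i'
        apply Finset.filter_congr
        intro x hx
        have : x ≠ a := fun e => haX (e ▸ hx)
        simp [Function.update_of_ne this]
      rw [Finset.filter_insert, hcong]
      by_cases hii : i = i'
      · subst hii
        simp only [Function.update_self, if_true]
        rw [Finset.sum_insert (by simp [haX])]
        linarith
      · simp only [Function.update_self, if_neg hii]
        exact hh i'
    · exfalso
      push Not at hex
      have htot : ∑ i : Fin k, ∑ j ∈ X with h j = i, s j = ∑ j ∈ X, s j :=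
        Finset.sum_fiberwise X h s
      have hb : ∀ i : Fin k, max (1 - s a) (1/2) ≤ ∑ j ∈ X with h j = i, s j ∨
          (1 - s a ≤ ∑ j ∈ X with h j = i, s j ∧ s a ≤ 1/2) := by
        intro i
        by_cases hsa : s a ≤ 1/2
        · right; exact ⟨(hex i).le, hsa⟩
        · left
          have hne : (X.filter (fun j => h j = i)).Nonempty := by
            by_contra hne
            rw [Finset.not_nonempty_iff_eq_empty] at hne
            have := hex i
            rw [hne] at this
            simp at this
            have := hs1 a
            linarith
          obtain ⟨x, hx⟩ := hne
          have h1 : s x ≤ ∑ j ∈ X with h j = i, s j :=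
            Finset.single_le_sum (f := s) (fun j _ => (hs0 j).le) hx
          have h2 := hmin x (Finset.mem_filter.1 hx).1
          apply max_le (hex i).le
          linarith
      have hb2 : ∀ i : Fin k, max (1 - s a) (1/2) ≤ ∑ j ∈ X with h j = i, s j := by
        intro i
        rcases hb i with h | ⟨h1, h2⟩
        · exact h
        · exact max_le h1 (by linarith)
      have hsumle : (k : ℝ) * max (1 - s a) (1/2) ≤ ∑ j ∈ X, s j := by
        rw [← htot]
        calc (k : ℝ) * max (1 - s a) (1/2) = ∑ _i : Fin k, max (1 - s a) (1/2) := by simp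
          _ ≤ _ := Finset.sum_le_sum fun i _ => hb2 i
      -- strictness from one bin
      have hk1 : (1 : ℝ) ≤ k := by exact_mod_cast hk
      by_cases hsa : s a ≤ 1/2
      · have hstrict : (k : ℝ) * (1 - s a) < ∑ j ∈ X, s j := by
          rw [← htot]
          calc (k : ℝ) * (1 - s a) = ∑ _i : Fin k, (1 - s a) := by simp; ring
            _ < _ := Finset.sum_lt_sum_of_nonempty
              ⟨⟨0, hk⟩, Finset.mem_univ _⟩ fun i _ => hex i
        nlinarith
      · have := le_max_right (1 - s a) (1/2)
        nlinarith

lemma packable_insert {ι : Type*} [DecidableEq ι] (s : ι → ℝ) (hs0 : ∀ j, 0 < s j)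
    (hs1 : ∀ j, s j ≤ 1) (m : ℕ) (hm : 2 ≤ m) (X : Finset ι) (a : ι) (ha : a ∉ X)
    (hX : ∑ j ∈ X, s j ≤ (m : ℝ) / 2) : Packable s m (insert a X) := by
  obtain ⟨k, rfl⟩ : ∃ k, m = k + 1 := ⟨m - 1, by omega⟩
  obtain ⟨h, hh⟩ := packable_of_sum s hs0 hs1 k (by omega) X (by push_cast at hX; exact hX)
  refine ⟨fun j => if j = a then Fin.last k else (h j).castSucc, fun i => ?_⟩
  rw [Finset.filter_insert]
  have hcong : ∀ i', X.filter (fun j => (if j = a then Fin.last k else (h j).castSucc) = i') =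
      X.filter (fun j => (h j).castSucc = i') := by
    intro i'
    apply Finset.filter_congr
    intro x hx
    have : x ≠ a := fun e => ha (e ▸ hx)
    simp [this]
  rw [hcong]
  induction i using Fin.lastCases with
  | last =>
    have : X.filter (fun j => (h j).castSucc = Fin.last k) = ∅ := by
      apply Finset.filter_false_of_mem
      intro x _
      exact (Fin.castSucc_lt_last _).ne
    simp only [if_true]
    rw [this]
    simpa using hs1 a
  | cast i =>
    simp only [if_true]
    rw [if_neg (Fin.castSucc_lt_last _).ne']
    simpa using hh i

lemma sum_load {ι : Type*} (Ll Lr : ι → ℤ) (p : ι → ℕ) (s : ι → ℝ) (hs0 : ∀ j, 0 < s j)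
    (S : Finset ι) (Tj : ι → Finset ℤ)
    (hT : ∀ j ∈ S, Tj j ⊆ Finset.Icc (Ll j) (Lr j) ∧ (Tj j).card = p j) (l r : ℤ)
    (hcl : ∀ x ∈ S, Lr x < l ∨ r < Ll x ∨ (l ≤ Ll x ∧ Lr x ≤ r)) :
    ∑ t ∈ Finset.Icc l r, ∑ x ∈ S with t ∈ Tj x, s x ≤
      ∑ j ∈ S with Finset.Icc (Ll j) (Lr j) ⊆ Finset.Icc l r, (p j : ℝ) * s j := by
  simp_rw [Finset.sum_filter]
  rw [Finset.sum_comm]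
  apply Finset.sum_le_sum
  intro x hx
  obtain ⟨h1, h2⟩ := hT x hx
  rw [← Finset.sum_filter, Finset.sum_const, nsmul_eq_mul]
  rcases hcl x hx with h | h | h
  · have : (Finset.Icc l r).filter (fun t => t ∈ Tj x) = ∅ := by
      apply Finset.filter_false_of_mem
      intro t ht ht2
      have := Finset.mem_Icc.1 (h1 ht2)
      have := Finset.mem_Icc.1 ht
      omega
    rw [this]
    have := hs0 x
    split_ifs <;> simp <;> positivity
  · have : (Finset.Icc l r).filter (fun t => t ∈ Tj x) = ∅ := by
      apply Finset.filter_false_of_mem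
      intro t ht ht2
      have := Finset.mem_Icc.1 (h1 ht2)
      have := Finset.mem_Icc.1 ht
      omega
    rw [this]
    have := hs0 x
    split_ifs <;> simp <;> positivity
  · rw [if_pos (Finset.Icc_subset_Icc h.1 h.2)]
    apply mul_le_mul_of_nonneg_right _ (hs0 x).le
    norm_cast
    rw [← h2]
    apply Finset.card_le_card
    intro t ht
    exact (Finset.mem_filter.1 ht).2

lemma closed_of_le {T l r a b : ℤ} (hT : 2 ≤ T) (h : BinLam T l r) (h' : BinLam T a b)
    (hle : b - a ≤ r - l) : b < l ∨ r < a ∨ (l ≤ a ∧ b ≤ r) := by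
  have h1 := rel hT h h'
  have := BinLam.bounds hT h
  have := BinLam.bounds hT h'
  unfold Rel at h1
  omega

/-- area in the node of job `a` available for the other jobs -/
lemma area_step {ι : Type*} [DecidableEq ι] (Ll Lr : ι → ℤ) (p : ι → ℕ) (s : ι → ℝ)
    (hs0 : ∀ j, 0 < s j)
    (S : Finset ι) (a : ι) (ha : a ∉ S) (Tj : ι → Finset ℤ)
    (hTj : ∀ j ∈ S, Tj j ⊆ Finset.Icc (Ll j) (Lr j) ∧ (Tj j).card = p j)
    (hcl : ∀ x ∈ S, Lr x < Ll a ∨ Lr a < Ll x ∨ (Ll a ≤ Ll x ∧ Lr x ≤ Lr a)) (C : ℝ)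
    (hC : ∑ j ∈ insert a S with Finset.Icc (Ll j) (Lr j) ⊆ Finset.Icc (Ll a) (Lr a),
      (p j : ℝ) * s j ≤ C) :
    ∑ t ∈ Finset.Icc (Ll a) (Lr a), ∑ x ∈ S with t ∈ Tj x, s x ≤ C - p a * s a := by
  have h1 := sum_load Ll Lr p s hs0 S Tj hTj (Ll a) (Lr a) hcl
  rw [Finset.filter_insert, if_pos (Finset.Subset.refl _), Finset.sum_insert (by simp [ha])] at hC
  linarith

lemma sched_ge_two {ι : Type*} [DecidableEq ι] (m : ℕ) (hm : 2 ≤ m) (T : ℤ) (hT : 2 ≤ T)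
    (Ll Lr : ι → ℤ) (hL : ∀ j, BinLam T (Ll j) (Lr j)) (p : ι → ℕ) (s : ι → ℝ)
    (hs0 : ∀ j, 0 < s j) (hs1 : ∀ j, s j ≤ 1) (lam : ℝ)
    (hp : ∀ j, (p j : ℝ) ≤ 4 * lam * ((Lr j - Ll j + 1 : ℤ) : ℝ)) (S : Finset ι) :
    (∀ l rr : ℤ, BinLam T l rr →
        ∑ j ∈ S.filter (fun j => Finset.Icc (Ll j) (Lr j) ⊆ Finset.Icc l rr),
            (p j : ℝ) * s j ≤ (1/2 - 2 * lam) * m * ((rr - l + 1 : ℤ) : ℝ)) →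
    ∃ Tj : ι → Finset ℤ, (∀ j ∈ S, Tj j ⊆ Finset.Icc (Ll j) (Lr j) ∧ (Tj j).card = p j) ∧
      ∀ t, Packable s m (S.filter (fun j => t ∈ Tj j)) := by
  induction S using Finset.induction_on_max_value (fun j => Lr j - Ll j) with
  | empty => intro _; exact ⟨fun _ => ∅, by simp, fun t => ⟨fun _ => ⟨0, by omega⟩, by simp⟩⟩
  | insert a S haS hmax ih =>
    intro hA
    obtain ⟨Tj, hTj, hpk⟩ := ih (by
      intro l r hlr
      refine le_trans (Finset.sum_le_sum_of_subset_of_nonneg ?_ ?_) (hA l r hlr)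
      · exact Finset.filter_subset_filter _ (Finset.subset_insert _ _)
      · intro i _ _
        have := hs0 i
        positivity)
    have hcl : ∀ x ∈ S, Lr x < Ll a ∨ Lr a < Ll x ∨ (Ll a ≤ Ll x ∧ Lr x ≤ Lr a) := fun x hx =>
      closed_of_le hT (hL a) (hL x) (hmax x hx)
    have harea := area_step Ll Lr p s hs0 S a haS Tj hTj hcl _ (hA _ _ (hL a))
    have hb := BinLam.bounds hT (hL a)
    classical
    let G := (Finset.Icc (Ll a) (Lr a)).filter
      (fun t => ∑ x ∈ S with t ∈ Tj x, s x ≤ (m : ℝ) / 2)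
    have hG : p a ≤ G.card := by
      by_contra hlt
      push Not at hlt
      have hsplit := Finset.card_filter_add_card_filter_not (s := Finset.Icc (Ll a) (Lr a))
        (fun t => ∑ x ∈ S with t ∈ Tj x, s x ≤ (m : ℝ) / 2)
      have hcard : (((Finset.Icc (Ll a) (Lr a)).card : ℕ) : ℝ) = ((Lr a - Ll a + 1 : ℤ) : ℝ) := by
        rw [Int.card_Icc]
        have : ((Lr a + 1 - Ll a).toNat : ℤ) = Lr a - Ll a + 1 := by omega
        exact_mod_cast this
      set B := (Finset.Icc (Ll a) (Lr a)).filter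
        (fun t => ¬ ∑ x ∈ S with t ∈ Tj x, s x ≤ (m : ℝ) / 2) with hB
      have h1 : (B.card : ℝ) * ((m : ℝ) / 2) ≤
          ∑ t ∈ Finset.Icc (Ll a) (Lr a), ∑ x ∈ S with t ∈ Tj x, s x := by
        calc (B.card : ℝ) * ((m : ℝ) / 2) = ∑ _t ∈ B, (m : ℝ) / 2 := by simp
          _ ≤ ∑ t ∈ B, ∑ x ∈ S with t ∈ Tj x, s x := by
            apply Finset.sum_le_sum
            intro t ht
            exact (not_le.1 (Finset.mem_filter.1 ht).2).le
          _ ≤ _ := by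
            apply Finset.sum_le_sum_of_subset_of_nonneg (Finset.filter_subset _ _)
            intro t _ _
            exact Finset.sum_nonneg fun x _ => (hs0 x).le
      have h2 : ((Lr a - Ll a + 1 : ℤ) : ℝ) < B.card + p a := by
        rw [← hcard, ← hsplit]
        have : (G.card : ℝ) < p a := by exact_mod_cast hlt
        push_cast
        change (G.card : ℝ) + B.card < _
        linarith
      have h3 := hp a
      have h4 := hs0 a
      have h5 : (2 : ℝ) ≤ m := by exact_mod_cast hm
      have h6 : (0 : ℝ) ≤ p a * s a := by positivity
      nlinarith
    obtain ⟨Ta, hTa, hTac⟩ := Finset.exists_subset_card_eq hG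
    have hcong : ∀ t, S.filter (fun j => t ∈ Function.update Tj a Ta j) =
        S.filter (fun j => t ∈ Tj j) := by
      intro t
      apply Finset.filter_congr
      intro x hx
      have : x ≠ a := fun e => haS (e ▸ hx)
      simp [Function.update_of_ne this]
    refine ⟨Function.update Tj a Ta, ?_, ?_⟩
    · intro j hj
      by_cases hja : j = a
      · subst hja
        simp only [Function.update_self]
        exact ⟨hTa.trans (Finset.filter_subset _ _), hTac⟩
      · rw [Function.update_of_ne hja]
        exact hTj j (Finset.mem_of_mem_insert_of_ne hj hja)
    · intro t
      rw [Finset.filter_insert, hcong, Function.update_self]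
      split_ifs with ht
      · apply packable_insert s hs0 hs1 m hm _ _ (by simp [haS])
        exact (Finset.mem_filter.1 (hTa ht)).2
      · exact hpk t


/-- number of light slots of `[l,r]` under the load function `f` -/
noncomputable def lightSet (f : ℤ → ℝ) (l r : ℤ) : Finset ℤ :=
  (Finset.Icc l r).filter (fun t => 0 < f t ∧ f t ≤ 1/2)

lemma lightSet_split (f : ℤ → ℝ) (l r c : ℤ) :
    ((lightSet f l r).card : ℝ) ≤ (lightSet f l c).card + (lightSet f (c + 1) r).card := by
  have : lightSet f l r ⊆ lightSet f l c ∪ lightSet f (c + 1) r := by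
    intro t ht
    simp only [lightSet, Finset.mem_union, Finset.mem_filter, Finset.mem_Icc] at *
    rcases le_or_gt t c with h | h
    · left; exact ⟨⟨ht.1.1, h⟩, ht.2⟩
    · right; exact ⟨⟨by omega, ht.1.2⟩, ht.2⟩
  exact_mod_cast (Finset.card_le_card this).trans (Finset.card_union_le _ _)

lemma card_Icc_real {l r : ℤ} (h : l ≤ r) :
    (((Finset.Icc l r).card : ℕ) : ℝ) = ((r - l + 1 : ℤ) : ℝ) := by
  rw [Int.card_Icc]
  have : ((r + 1 - l).toNat : ℤ) = r - l + 1 := by omega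
  exact_mod_cast this

/-- choice of slots for one more job on a single host -/
lemma choose_slots (f : ℤ → ℝ) (hf0 : ∀ t, 0 ≤ f t) (hf1 : ∀ t, f t ≤ 1) (l r : ℤ) (hlr : l ≤ r)
    (lam : ℝ) (p : ℕ) (s : ℝ) (hs0 : 0 < s) (hs1 : s ≤ 1)
    (hp : (p : ℝ) ≤ 4 * lam * ((r - l + 1 : ℤ) : ℝ))
    (harea : ∑ t ∈ Finset.Icc l r, f t ≤ (1/2 - 2 * lam) * ((r - l + 1 : ℤ) : ℝ) - p * s)
    (hlight : ((lightSet f l r).card : ℝ) ≤ 4 * lam * ((r - l + 1 : ℤ) : ℝ)) :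
    ∃ U ⊆ Finset.Icc l r, U.card = p ∧ (∀ t ∈ U, f t + s ≤ 1) ∧
      ((lightSet (fun t => f t + if t ∈ U then s else 0) l r).card : ℝ) ≤
        4 * lam * ((r - l + 1 : ℤ) : ℝ) := by
  classical
  set H := (Finset.Icc l r).filter (fun t => 1/2 < f t) with hH
  set E := (Finset.Icc l r).filter (fun t => f t = 0) with hE
  set Lt := lightSet f l r with hLt
  have hcov : Finset.Icc l r ⊆ H ∪ (Lt ∪ E) := by
    intro t ht
    simp only [hH, hE, hLt, lightSet, Finset.mem_union, Finset.mem_filter]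
    rcases lt_or_ge (1/2) (f t) with h | h
    · exact Or.inl ⟨ht, h⟩
    · rcases (hf0 t).eq_or_lt with h' | h'
      · exact Or.inr (Or.inr ⟨ht, h'.symm⟩)
      · exact Or.inr (Or.inl ⟨ht, h', h⟩)
  have hc1 : (((r - l + 1 : ℤ) : ℝ)) ≤ H.card + (Lt ∪ E).card := by
    rw [← card_Icc_real hlr]
    exact_mod_cast (Finset.card_le_card hcov).trans (Finset.card_union_le _ _)
  have hc2 : ((Lt ∪ E).card : ℝ) ≤ Lt.card + E.card := by
    exact_mod_cast Finset.card_union_le _ _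
  have hHs : (H.card : ℝ) * (1/2) ≤ ∑ t ∈ Finset.Icc l r, f t := by
    calc (H.card : ℝ) * (1/2) = ∑ _t ∈ H, (1/2 : ℝ) := by simp
      _ ≤ ∑ t ∈ H, f t := Finset.sum_le_sum fun t ht => (Finset.mem_filter.1 ht).2.le
      _ ≤ _ := Finset.sum_le_sum_of_subset_of_nonneg (Finset.filter_subset _ _)
          fun t _ _ => hf0 t
  have hps : (0 : ℝ) ≤ p * s := by positivity
  by_cases hs : s ≤ 1/2
  · have hcard : p ≤ (Lt ∪ E).card := by
      have : (p : ℝ) ≤ (Lt ∪ E).card := by linarith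
      exact_mod_cast this
    have hsub : Lt ∪ E ⊆ Finset.Icc l r :=
      Finset.union_subset (Finset.filter_subset _ _) (Finset.filter_subset _ _)
    have hfit : ∀ t ∈ Lt ∪ E, f t + s ≤ 1 := by
      intro t ht
      have : f t ≤ 1/2 := by
        rcases Finset.mem_union.1 ht with h | h
        · exact (Finset.mem_filter.1 h).2.2
        · rw [(Finset.mem_filter.1 h).2]; norm_num
      linarith
    rcases le_or_gt p Lt.card with h | h
    · obtain ⟨U, hU, hUc⟩ := Finset.exists_subset_card_eq h
      refine ⟨U, hU.trans (Finset.subset_union_left.trans hsub), hUc,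
        fun t ht => hfit t (Finset.mem_union_left _ (hU ht)), le_trans ?_ hlight⟩
      norm_cast
      apply Finset.card_le_card
      intro t ht
      simp only [lightSet, Finset.mem_filter] at ht
      by_cases htU : t ∈ U
      · exact hU htU
      · simp only [htU, if_false, add_zero] at ht
        exact Finset.mem_filter.2 ht
    · obtain ⟨U, hU1, hU2, hUc⟩ :=
        Finset.exists_subsuperset_card_eq (Finset.subset_union_left (s₁ := Lt) (s₂ := E)) h.le hcard
      refine ⟨U, hU2.trans hsub, hUc, fun t ht => hfit t (hU2 ht), le_trans ?_ hp⟩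
      rw [← hUc]
      norm_cast
      apply Finset.card_le_card
      intro t ht
      simp only [lightSet, Finset.mem_filter] at ht
      by_contra htU
      simp only [htU, if_false, add_zero] at ht
      exact htU (hU1 (Finset.mem_filter.2 ht))
  · push Not at hs
    have hcard : p ≤ E.card := by
      have hp0 : (0 : ℝ) ≤ p := by positivity
      have : (p : ℝ) ≤ E.card := by nlinarith
      exact_mod_cast this
    obtain ⟨U, hU, hUc⟩ := Finset.exists_subset_card_eq hcard
    refine ⟨U, hU.trans (Finset.filter_subset _ _), hUc, ?_, le_trans ?_ hlight⟩
    · intro t ht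
      rw [(Finset.mem_filter.1 (hU ht)).2]; linarith
    · norm_cast
      apply Finset.card_le_card
      intro t ht
      simp only [lightSet, Finset.mem_filter] at ht
      by_cases htU : t ∈ U
      · exfalso
        have := (Finset.mem_filter.1 (hU htU)).2
        simp only [htU, if_true, this] at ht
        linarith [ht.2.2]
      · simp only [htU, if_false, add_zero] at ht
        exact Finset.mem_filter.2 ht

lemma sched_one {ι : Type*} [DecidableEq ι] (T : ℤ) (hT : 2 ≤ T)
    (Ll Lr : ι → ℤ) (hL : ∀ j, BinLam T (Ll j) (Lr j)) (p : ι → ℕ) (s : ι → ℝ)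
    (hs0 : ∀ j, 0 < s j) (hs1 : ∀ j, s j ≤ 1) (lam : ℝ) (hlam : 0 < lam)
    (hp : ∀ j, (p j : ℝ) ≤ 4 * lam * ((Lr j - Ll j + 1 : ℤ) : ℝ)) (S : Finset ι) :
    (∀ l rr : ℤ, BinLam T l rr →
        ∑ j ∈ S.filter (fun j => Finset.Icc (Ll j) (Lr j) ⊆ Finset.Icc l rr),
            (p j : ℝ) * s j ≤ (1/2 - 2 * lam) * ((rr - l + 1 : ℤ) : ℝ)) →
    ∃ Tj : ι → Finset ℤ, (∀ j ∈ S, Tj j ⊆ Finset.Icc (Ll j) (Lr j) ∧ (Tj j).card = p j) ∧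
      (∀ t, ∑ j ∈ S with t ∈ Tj j, s j ≤ 1) ∧
      ∀ l r, BinLam T l r → (∀ x ∈ S, Lr x < l ∨ r < Ll x ∨ (l ≤ Ll x ∧ Lr x ≤ r)) →
        ((lightSet (fun t => ∑ j ∈ S with t ∈ Tj j, s j) l r).card : ℝ) ≤
          4 * lam * ((r - l + 1 : ℤ) : ℝ) := by
  induction S using Finset.induction_on_max_value (fun j => Lr j - Ll j) with
  | empty =>
    intro _
    refine ⟨fun _ => ∅, by simp, by simp, ?_⟩
    intro l r h _
    have hb := BinLam.bounds hT h
    have : (0 : ℝ) ≤ ((r - l + 1 : ℤ) : ℝ) := by exact_mod_cast (by omega : 0 ≤ r - l + 1)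
    simp only [lightSet, Finset.filter_empty, Finset.sum_empty, lt_irrefl, false_and,
      Finset.filter_false, Finset.card_empty, Nat.cast_zero]
    positivity
  | insert a S haS hmax ih =>
    intro hA
    obtain ⟨Tj, hTj, hld, hK⟩ := ih (by
      intro l r hlr
      refine le_trans (Finset.sum_le_sum_of_subset_of_nonneg ?_ ?_) (hA l r hlr)
      · exact Finset.filter_subset_filter _ (Finset.subset_insert _ _)
      · intro i _ _
        have := hs0 i
        positivity)
    have hcl : ∀ x ∈ S, Lr x < Ll a ∨ Lr a < Ll x ∨ (Ll a ≤ Ll x ∧ Lr x ≤ Lr a) := fun x hx =>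
      closed_of_le hT (hL a) (hL x) (hmax x hx)
    have harea := area_step Ll Lr p s hs0 S a haS Tj hTj hcl _ (hA _ _ (hL a))
    have hb := BinLam.bounds hT (hL a)
    set f : ℤ → ℝ := fun t => ∑ j ∈ S with t ∈ Tj j, s j with hf
    obtain ⟨U, hU1, hU2, hU3, hU4⟩ := choose_slots f
      (fun t => Finset.sum_nonneg fun x _ => (hs0 x).le) hld (Ll a) (Lr a) hb.2.1 lam (p a) (s a)
      (hs0 a) (hs1 a) (hp a) harea (hK _ _ (hL a) hcl)
    have hnew : ∀ t, ∑ j ∈ insert a S with t ∈ Function.update Tj a U j, s j =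
        f t + if t ∈ U then s a else 0 := by
      intro t
      have hcong : S.filter (fun j => t ∈ Function.update Tj a U j) =
          S.filter (fun j => t ∈ Tj j) := by
        apply Finset.filter_congr
        intro x hx
        have : x ≠ a := fun e => haS (e ▸ hx)
        simp [Function.update_of_ne this]
      rw [Finset.filter_insert, hcong, Function.update_self]
      split_ifs with ht
      · rw [Finset.sum_insert (by simp [haS])]; simp only [hf]; ring
      · simp [hf]
    refine ⟨Function.update Tj a U, ?_, ?_, ?_⟩
    · intro j hj
      by_cases hja : j = a
      · subst hja
        simp only [Function.update_self]
        exact ⟨hU1, hU2⟩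
      · rw [Function.update_of_ne hja]
        exact hTj j (Finset.mem_of_mem_insert_of_ne hj hja)
    · intro t
      rw [hnew]
      split_ifs with ht
      · exact hU3 t ht
      · simpa using hld t
    · simp_rw [hnew]
      have main : ∀ n : ℕ, ∀ l r, (r - l).toNat ≤ n → BinLam T l r →
          (∀ x ∈ insert a S, Lr x < l ∨ r < Ll x ∨ (l ≤ Ll x ∧ Lr x ≤ r)) →
          ((lightSet (fun t => f t + if t ∈ U then s a else 0) l r).card : ℝ) ≤
            4 * lam * ((r - l + 1 : ℤ) : ℝ) := by
        intro n
        induction n using Nat.strong_induction_on with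
        | _ n ihn =>
        intro l r hn h hcls
        have hlr := BinLam.bounds hT h
        have hdisj : (Lr a < l ∨ r < Ll a) →
          ((lightSet (fun t => f t + if t ∈ U then s a else 0) l r).card : ℝ) ≤
            4 * lam * ((r - l + 1 : ℤ) : ℝ) := by
          intro hd
          refine le_trans ?_ (hK l r h fun x hx => hcls x (Finset.mem_insert_of_mem hx))
          norm_cast
          apply Finset.card_le_card
          intro t ht
          simp only [lightSet, Finset.mem_filter] at *
          have htU : t ∉ U := by
            intro htU
            have h1 := Finset.mem_Icc.1 (hU1 htU)
            have h2 := Finset.mem_Icc.1 ht.1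
            omega
          simpa [htU] using ht
        have hchild : 1 < r - l → (∀ x ∈ insert a S, Lr x - Ll x < r - l) →
          ((lightSet (fun t => f t + if t ∈ U then s a else 0) l r).card : ℝ) ≤
            4 * lam * ((r - l + 1 : ℤ) : ℝ) := by
          intro h1 hx
          have c1 := ihn (((l + r) / 2 - l).toNat) (by omega) _ _ le_rfl (BinLam.left h h1) (by
            intro x hxS
            have q1 := hx x hxS
            have q2 := hcls x hxS
            have q3 := rel hT h (hL x)
            unfold Rel at q3
            omega)
          have c2 := ihn ((r - ((l + r) / 2 + 1)).toNat) (by omega) _ _ le_rfl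
            (BinLam.right h h1) (by
            intro x hxS
            have q1 := hx x hxS
            have q2 := hcls x hxS
            have q3 := rel hT h (hL x)
            unfold Rel at q3
            omega)
          have c3 := lightSet_split (fun t => f t + if t ∈ U then s a else 0) l r ((l + r) / 2)
          push_cast at c1 c2 ⊢
          linarith
        have hxs : Lr a - Ll a < r - l → ∀ x ∈ insert a S, Lr x - Ll x < r - l := by
          intro hlt x hx
          rcases Finset.mem_insert.1 hx with rfl | hx
          · exact hlt
          · have := hmax x hx
            omega
        have hca := hcls a (Finset.mem_insert_self _ _)
        have hrel := rel hT h (hL a)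
        unfold Rel at hrel
        rcases hrel with h1 | h1 | h1 | h1 | h1
        · exact hdisj (Or.inl h1)
        · exact hdisj (Or.inr h1)
        · have e1 : Ll a = l := by omega
          have e2 : Lr a = r := by omega
          rw [← e1, ← e2]
          exact hU4
        · exact hchild h1.1 (hxs (by omega))
        · exact hchild h1.1 (hxs (by omega))
      intro l r h hc
      exact main _ l r le_rfl h hc

lemma part_one {ι : Type*} (m : ℕ) (hm : 1 ≤ m) (T : ℤ) (hT : 2 ≤ T)
    (Ll Lr : ι → ℤ) (hL : ∀ j, BinLam T (Ll j) (Lr j)) (p : ι → ℕ) (s : ι → ℝ)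
    (hs0 : ∀ j, 0 < s j) (hs1 : ∀ j, s j ≤ 1) (lam : ℝ) (hlam : 0 < lam)
    (hp : ∀ j, (p j : ℝ) ≤ 4 * lam * ((Lr j - Ll j + 1 : ℤ) : ℝ)) (S : Finset ι)
    (hA : ∀ l rr : ℤ, BinLam T l rr →
        ∑ j ∈ S.filter (fun j => Finset.Icc (Ll j) (Lr j) ⊆ Finset.Icc l rr),
            (p j : ℝ) * s j ≤ (1/2 - 2 * lam) * m * ((rr - l + 1 : ℤ) : ℝ)) :
    Schedulable m Ll Lr p s S := by
  classical
  rcases hm.eq_or_lt with rfl | hm2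
  · obtain ⟨Tj, h1, h2, -⟩ := sched_one T hT Ll Lr hL p s hs0 hs1 lam hlam hp S (by simpa using hA)
    refine ⟨Tj, fun _ _ => 0, h1, fun i t => le_trans (le_of_eq ?_) (h2 t)⟩
    apply Finset.sum_congr _ fun _ _ => rfl
    apply Finset.filter_congr
    intro x _
    simp [Subsingleton.elim (0 : Fin 1) i]
  · obtain ⟨Tj, h1, h2⟩ := sched_ge_two m hm2 T hT Ll Lr hL p s hs0 hs1 lam hp S hA
    choose h hh using h2
    refine ⟨Tj, fun j t => h t j, h1, fun i t => ?_⟩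
    have := hh t i
    rwa [Finset.filter_filter] at this


lemma round_one {ι : Type*} [DecidableEq ι] (a : ι → ℝ) (ha : ∀ j, 0 < a j) (V : Finset ι)
    (y : ι → ℝ) (hy : ∀ j ∈ V, 0 ≤ y j ∧ y j ≤ 1) (c e : ℝ) (he0 : 0 ≤ e)
    (he : ∀ j ∈ V, a j ≤ e)
    (hone : ∀ i ∈ V, ∀ j ∈ V, (0 < y i ∧ y i < 1) → (0 < y j ∧ y j < 1) → i = j)
    (hc : ∑ j ∈ V, a j * y j ≤ c) : ∑ j ∈ V with y j ≠ 0, a j ≤ c + e := by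
  have h1 : ∑ j ∈ V with (0 < y j ∧ y j < 1), a j ≤ e := by
    rcases (V.filter (fun j => 0 < y j ∧ y j < 1)).eq_empty_or_nonempty with h | ⟨f, hf⟩
    · rw [h]; simpa using he0
    · have hf' := Finset.mem_filter.1 hf
      have : V.filter (fun j => 0 < y j ∧ y j < 1) = {f} := by
        ext x
        simp only [Finset.mem_filter, Finset.mem_singleton]
        constructor
        · rintro ⟨h1, h2⟩
          exact hone x h1 f hf'.1 h2 hf'.2
        · rintro rfl; exact hf'
      rw [this, Finset.sum_singleton]
      exact he f hf'.1
  have h2 : ∑ j ∈ V with y j ≠ 0, a j ≤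
      ∑ j ∈ V, a j * y j + ∑ j ∈ V with (0 < y j ∧ y j < 1), a j := by
    rw [Finset.sum_filter, Finset.sum_filter, ← Finset.sum_add_distrib]
    apply Finset.sum_le_sum
    intro x hx
    obtain ⟨q1, q2⟩ := hy x hx
    have hax := ha x
    by_cases h0 : y x = 0
    · simp [h0]
    · have hpos : 0 < y x := lt_of_le_of_ne q1 (Ne.symm h0)
      rw [if_pos h0]
      by_cases hl : y x < 1
      · rw [if_pos ⟨hpos, hl⟩]; nlinarith
      · rw [if_neg (by tauto)]
        have : y x = 1 := le_antisymm q2 (not_lt.1 hl)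
        rw [this]; linarith
  linarith

lemma round_lam {ι κ : Type*} [DecidableEq ι] (O : Finset ι) (a w : ι → ℝ) (ha : ∀ j, 0 < a j)
    (hw : ∀ j, 0 < w j) (U : κ → Finset ι) (hU : ∀ k, U k ⊆ O)
    (hlam : ∀ k k', Disjoint (U k) (U k') ∨ U k ⊆ U k' ∨ U k' ⊆ U k)
    (k0 : κ) (hk0 : U k0 = O) (c e : κ → ℝ) (he0 : ∀ k, 0 ≤ e k)
    (he : ∀ k, ∀ j ∈ U k, a j ≤ e k) (n : ℕ) :
    ∀ y : ι → ℝ, (∀ j ∈ O, 0 ≤ y j ∧ y j ≤ 1) →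
      (∀ k, ∑ j ∈ U k, a j * y j ≤ c k ∨
        ((∀ i ∈ U k, ∀ j ∈ U k, (0 < y i ∧ y i < 1) → (0 < y j ∧ y j < 1) → i = j) ∧
          ∑ j ∈ U k with y j ≠ 0, a j ≤ c k + e k)) →
      (O.filter (fun j => 0 < y j ∧ y j < 1)).card ≤ n →
      ∃ S ⊆ O, ∑ j ∈ O, w j * y j ≤ ∑ j ∈ S, w j ∧
        ∀ k, ∑ j ∈ U k with j ∈ S, a j ≤ c k + e k := by
  induction n using Nat.strong_induction_on with
  | _ n ih =>
  intro y hy hinv hn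
  by_cases hone : ∀ i ∈ O, ∀ j ∈ O, (0 < y i ∧ y i < 1) → (0 < y j ∧ y j < 1) → i = j
  · refine ⟨O.filter (fun j => y j ≠ 0), Finset.filter_subset _ _, ?_, ?_⟩
    · rw [Finset.sum_filter]
      apply Finset.sum_le_sum
      intro x hx
      obtain ⟨q1, q2⟩ := hy x hx
      have := hw x
      by_cases h0 : y x = 0
      · simp [h0]
      · rw [if_pos h0]; nlinarith
    · intro k
      have hset : (U k).filter (fun j => j ∈ O.filter (fun j => y j ≠ 0)) =
          (U k).filter (fun j => y j ≠ 0) := by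
        apply Finset.filter_congr
        intro x hx
        simp [hU k hx]
      rw [hset]
      rcases hinv k with h | h
      · exact round_one a ha (U k) y (fun j hj => hy j (hU k hj)) _ _ (he0 k) (he k)
          (fun i hi j hj => hone i (hU k hi) j (hU k hj)) h
      · exact h.2
  · -- two fractional jobs in a smallest common node
    have hex : ∃ N : ℕ, ∃ u : κ, (U u).card = N ∧ ∃ i ∈ U u, ∃ j ∈ U u,
        (0 < y i ∧ y i < 1) ∧ (0 < y j ∧ y j < 1) ∧ i ≠ j := by
      push Not at hone
      obtain ⟨i, hi, j, hj, h1, h2, h3⟩ := hone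
      exact ⟨_, k0, rfl, i, hk0 ▸ hi, j, hk0 ▸ hj, h1, h2, h3⟩
    classical
    obtain ⟨u, huN, i, hi, j, hj, hfi, hfj, hij⟩ := Nat.find_spec hex
    have hmin : ∀ k, (U k).card < (U u).card → ∀ i ∈ U k, ∀ j ∈ U k,
        (0 < y i ∧ y i < 1) → (0 < y j ∧ y j < 1) → i = j := by
      intro k hk i hi j hj h1 h2
      by_contra hne
      exact Nat.find_min hex (huN ▸ hk) ⟨k, rfl, i, hi, j, hj, h1, h2, hne⟩
    clear huN
    have step : ∀ i ∈ U u, ∀ j ∈ U u, (0 < y i ∧ y i < 1) → (0 < y j ∧ y j < 1) → i ≠ j →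
        w j * a i ≤ w i * a j → ∃ S ⊆ O, ∑ j ∈ O, w j * y j ≤ ∑ j ∈ S, w j ∧
        ∀ k, ∑ j ∈ U k with j ∈ S, a j ≤ c k + e k := by
      clear hi hj hfi hfj hij i j
      intro i hi j hj hfi hfj hij hd
      have hai := ha i
      have haj := ha j
      obtain ⟨δ, hδ⟩ : ∃ δ, δ = min ((1 - y i) * a i) (y j * a j) := ⟨_, rfl⟩
      have hδ0 : 0 < δ := by
        rw [hδ]; exact lt_min (mul_pos (by linarith [hfi.2]) hai) (mul_pos hfj.1 haj)
      have hδ1 : δ / a i ≤ 1 - y i := by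
        rw [div_le_iff₀ hai, hδ]; exact min_le_left _ _
      have hδ2 : δ / a j ≤ y j := by
        rw [div_le_iff₀ haj, hδ]; exact min_le_right _ _
      have hδ3 : δ / a i = 1 - y i ∨ δ / a j = y j := by
        rcases min_choice ((1 - y i) * a i) (y j * a j) with h | h
        · left; rw [hδ, h]; field_simp
        · right; rw [hδ, h]; field_simp
      have hpi : 0 < δ / a i := div_pos hδ0 hai
      have hpj : 0 < δ / a j := div_pos hδ0 haj
      obtain ⟨y', hy'⟩ : ∃ y' : ι → ℝ, y' = fun x => y x + (if x = i then δ / a i else 0) -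
        (if x = j then δ / a j else 0) := ⟨_, rfl⟩
      have hyi : y' i = y i + δ / a i := by simp [hy', hij]
      have hyj : y' j = y j - δ / a j := by simp [hy', hij.symm]
      have hyo : ∀ x, x ≠ i → x ≠ j → y' x = y x := by
        intro x h1 h2; simp [hy', h1, h2]
      have hsum : ∀ (g : ι → ℝ) (V : Finset ι), i ∈ V → j ∈ V →
          ∑ x ∈ V, g x * y' x = ∑ x ∈ V, g x * y x + g i * (δ / a i) - g j * (δ / a j) := by
        intro g V h1 h2
        simp only [hy', mul_add, mul_sub, Finset.sum_add_distrib, Finset.sum_sub_distrib, mul_ite,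
          mul_zero, Finset.sum_ite_eq', h1, h2, if_true]
      have hfrac : ∀ x, (0 < y' x ∧ y' x < 1) → (0 < y x ∧ y x < 1) := by
        intro x hx
        by_cases h1 : x = i
        · rw [h1]; exact hfi
        by_cases h2 : x = j
        · rw [h2]; exact hfj
        rwa [hyo x h1 h2] at hx
      have hsupp : ∀ x, y' x ≠ 0 → y x ≠ 0 := by
        intro x hx
        by_cases h1 : x = i
        · rw [h1]; exact hfi.1.ne'
        by_cases h2 : x = j
        · rw [h2]; exact hfj.1.ne'
        rwa [hyo x h1 h2] at hx
      have hiO := hU u hi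
      have hjO := hU u hj
      have hlt : (O.filter (fun j => 0 < y' j ∧ y' j < 1)).card < n := by
        refine lt_of_lt_of_le (Finset.card_lt_card ?_) hn
        rw [Finset.ssubset_iff_of_subset]
        · rcases hδ3 with h | h
          · refine ⟨i, Finset.mem_filter.2 ⟨hiO, hfi⟩, fun hc => ?_⟩
            have := (Finset.mem_filter.1 hc).2.2
            rw [hyi] at this; linarith
          · refine ⟨j, Finset.mem_filter.2 ⟨hjO, hfj⟩, fun hc => ?_⟩
            have := (Finset.mem_filter.1 hc).2.1
            rw [hyj] at this; linarith
        · intro x hx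
          exact Finset.mem_filter.2 ⟨(Finset.mem_filter.1 hx).1, hfrac x (Finset.mem_filter.1 hx).2⟩
      have hsmall : ∀ k, (U k).card < (U u).card →
          ((∀ i ∈ U k, ∀ j ∈ U k, (0 < y' i ∧ y' i < 1) → (0 < y' j ∧ y' j < 1) → i = j) ∧
          ∑ j ∈ U k with y' j ≠ 0, a j ≤ c k + e k) := by
        intro k hk
        refine ⟨fun p hp q hq h1 h2 => hmin k hk p hp q hq (hfrac p h1) (hfrac q h2), ?_⟩
        have : ∑ j ∈ U k with y j ≠ 0, a j ≤ c k + e k := by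
          rcases hinv k with h | h
          · exact round_one a ha (U k) y (fun j hj => hy j (hU k hj)) _ _ (he0 k) (he k)
              (hmin k hk) h
          · exact h.2
        refine le_trans (Finset.sum_le_sum_of_subset_of_nonneg ?_ fun x _ _ => (ha x).le) this
        intro x hx
        exact Finset.mem_filter.2 ⟨(Finset.mem_filter.1 hx).1, hsupp x (Finset.mem_filter.1 hx).2⟩
      have hcardlt : ∀ k, ∀ x ∈ U u, x ∈ U k → ∀ z ∈ U u, z ∉ U k → (U k).card < (U u).card := by
        intro k x hxu hxk z hzu hzk
        rcases hlam k u with h | h | h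
        · exact absurd hxu (Finset.disjoint_left.1 h hxk)
        · exact Finset.card_lt_card ((Finset.ssubset_iff_of_subset h).2 ⟨z, hzu, hzk⟩)
        · exact absurd (h hzu) hzk
      obtain ⟨S, hS1, hS2, hS3⟩ := ih _ hlt y' (by
        intro x hx
        by_cases h1 : x = i
        · rw [h1, hyi]; constructor <;> linarith [hfi.1]
        by_cases h2 : x = j
        · rw [h2, hyj]; constructor <;> linarith [hfj.2]
        rw [hyo x h1 h2]; exact hy x hx) (by
        intro k
        by_cases h1 : i ∈ U k
        · by_cases h2 : j ∈ U k
          · rcases hinv k with h | h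
            · left
              rw [hsum a _ h1 h2, mul_div_cancel₀ _ hai.ne', mul_div_cancel₀ _ haj.ne']
              linarith
            · exact absurd (h.1 i h1 j h2 hfi hfj) hij
          · exact Or.inr (hsmall k (hcardlt k i hi h1 j hj h2))
        · by_cases h2 : j ∈ U k
          · exact Or.inr (hsmall k (hcardlt k j hj h2 i hi h1))
          · have heq : ∀ x ∈ U k, y' x = y x := fun x hx =>
              hyo x (fun e => h1 (e ▸ hx)) (fun e => h2 (e ▸ hx))
            rcases hinv k with h | h
            · left
              rwa [Finset.sum_congr rfl fun x hx => by rw [heq x hx]]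
            · right
              refine ⟨fun p hp q hq h1 h2 => h.1 p hp q hq (hfrac p h1) (hfrac q h2), ?_⟩
              rw [Finset.filter_congr fun x hx => by rw [heq x hx]]
              exact h.2) le_rfl
      refine ⟨S, hS1, le_trans ?_ hS2, hS3⟩
      rw [hsum w O hiO hjO]
      have : w j * (δ / a j) ≤ w i * (δ / a i) := by
        rw [mul_div_assoc', mul_div_assoc', div_le_div_iff₀ haj hai]
        nlinarith
      linarith
    rcases le_total (w j * a i) (w i * a j) with h | h
    · exact step i hi j hj hfi hfj hij h
    · exact step j hj i hi hfj hfi hij.symm h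

lemma area_opt {ι : Type*} (m : ℕ) (r d : ι → ℤ) (p : ι → ℕ) (s : ι → ℝ)
    (hs0 : ∀ j, 0 < s j) (O X : Finset ι)
    (hO : Schedulable m r d p s O) (hX : X ⊆ O) (A B : ℤ) (hAB : A ≤ B)
    (h : ∀ j ∈ X, A ≤ r j ∧ d j ≤ B) :
    ∑ j ∈ X, (p j : ℝ) * s j ≤ m * ((B - A + 1 : ℤ) : ℝ) := by
  classical
  obtain ⟨Tj, hh, h1, h2⟩ := hO
  calc ∑ j ∈ X, (p j : ℝ) * s j
      = ∑ j ∈ X, ∑ t ∈ Finset.Icc A B, (if t ∈ Tj j then s j else 0) := by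
        apply Finset.sum_congr rfl
        intro j hj
        rw [← Finset.sum_filter, Finset.sum_const, nsmul_eq_mul, ← (h1 j (hX hj)).2]
        congr 3
        ext t
        simp only [Finset.mem_filter, Finset.mem_Icc]
        constructor
        · intro ht
          have := Finset.mem_Icc.1 ((h1 j (hX hj)).1 ht)
          have := h j hj
          exact ⟨by omega, ht⟩
        · exact fun ht => ht.2
    _ = ∑ t ∈ Finset.Icc A B, ∑ j ∈ X with t ∈ Tj j, s j := by
        rw [Finset.sum_comm]
        simp_rw [Finset.sum_filter]
    _ ≤ ∑ _t ∈ Finset.Icc A B, (m : ℝ) := by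
        apply Finset.sum_le_sum
        intro t _
        calc ∑ j ∈ X with t ∈ Tj j, s j ≤ ∑ j ∈ O with t ∈ Tj j, s j :=
              Finset.sum_le_sum_of_subset_of_nonneg (Finset.filter_subset_filter _ hX)
                fun x _ _ => (hs0 x).le
          _ = ∑ i : Fin m, ∑ j ∈ O.filter (fun j => t ∈ Tj j) with hh j t = i, s j :=
              (Finset.sum_fiberwise _ (fun j => hh j t) s).symm
          _ ≤ ∑ _i : Fin m, (1 : ℝ) := by
              apply Finset.sum_le_sum
              intro i _
              rw [Finset.filter_filter]
              exact h2 i t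
          _ = m := by simp
    _ = m * ((B - A + 1 : ℤ) : ℝ) := by
        rw [Finset.sum_const, nsmul_eq_mul, card_Icc_real hAB, mul_comm]

end MaxT

open MaxT in
theorem stmt_7 {ι : Type*} [Fintype ι]
    (m : ℕ) (hm : 1 ≤ m) (T : ℤ) (hT : 2 ≤ T)
    (r d : ι → ℤ) (p : ι → ℕ) (s w : ι → ℝ)
    (hrd : ∀ j, r j ≤ d j)
    (hr1 : ∀ j, 1 ≤ r j) (hdT : ∀ j, d j ≤ T)
    (hp1 : ∀ j, 1 ≤ p j)
    (hpw : ∀ j, (p j : ℤ) ≤ d j - r j + 1)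
    (hs0 : ∀ j, 0 < s j) (hs1 : ∀ j, s j ≤ 1)
    (hw : ∀ j, 0 < w j)
    (lam : ℝ) (hlam0 : 0 < lam) (hlam1 : lam < 1/4 - 1 / (2 * ((m : ℝ) + 2)))
    (hslack : ∀ j, (p j : ℝ) ≤ lam * ((d j - r j + 1 : ℤ) : ℝ))
    (Ll Lr : ι → ℤ) (hL : ∀ j, IsLMap T (r j) (d j) (Ll j) (Lr j))
    (W : ℝ)
    (hWach : ∃ O : Finset ι, Schedulable m r d p s O ∧ ∑ j ∈ O, w j = W)
    (hWmax : ∀ O : Finset ι, Schedulable m r d p s O → ∑ j ∈ O, w j ≤ W)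
    (ω : ℝ) (hω : ω = 1/2 - 4 * lam * (1/2 + 1/m)) :
    (∀ S : Finset ι,
      (∀ l rr : ℤ, BinLam T l rr →
        ∑ j ∈ S.filter (fun j => Finset.Icc (Ll j) (Lr j) ⊆ Finset.Icc l rr),
            (p j : ℝ) * s j
          ≤ (ω + 4 * lam / m) * m * ((rr - l + 1 : ℤ) : ℝ)) →
      Schedulable m Ll Lr p s S) ∧
    (∃ S : Finset ι,
      (∀ l rr : ℤ, BinLam T l rr →
        ∑ j ∈ S.filter (fun j => Finset.Icc (Ll j) (Lr j) ⊆ Finset.Icc l rr),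
            (p j : ℝ) * s j
          ≤ (ω + 4 * lam / m) * m * ((rr - l + 1 : ℤ) : ℝ)) ∧
      (1/8 - lam * (1/2 + 1/m)) * W ≤ ∑ j ∈ S, w j ∧
      Schedulable m Ll Lr p s S ∧
      Schedulable m r d p s S) := by
  classical
  have hm0 : (0 : ℝ) < m := by exact_mod_cast hm
  have hlam4 : lam < 1/4 := by
    have : (0 : ℝ) < 1 / (2 * ((m : ℝ) + 2)) := by positivity
    linarith
  have hω0 : 0 ≤ ω := by
    have e1 : (1/4 : ℝ) - 1 / (2 * ((m : ℝ) + 2)) = m / (4 * (m + 2)) := by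
      field_simp; ring
    rw [e1, lt_div_iff₀ (by positivity)] at hlam1
    have e2 : ω * (2 * m) = m - lam * (4 * (m + 2)) := by
      rw [hω]; field_simp
    have : 0 ≤ ω * (2 * m) := by rw [e2]; linarith
    by_contra hneg
    push Not at hneg
    nlinarith
  have hω1 : ω ≤ 1/2 := by
    rw [hω]
    have : 0 ≤ 4 * lam * (1/2 + 1/(m : ℝ)) := by positivity
    linarith
  have hcoef : (ω + 4 * lam / m) * m = (1/2 - 2 * lam) * m := by
    rw [hω]; field_simp; ring
  have hwin : ∀ j, r j + 4 ≤ d j := by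
    intro j
    have h1 : (1 : ℝ) ≤ p j := by exact_mod_cast hp1 j
    have h2 := hslack j
    by_contra hlt
    have h3 : ((d j - r j + 1 : ℤ) : ℝ) ≤ 4 := by exact_mod_cast (by omega : d j - r j + 1 ≤ 4)
    nlinarith
  have hquart : ∀ j, d j - r j + 1 ≤ 4 * (Lr j - Ll j + 1) := fun j =>
    quarter (hr1 j) (hdT j) (by have := hwin j; omega) (hL j)
  have hLB : ∀ j, BinLam T (Ll j) (Lr j) := fun j => (hL j).1
  have hL2 : ∀ j, Ll j + 1 ≤ Lr j := by
    intro j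
    have := hwin j
    have := hquart j
    omega
  have hp : ∀ j, (p j : ℝ) ≤ 4 * lam * ((Lr j - Ll j + 1 : ℤ) : ℝ) := by
    intro j
    have h1 : ((d j - r j + 1 : ℤ) : ℝ) ≤ 4 * ((Lr j - Ll j + 1 : ℤ) : ℝ) := by
      exact_mod_cast hquart j
    have h2 := hslack j
    nlinarith
  have hone : ∀ S : Finset ι,
      (∀ l rr : ℤ, BinLam T l rr →
        ∑ j ∈ S.filter (fun j => Finset.Icc (Ll j) (Lr j) ⊆ Finset.Icc l rr),
            (p j : ℝ) * s j
          ≤ (ω + 4 * lam / m) * m * ((rr - l + 1 : ℤ) : ℝ)) →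
      Schedulable m Ll Lr p s S := by
    intro S hS
    rw [hcoef] at hS
    exact part_one m hm T hT Ll Lr hLB p s hs0 hs1 lam hlam0 hp S hS
  refine ⟨hone, ?_⟩
  obtain ⟨O, hO, hOW⟩ := hWach
  have hsubiff : ∀ j l rr, Finset.Icc (Ll j) (Lr j) ⊆ Finset.Icc l rr ↔ l ≤ Ll j ∧ Lr j ≤ rr := by
    intro j l rr
    rw [Finset.Icc_subset_Icc_iff (by have := hL2 j; omega)]
  have hareaO : ∀ l rr, BinLam T l rr →
      ∑ j ∈ O.filter (fun j => Finset.Icc (Ll j) (Lr j) ⊆ Finset.Icc l rr), (p j : ℝ) * s j ≤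
        4 * m * ((rr - l + 1 : ℤ) : ℝ) := by
    intro l rr hB
    have hb := MaxT.BinLam.bounds hT hB
    by_cases h2 : l + 1 ≤ rr
    · obtain ⟨A, B, hAB, hlen, hext⟩ := extent hT hB h2
      refine (area_opt m r d p s hs0 O _ hO (Finset.filter_subset _ _) A B hAB ?_).trans ?_
      · intro j hj
        have hj2 := (hsubiff j l rr).1 (Finset.mem_filter.1 hj).2
        exact hext _ _ _ _ (hr1 j) (hdT j) (hL j) hj2.1 hj2.2
      · have : ((B - A + 1 : ℤ) : ℝ) ≤ 4 * ((rr - l + 1 : ℤ) : ℝ) := by exact_mod_cast hlen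
        nlinarith
    · have : O.filter (fun j => Finset.Icc (Ll j) (Lr j) ⊆ Finset.Icc l rr) = ∅ := by
        apply Finset.filter_false_of_mem
        intro j _ hj
        have := (hsubiff j l rr).1 hj
        have := hL2 j
        omega
      rw [this, Finset.sum_empty]
      have : (0 : ℝ) ≤ ((rr - l + 1 : ℤ) : ℝ) := by exact_mod_cast (by omega : 0 ≤ rr - l + 1)
      positivity
  obtain ⟨S, hSO, hSw, hSa⟩ := round_lam (κ := {q : ℤ × ℤ // BinLam T q.1 q.2}) O
    (fun j => (p j : ℝ) * s j) w
    (fun j => mul_pos (by exact_mod_cast hp1 j) (hs0 j)) hw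
    (fun q => O.filter (fun j => Finset.Icc (Ll j) (Lr j) ⊆ Finset.Icc q.1.1 q.1.2))
    (fun q => Finset.filter_subset _ _)
    (by
      intro q q'
      have hq := MaxT.BinLam.bounds hT q.2
      have hq' := MaxT.BinLam.bounds hT q'.2
      have hrel := rel hT q.2 q'.2
      unfold MaxT.Rel at hrel
      have hcases : (q'.1.2 < q.1.1 ∨ q.1.2 < q'.1.1) ∨ (q'.1.1 ≤ q.1.1 ∧ q.1.2 ≤ q'.1.2) ∨
          (q.1.1 ≤ q'.1.1 ∧ q'.1.2 ≤ q.1.2) := by omega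
      rcases hcases with h | h | h
      · left
        rw [Finset.disjoint_left]
        intro j hj hj'
        have e1 := (hsubiff j _ _).1 (Finset.mem_filter.1 hj).2
        have e2 := (hsubiff j _ _).1 (Finset.mem_filter.1 hj').2
        have := hL2 j
        omega
      · right; left
        intro j hj
        have e1 := Finset.mem_filter.1 hj
        exact Finset.mem_filter.2 ⟨e1.1, e1.2.trans (Finset.Icc_subset_Icc h.1 h.2)⟩
      · right; right
        intro j hj
        have e1 := Finset.mem_filter.1 hj
        exact Finset.mem_filter.2 ⟨e1.1, e1.2.trans (Finset.Icc_subset_Icc h.1 h.2)⟩)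
    ⟨(1, T), BinLam.root⟩
    (by
      apply Finset.filter_true_of_mem
      intro j _
      have := MaxT.BinLam.bounds hT (hLB j)
      exact Finset.Icc_subset_Icc this.1 this.2.2)
    (fun q => ω * m * ((q.1.2 - q.1.1 + 1 : ℤ) : ℝ))
    (fun q => 4 * lam * ((q.1.2 - q.1.1 + 1 : ℤ) : ℝ))
    (by
      intro q
      have hq := MaxT.BinLam.bounds hT q.2
      have : (0 : ℝ) ≤ ((q.1.2 - q.1.1 + 1 : ℤ) : ℝ) := by
        exact_mod_cast (by omega : 0 ≤ q.1.2 - q.1.1 + 1)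
      positivity)
    (by
      intro q j hj
      have e1 := (hsubiff j _ _).1 (Finset.mem_filter.1 hj).2
      have e2 : ((Lr j - Ll j + 1 : ℤ) : ℝ) ≤ ((q.1.2 - q.1.1 + 1 : ℤ) : ℝ) := by
        exact_mod_cast (by omega : Lr j - Ll j + 1 ≤ q.1.2 - q.1.1 + 1)
      have e3 := hp j
      have e4 : (p j : ℝ) * s j ≤ p j * 1 :=
        mul_le_mul_of_nonneg_left (hs1 j) (by positivity)
      nlinarith)
    _ (fun _ => ω / 4) (fun j _ => ⟨by linarith, by linarith⟩)
    (by
      intro q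
      left
      rw [← Finset.sum_mul]
      have := hareaO _ _ q.2
      nlinarith)
    le_rfl
  have hScond : ∀ l rr : ℤ, BinLam T l rr →
        ∑ j ∈ S.filter (fun j => Finset.Icc (Ll j) (Lr j) ⊆ Finset.Icc l rr),
            (p j : ℝ) * s j
          ≤ (ω + 4 * lam / m) * m * ((rr - l + 1 : ℤ) : ℝ) := by
    intro l rr hB
    have h1 := hSa ⟨(l, rr), hB⟩
    have hset : S.filter (fun j => Finset.Icc (Ll j) (Lr j) ⊆ Finset.Icc l rr) =
        (O.filter (fun j => Finset.Icc (Ll j) (Lr j) ⊆ Finset.Icc l rr)).filter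
          (fun j => j ∈ S) := by
      ext j
      simp only [Finset.mem_filter]
      constructor
      · exact fun h => ⟨⟨hSO h.1, h.2⟩, h.1⟩
      · exact fun h => ⟨h.2, h.1.2⟩
    rw [hset]
    refine h1.trans (le_of_eq ?_)
    have : (ω + 4 * lam / m) * m = ω * m + 4 * lam := by field_simp
    rw [this]
    ring
  have hSL := hone S hScond
  refine ⟨S, hScond, ?_, hSL, ?_⟩
  · rw [← Finset.sum_mul, hOW] at hSw
    refine le_trans (le_of_eq ?_) hSw
    rw [hω]; ring
  · obtain ⟨Tj, h, h1, h2⟩ := hSL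
    exact ⟨Tj, h, fun j hj => ⟨(h1 j hj).1.trans
      (Finset.Icc_subset_Icc (hL j).2.1 (hL j).2.2.1), (h1 j hj).2⟩, h2⟩
end

section
/- For every real λ ∈ (0,1/4) there exist constants c > 1 and θ > 0 (depending only on λ) with the following property. Let d ≥ 2, let (J, T, d) be a d-dimensional MinR instance with T ≥ 2 satisfying p_j ≤ λ·|χ_j| for every job j, let m ≥ 1 be an integer, and suppose that |χ_j| ≥ (1/m)·θ·d²·(log d)·log(√2·T) for every job j. If the instance admits a fractional configuration-LP solution of value m, then all jobs of J can be feasibly scheduled on ⌈c·m·log d⌉ + m hosts. -/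
open Finset

/-- `(S, t)` is a valid configuration: every job of `S` has `t` in its time window,
and the jobs of `S` jointly fit into one host in every one of the `d` resources. -/
def ValidConfig {ι : Type*} {d : ℕ} (r dd : ι → ℤ) (s : ι → Fin d → ℝ)
    (S : Finset ι) (t : ℤ) : Prop :=
  (∀ j ∈ S, t ∈ Finset.Icc (r j) (dd j)) ∧ ∀ i : Fin d, ∑ j ∈ S, s j i ≤ 1

/-- `x` is a fractional configuration-LP solution of value `m`:
`x` is supported on valid configurations, at most `m` (fractional) configurations
are picked at each time slot, each job appears with total fraction at most `1`
at each time slot, and each job `j` is covered for at least `p j` units. -/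
def ConfigLP {ι : Type*} [Fintype ι] [DecidableEq ι] {d : ℕ} (T : ℤ)
    (r dd : ι → ℤ) (p : ι → ℕ) (s : ι → Fin d → ℝ)
    (x : Finset ι → ℤ → ℝ) (m : ℕ) : Prop :=
  (∀ S t, 0 ≤ x S t) ∧
  (∀ S t, x S t ≠ 0 → ValidConfig r dd s S t) ∧
  (∀ t, ∑ S : Finset ι, x S t ≤ (m : ℝ)) ∧
  (∀ j : ι, ∀ t : ℤ, ∑ S ∈ Finset.univ.filter (fun S : Finset ι => j ∈ S), x S t ≤ 1) ∧
  (∀ j : ι, (p j : ℝ) ≤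
    ∑ t ∈ Finset.Icc 1 T, ∑ S ∈ Finset.univ.filter (fun S : Finset ι => j ∈ S), x S t)

/-- The whole job set is feasibly schedulable on `k` hosts (`d` resources):
each job `j` gets exactly `p j` slots in its window and a host per slot, and at
every host, slot and resource the total requirement is at most `1`. -/
def SchedulableD {ι : Type*} [Fintype ι] {d : ℕ} (k : ℕ)
    (r dd : ι → ℤ) (p : ι → ℕ) (s : ι → Fin d → ℝ) : Prop :=
  ∃ (Tj : ι → Finset ℤ) (h : ι → ℤ → Fin k),
    (∀ j : ι, Tj j ⊆ Finset.Icc (r j) (dd j) ∧ (Tj j).card = p j) ∧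
    ∀ (i : Fin k) (t : ℤ) (c : Fin d),
      ∑ j ∈ Finset.univ.filter (fun j : ι => t ∈ Tj j ∧ h j t = i), s j c ≤ 1


/-- bin packing -/
lemma binpack {ι : Type*} [DecidableEq ι] (σ : ι → ℝ) (m : ℕ) (hm : 1 ≤ m)
    (h0 : ∀ j, 0 ≤ σ j) (h1 : ∀ j, σ j ≤ 1) (U : Finset ι) (hU : ∑ j ∈ U, σ j ≤ 2 * m) :
    ∃ h : ι → Fin (4 * m), ∀ i, ∑ j ∈ U.filter (fun j => h j = i), σ j ≤ 1 := by
  revert hU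
  induction U using Finset.induction_on_min_value σ with
  | empty => exact fun _ => ⟨fun _ => ⟨0, by omega⟩, fun i => by simp⟩
  | insert a s ha hs ih =>
    intro hU
    rw [Finset.sum_insert ha] at hU
    obtain ⟨h, hh⟩ := ih (by linarith [h0 a])
    have key : ∃ i, ∑ j ∈ s.filter (fun j => h j = i), σ j + σ a ≤ 1 := by
      by_contra! hc
      have h2 : ∀ i, (1:ℝ)/2 ≤ ∑ j ∈ s.filter (fun j => h j = i), σ j := by
        intro i
        have hne : (s.filter (fun j => h j = i)).Nonempty := by
          rw [Finset.nonempty_iff_ne_empty]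
          intro he
          have := hc i
          rw [he] at this
          simp at this
          linarith [h1 a]
        obtain ⟨b, hb⟩ := hne
        have h3 : σ b ≤ ∑ j ∈ s.filter (fun j => h j = i), σ j :=
          Finset.single_le_sum (f := σ) (fun j _ => h0 j) hb
        have h4 := hs b (Finset.mem_filter.1 hb).1
        linarith [hc i]
      have h5 : ∑ i : Fin (4*m), ∑ j ∈ s.filter (fun j => h j = i), σ j = ∑ j ∈ s, σ j :=
        Finset.sum_fiberwise s h σ
      have h6 : ∑ i : Fin (4*m), (1:ℝ)/2 ≤ ∑ j ∈ s, σ j := by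
        rw [← h5]; exact Finset.sum_le_sum (fun i _ => h2 i)
      simp at h6
      have hz : σ a ≤ 0 := by linarith
      have i0 : Fin (4*m) := ⟨0, by omega⟩
      linarith [hc i0, hh i0]
    obtain ⟨i, hi⟩ := key
    refine ⟨Function.update h a i, fun k => ?_⟩
    have e : s.filter (fun j => Function.update h a i j = k) = s.filter (fun j => h j = k) := by
      apply Finset.filter_congr
      intro j hj
      rw [Function.update_of_ne]
      rintro rfl; exact ha hj
    rw [Finset.filter_insert, e]
    simp only [Function.update_self]
    split_ifs with hk
    · subst hk
      rw [Finset.sum_insert (by simp [ha])]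
      linarith
    · exact hh k

/-- splitting a fractional assignment in groups -/
lemma groups (y : ℤ → ℝ) (hy0 : ∀ t, 0 ≤ y t) (hy1 : ∀ t, y t ≤ 1) (p : ℕ) :
    ∀ W : Finset ℤ, (p : ℝ) - 1/2 ≤ ∑ t ∈ W, y t →
    ∃ G : Fin p → Finset ℤ, (∀ g, G g ⊆ W) ∧ (∀ g, 1/2 ≤ ∑ t ∈ G g, y t) ∧
      ∀ A : Finset ℤ, (p : ℝ) ≤ ((A ∩ W).card : ℝ) +
        ∑ g, if Disjoint (G g) A then (1:ℝ) else 0 := by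
  induction p with
  | zero => intro W _; exact ⟨fun _ => ∅, by simp, fun g => g.elim0, fun A => by simp⟩
  | succ p ih =>
    intro W hW
    push_cast at hW
    have hp : (0:ℝ) ≤ p := Nat.cast_nonneg p
    have hex : (W.powerset.filter (fun G => (1:ℝ)/2 ≤ ∑ t ∈ G, y t)).Nonempty :=
      ⟨W, by simp; linarith⟩
    obtain ⟨G0, hG0⟩ := Finset.exists_minimal hex
    have hG0m := hG0.1
    simp only [Finset.mem_filter, Finset.mem_powerset] at hG0m
    obtain ⟨hsub, hge⟩ := hG0m
    have hmin : ∀ G' ⊆ G0, (1:ℝ)/2 ≤ ∑ t ∈ G', y t → G0 ⊆ G' := by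
      intro G' h' h2
      exact hG0.2 (by simp only [Finset.mem_filter, Finset.mem_powerset]; exact ⟨h'.trans hsub, h2⟩) h'
    have hle : ∑ t ∈ G0, y t ≤ 1 := by
      rcases G0.eq_empty_or_nonempty with h | ⟨a, ha⟩
      · simp [h]
      by_cases hya : y a ≤ 1/2
      · have := Finset.add_sum_erase G0 y ha
        by_contra! hc
        have h3 := hmin (G0.erase a) (Finset.erase_subset _ _) (by linarith)
        exact Finset.notMem_erase a G0 (h3 ha)
      · have h3 := hmin {a} (by simpa using ha) (by simp; push Not at hya; norm_num at hya; linarith)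
        calc ∑ t ∈ G0, y t ≤ ∑ t ∈ {a}, y t := Finset.sum_le_sum_of_subset_of_nonneg h3 (fun _ _ _ => hy0 _)
          _ ≤ 1 := by simpa using hy1 a
    obtain ⟨G, hG1, hG2, hG3⟩ := ih (W \ G0) (by
      have := Finset.sum_sdiff (f := y) hsub
      linarith)
    refine ⟨Fin.cons G0 G, ?_, ?_, ?_⟩
    · intro g
      refine Fin.cases ?_ (fun g => ?_) g
      · simpa using hsub
      · simpa using (hG1 g).trans Finset.sdiff_subset
    · intro g
      refine Fin.cases ?_ (fun g => ?_) g
      · simpa using hge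
      · simpa using hG2 g
    · intro A
      rw [Fin.sum_univ_succ]
      simp only [Fin.cons_zero, Fin.cons_succ]
      have h3 := hG3 A
      have h4 : (A ∩ W).card = (A ∩ (W \ G0)).card + (A ∩ G0).card := by
        rw [← Finset.card_union_of_disjoint]
        · congr 1
          ext t
          have := @hsub t
          simp only [Finset.mem_inter, Finset.mem_union, Finset.mem_sdiff]
          tauto
        · rw [Finset.disjoint_left]; intro t; simp; tauto
      rw [h4]
      push_cast
      have h5 : (1:ℝ) ≤ ((A ∩ G0).card : ℝ) + if Disjoint G0 A then (1:ℝ) else 0 := by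
        split_ifs with hd
        · linarith [Nat.cast_nonneg (α := ℝ) (A ∩ G0).card]
        · rw [Finset.not_disjoint_iff] at hd
          obtain ⟨t, h1, h2⟩ := hd
          have : 0 < (A ∩ G0).card := Finset.card_pos.2 ⟨t, by simp [h1, h2]⟩
          have : (1:ℝ) ≤ (A ∩ G0).card := by exact_mod_cast this
          linarith
      linarith

/-- greedy scheduling of the residual -/
lemma greedy {ι : Type*} [DecidableEq ι] (σ : ι → ℝ) (m : ℕ) (hm : 1 ≤ m)
    (h0 : ∀ j, 0 ≤ σ j) (h1 : ∀ j, σ j ≤ 1) (r dd : ι → ℤ) (T : ℤ)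
    (hw : ∀ j, 1 ≤ r j ∧ dd j ≤ T ∧ r j ≤ dd j)
    (A : ι → Finset ℤ) (q : ι → ℕ)
    (hA : ∀ j, q j ≠ 0 → 4 * (((A j).card : ℝ) + q j) ≤ ((dd j - r j + 1 : ℤ) : ℝ))
    (V : Finset ι)
    (hV : ∀ j a b, 1 ≤ a → b ≤ T → a ≤ r j → dd j ≤ b →
      ∑ i ∈ V.filter (fun i => a ≤ r i ∧ dd i ≤ b), (q i : ℝ) * σ i
        ≤ m * ((b - a + 1 : ℤ) : ℝ) / 4) 
    (U : Finset ι) (hUV : U ⊆ V) :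
    ∃ B : ι → Finset ℤ, (∀ j ∈ U, B j ⊆ Finset.Icc (r j) (dd j) ∧ Disjoint (A j) (B j)
        ∧ (B j).card = q j) ∧
      ∀ t, ∑ j ∈ U.filter (fun j => t ∈ B j), σ j ≤ 2 * m := by
  revert hUV
  induction U using Finset.induction_on_max_value (fun j => dd j - r j) with
  | empty => exact fun _ => ⟨fun _ => ∅, by simp, by simp⟩
  | insert a s ha hs ih =>
    intro hUV
    obtain ⟨B, hB1, hB2⟩ := ih ((Finset.subset_insert _ _).trans hUV)
    have hm' : (1:ℝ) ≤ m := by exact_mod_cast hm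
    set load : ℤ → ℝ := fun t => ∑ j ∈ s.filter (fun j => t ∈ B j), σ j with hload
    have hload0 : ∀ t, 0 ≤ load t := fun t => Finset.sum_nonneg (fun j _ => h0 j)
    have key : ∃ Ba ⊆ ((Finset.Icc (r a) (dd a)).filter (fun t => load t ≤ m)) \ A a,
        Ba.card = q a := by
      by_cases hq : q a = 0
      · exact ⟨∅, by simp, by simp [hq]⟩
      apply Finset.exists_subset_card_eq
      set X := Finset.Icc (r a) (dd a) with hX
      have hXc : ((X.card : ℕ) : ℝ) = ((dd a - r a + 1 : ℤ) : ℝ) := by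
        rw [hX, Int.card_Icc]
        have : (((dd a + 1 - r a).toNat : ℤ)) = dd a - r a + 1 := by
          have := (hw a).2.2; omega
        exact_mod_cast this
      have hsplit := Finset.card_filter_add_card_filter_not (s := X) (fun t => load t ≤ m)
      have hbad : (m:ℝ) * ((X.filter (fun t => ¬ load t ≤ m)).card : ℝ) ≤ ∑ t ∈ X, load t := by
        calc (m:ℝ) * ((X.filter (fun t => ¬ load t ≤ m)).card : ℝ)
            = ∑ t ∈ X.filter (fun t => ¬ load t ≤ m), (m:ℝ) := by simp [mul_comm]
          _ ≤ ∑ t ∈ X.filter (fun t => ¬ load t ≤ m), load t := by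
              apply Finset.sum_le_sum
              intro t ht
              have := (Finset.mem_filter.1 ht).2
              linarith
          _ ≤ _ := Finset.sum_le_sum_of_subset_of_nonneg (Finset.filter_subset _ _)
              (fun t _ _ => hload0 t)
      set a' := max 1 (r a - (dd a - r a + 1)) with ha'
      set b' := min T (dd a + (dd a - r a + 1)) with hb'
      have hwa := hw a
      have htot : ∑ t ∈ X, load t ≤
          ∑ i ∈ V.filter (fun i => a' ≤ r i ∧ dd i ≤ b'), (q i : ℝ) * σ i := by
        have e1 : ∑ t ∈ X, load t = ∑ j ∈ s, ((X.filter (fun t => t ∈ B j)).card : ℝ) * σ j := by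
          simp only [hload, Finset.sum_filter]
          rw [Finset.sum_comm]
          apply Finset.sum_congr rfl
          intro j _
          rw [← Finset.sum_filter]
          simp
        rw [e1]
        calc ∑ j ∈ s, ((X.filter (fun t => t ∈ B j)).card : ℝ) * σ j
            ≤ ∑ j ∈ s, if (a' ≤ r j ∧ dd j ≤ b') then (q j : ℝ) * σ j else 0 := by
              apply Finset.sum_le_sum
              intro j hj
              obtain ⟨hj1, hj2, hj3⟩ := hB1 j hj
              split_ifs with hc
              · apply mul_le_mul_of_nonneg_right _ (h0 j)
                rw [← hj3]
                exact_mod_cast Finset.card_le_card (fun t ht => (Finset.mem_filter.1 ht).2)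
              · have : X.filter (fun t => t ∈ B j) = ∅ := by
                  rw [Finset.filter_eq_empty_iff]
                  intro t ht ht2
                  apply hc
                  have h3 := hj1 ht2
                  rw [hX, Finset.mem_Icc] at ht
                  rw [Finset.mem_Icc] at h3
                  have h4 := hs j hj
                  have h5 := hw j
                  omega
                rw [this]; simp
          _ = ∑ j ∈ s.filter (fun i => a' ≤ r i ∧ dd i ≤ b'), (q j : ℝ) * σ j := by
              rw [Finset.sum_filter]
          _ ≤ _ := by
              apply Finset.sum_le_sum_of_subset_of_nonneg
              · exact Finset.filter_subset_filter _ ((Finset.subset_insert _ _).trans hUV)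
              · intro i _ _; exact mul_nonneg (Nat.cast_nonneg _) (h0 i)
      have hV' := hV a a' b' (by omega) (by omega) (by omega) (by omega)
      have hlen : ((b' - a' + 1 : ℤ) : ℝ) ≤ 3 * (X.card : ℝ) := by
        rw [hXc]
        have : b' - a' + 1 ≤ 3 * (dd a - r a + 1) := by omega
        exact_mod_cast this
      have hbad2 : ((X.filter (fun t => ¬ load t ≤ m)).card : ℝ) ≤ 3/4 * X.card := by
        have : (m:ℝ) * ((X.filter (fun t => ¬ load t ≤ m)).card : ℝ) ≤ m * (3/4 * X.card) := by
          calc _ ≤ _ := hbad.trans (htot.trans hV')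
            _ ≤ m * (3 * (X.card:ℝ)) / 4 := by gcongr
            _ = _ := by ring
        exact le_of_mul_le_mul_left this (by linarith)
      have h6 := hA a hq
      rw [← hXc] at h6
      have h7 : ((X.filter (fun t => load t ≤ m)).card : ℝ) + ((X.filter (fun t => ¬ load t ≤ m)).card : ℝ) = X.card := by
        exact_mod_cast hsplit
      have h8 : (((A a).card + q a : ℕ) : ℝ) ≤ ((X.filter (fun t => load t ≤ m)).card : ℝ) := by
        push_cast; linarith
      have h9 : (A a).card + q a ≤ (X.filter (fun t => load t ≤ m)).card := by exact_mod_cast h8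
      have h10 := Finset.le_card_sdiff (A a) (X.filter (fun t => load t ≤ m))
      omega
    obtain ⟨Ba, hBa, hBac⟩ := key
    have hBa' : ∀ t ∈ Ba, (r a ≤ t ∧ t ≤ dd a) ∧ load t ≤ m ∧ t ∉ A a := by
      intro t ht
      have := hBa ht
      simp only [Finset.mem_sdiff, Finset.mem_filter, Finset.mem_Icc] at this
      tauto
    refine ⟨Function.update B a Ba, ?_, ?_⟩
    · intro j hj
      rcases Finset.mem_insert.1 hj with rfl | hj'
      · simp only [Function.update_self]
        refine ⟨fun t ht => Finset.mem_Icc.2 (hBa' t ht).1, ?_, hBac⟩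
        rw [Finset.disjoint_right]
        exact fun t ht => (hBa' t ht).2.2
      · have hne : j ≠ a := by
          intro h; rw [h] at hj'; exact ha hj'
        rw [Function.update_of_ne hne]
        exact hB1 j hj'
    · intro t
      have e : s.filter (fun j => t ∈ Function.update B a Ba j) = s.filter (fun j => t ∈ B j) := by
        apply Finset.filter_congr
        intro j hj
        rw [Function.update_of_ne]
        rintro rfl; exact ha hj
      rw [Finset.filter_insert, e]
      simp only [Function.update_self]
      split_ifs with hk
      · rw [Finset.sum_insert (by simp [ha])]
        have := (hBa' t hk).2.1
        simp only [hload] at this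
        linarith [h1 a]
      · exact hB2 t

/-- expectation w.r.t. a product weight -/
noncomputable def Ex {κ Ω : Type*} [Fintype κ] [Fintype Ω] [DecidableEq κ]
    (w : κ → Ω → ℝ) (f : (κ → Ω) → ℝ) : ℝ := ∑ ω, (∏ i, w i (ω i)) * f ω

section
variable {κ Ω : Type*} [Fintype κ] [Fintype Ω] [DecidableEq κ]

lemma Ex_mono {w : κ → Ω → ℝ} (hw : ∀ i a, 0 ≤ w i a) {f g : (κ → Ω) → ℝ}
    (h : ∀ ω, f ω ≤ g ω) : Ex w f ≤ Ex w g :=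
  Finset.sum_le_sum (fun ω _ => mul_le_mul_of_nonneg_left (h ω) (Finset.prod_nonneg (fun i _ => hw i _)))

lemma Ex_prod (w : κ → Ω → ℝ) (g : κ → Ω → ℝ) :
    Ex w (fun ω => ∏ i, g i (ω i)) = ∏ i, ∑ a, w i a * g i a := by
  unfold Ex
  rw [Finset.prod_univ_sum]
  simp only [Fintype.piFinset_univ, Finset.prod_mul_distrib]

lemma Ex_one {w : κ → Ω → ℝ} (hw : ∀ i, ∑ a, w i a = 1) : Ex w (fun _ => 1) = 1 := by
  have := Ex_prod w (fun _ _ => 1)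
  simpa [hw] using this

lemma Ex_const {w : κ → Ω → ℝ} (hw : ∀ i, ∑ a, w i a = 1) (c : ℝ) : Ex w (fun _ => c) = c := by
  have := Ex_one hw
  unfold Ex at *
  rw [← Finset.sum_mul]
  simp only [mul_one] at this
  rw [this, one_mul]

lemma Ex_mul (w : κ → Ω → ℝ) (c : ℝ) (f : (κ → Ω) → ℝ) :
    Ex w (fun ω => c * f ω) = c * Ex w f := by
  unfold Ex
  rw [Finset.mul_sum]
  exact Finset.sum_congr rfl (fun _ _ => by ring)

lemma Ex_add (w : κ → Ω → ℝ) (f g : (κ → Ω) → ℝ) :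
    Ex w (fun ω => f ω + g ω) = Ex w f + Ex w g := by
  unfold Ex
  rw [← Finset.sum_add_distrib]
  exact Finset.sum_congr rfl (fun _ _ => by ring)

lemma Ex_sum {α : Type*} (w : κ → Ω → ℝ) (s : Finset α) (f : α → (κ → Ω) → ℝ) :
    Ex w (fun ω => ∑ a ∈ s, f a ω) = ∑ a ∈ s, Ex w (f a) := by
  unfold Ex
  rw [Finset.sum_comm]
  exact Finset.sum_congr rfl (fun _ _ => by rw [Finset.mul_sum])

end

lemma hoeff {Ω : Type*} [Fintype Ω] (w : Ω → ℝ) (hw0 : ∀ a, 0 ≤ w a) (hw : ∑ a, w a = 1)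
    (g : Ω → ℝ) (c : ℝ) (hc1 : c ≤ 1) (hg : ∀ a b, g a ≤ g b + c) :
    ∑ a, w a * Real.exp (g a) ≤ Real.exp (∑ a, w a * g a + c ^ 2) := by
  set μ := ∑ a, w a * g a with hμ
  have h1 : ∀ a, |g a - μ| ≤ c := by
    intro a
    have e : g a - μ = ∑ b, w b * (g a - g b) := by
      simp only [mul_sub, Finset.sum_sub_distrib, ← Finset.sum_mul, hw, hμ, one_mul]
    have e2 : c = ∑ b, w b * c := by rw [← Finset.sum_mul, hw, one_mul]
    rw [abs_le]
    constructor
    · rw [e, e2, ← Finset.sum_neg_distrib]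
      exact Finset.sum_le_sum (fun b _ => by nlinarith [hw0 b, hg b a])
    · rw [e]
      refine le_trans ?_ e2.symm.le
      exact Finset.sum_le_sum (fun b _ => by nlinarith [hw0 b, hg a b])
  have h2 : ∀ a, Real.exp (g a) ≤ Real.exp μ * (1 + (g a - μ) + c ^ 2) := by
    intro a
    have h3 := Real.abs_exp_sub_one_sub_id_le ((h1 a).trans hc1)
    have h4 : (g a - μ) ^ 2 ≤ c ^ 2 := sq_le_sq' (by linarith [(abs_le.1 (h1 a)).1]) (abs_le.1 (h1 a)).2
    have h5 := (abs_le.1 h3).2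
    calc Real.exp (g a) = Real.exp μ * Real.exp (g a - μ) := by rw [← Real.exp_add]; ring_nf
      _ ≤ _ := mul_le_mul_of_nonneg_left (by linarith) (Real.exp_pos _).le
  calc ∑ a, w a * Real.exp (g a) ≤ ∑ a, w a * (Real.exp μ * (1 + (g a - μ) + c ^ 2)) :=
        Finset.sum_le_sum (fun a _ => mul_le_mul_of_nonneg_left (h2 a) (hw0 a))
    _ = Real.exp μ * ((∑ a, w a) * (1 - μ + c^2) + ∑ a, w a * g a) := by
        rw [Finset.sum_mul, ← Finset.sum_add_distrib, Finset.mul_sum]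
        exact Finset.sum_congr rfl (fun _ _ => by ring)
    _ = Real.exp μ * (1 + c^2) := by rw [hw, ← hμ]; ring
    _ ≤ Real.exp μ * Real.exp (c^2) := mul_le_mul_of_nonneg_left (by linarith [Real.add_one_le_exp (c^2)]) (Real.exp_pos _).le
    _ = _ := by rw [← Real.exp_add]

lemma Ex_succ {Ω : Type*} [Fintype Ω] {n : ℕ} (w : Fin (n+1) → Ω → ℝ) (f : (Fin (n+1) → Ω) → ℝ) :
    Ex w f = ∑ a, w 0 a * Ex (fun i => w i.succ) (fun ω => f (Fin.cons a ω)) := by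
  unfold Ex
  rw [← (Fin.consEquiv (fun _ : Fin (n+1) => Ω)).sum_comp, Fintype.sum_prod_type]
  apply Finset.sum_congr rfl
  intro a _
  rw [Finset.mul_sum]
  apply Finset.sum_congr rfl
  intro ω _
  rw [Fin.prod_univ_succ]
  simp [Fin.consEquiv, mul_assoc]

lemma mcd_fin {Ω : Type*} [Fintype Ω] (n : ℕ) : ∀ (w : Fin n → Ω → ℝ) (_ : ∀ i a, 0 ≤ w i a)
    (_ : ∀ i, ∑ a, w i a = 1) (f : (Fin n → Ω) → ℝ) (c : Fin n → ℝ) (_ : ∀ i, c i ≤ 1)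
    (_ : ∀ i ω a, f ω ≤ f (Function.update ω i a) + c i),
    Ex w (fun ω => Real.exp (f ω)) ≤ Real.exp (Ex w f + ∑ i, c i ^ 2) := by
  induction n with
  | zero => intro w _ _ f c _ _; simp [Ex]
  | succ n ih =>
    intro w hw0 hw1 f c hc hf
    rw [Ex_succ, Ex_succ, Fin.sum_univ_succ]
    set g : Ω → ℝ := fun a => Ex (fun i => w i.succ) (fun ω => f (Fin.cons a ω)) with hg
    set C := ∑ i : Fin n, c i.succ ^ 2 with hC
    have step : ∀ a, Ex (fun i => w i.succ) (fun ω => Real.exp (f (Fin.cons a ω)))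
        ≤ Real.exp (g a + C) := by
      intro a
      apply ih (fun i => w i.succ) (fun i a => hw0 _ _) (fun i => hw1 _) (fun ω => f (Fin.cons a ω))
        (fun i => c i.succ) (fun i => hc _)
      intro i ω b
      have := hf i.succ (Fin.cons a ω) b
      rwa [← Fin.cons_update] at this
    have hgd : ∀ a b, g a ≤ g b + c 0 := by
      intro a b
      have hcst := Ex_const (w := fun i : Fin n => w i.succ) (fun i => hw1 _) (c 0)
      rw [hg, ← hcst]
      simp only
      rw [← Ex_add]
      apply Ex_mono (fun i a => hw0 _ _)
      intro ω
      have := hf 0 (Fin.cons a ω) b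
      rwa [Fin.update_cons_zero] at this
    have h := hoeff (w 0) (hw0 0) (hw1 0) g (c 0) (hc 0) hgd
    calc ∑ a, w 0 a * Ex (fun i => w i.succ) (fun ω => Real.exp (f (Fin.cons a ω)))
        ≤ ∑ a, w 0 a * Real.exp (g a + C) :=
          Finset.sum_le_sum (fun a _ => mul_le_mul_of_nonneg_left (step a) (hw0 _ _))
      _ = (∑ a, w 0 a * Real.exp (g a)) * Real.exp C := by
          rw [Finset.sum_mul]
          exact Finset.sum_congr rfl (fun a _ => by rw [Real.exp_add]; ring)
      _ ≤ Real.exp (∑ a, w 0 a * g a + c 0 ^ 2) * Real.exp C :=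
          mul_le_mul_of_nonneg_right h (Real.exp_pos _).le
      _ = _ := by rw [← Real.exp_add, add_assoc]

lemma mcd {κ Ω : Type*} [Fintype κ] [Fintype Ω] [DecidableEq κ]
    (w : κ → Ω → ℝ) (hw0 : ∀ i a, 0 ≤ w i a)
    (hw1 : ∀ i, ∑ a, w i a = 1) (f : (κ → Ω) → ℝ) (c : κ → ℝ) (hc : ∀ i, c i ≤ 1)
    (hf : ∀ i ω a, f ω ≤ f (Function.update ω i a) + c i) :
    Ex w (fun ω => Real.exp (f ω)) ≤ Real.exp (Ex w f + ∑ i, c i ^ 2) := by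
  let e := Fintype.equivFin κ
  have tr : ∀ g : (κ → Ω) → ℝ, Ex w g = Ex (fun i => w (e.symm i)) (fun ω => g (fun k => ω (e k))) := by
    intro g
    unfold Ex
    rw [← (e.arrowCongr (Equiv.refl Ω)).symm.sum_comp]
    apply Finset.sum_congr rfl
    intro ω _
    congr 1
    rw [← e.symm.prod_comp]
    simp [Equiv.arrowCongr]
  rw [tr, tr, ← e.symm.sum_comp]
  apply mcd_fin _ (fun i => w (e.symm i)) (fun i a => hw0 _ _) (fun i => hw1 _) (fun ω => f (fun k => ω (e k)))
    (fun i => c (e.symm i)) (fun i => hc _)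
  intro i ω a
  have := hf (e.symm i) (fun k => ω (e k)) a
  convert this using 3
  ext k
  simp only [Function.update_apply, Equiv.eq_symm_apply]

open Classical in
/-- slots in which job `j` is covered by the sampled (valid) configurations -/
noncomputable def cov {ι : Type*} {T : ℤ} {K : ℕ} (P : Finset ι → ℤ → Prop)
    (ω : ↥(Finset.Icc (1:ℤ) T) × Fin K → Finset ι) (j : ι) : Finset ℤ :=
  (Finset.univ.filter (fun i : ↥(Finset.Icc (1:ℤ) T) × Fin K => P (ω i) i.1 ∧ j ∈ ω i)).image
    (fun i => (i.1 : ℤ))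

lemma mem_cov {ι : Type*} {T : ℤ} {K : ℕ} {P : Finset ι → ℤ → Prop}
    {ω : ↥(Finset.Icc (1:ℤ) T) × Fin K → Finset ι} {j : ι} {t : ℤ} :
    t ∈ cov P ω j ↔ ∃ i : ↥(Finset.Icc (1:ℤ) T) × Fin K, (i.1 : ℤ) = t ∧ P (ω i) t ∧ j ∈ ω i := by
  unfold cov
  simp only [Finset.mem_image, Finset.mem_filter, Finset.mem_univ, true_and]
  constructor
  · rintro ⟨i, ⟨h1, h2⟩, rfl⟩; exact ⟨i, rfl, h1, h2⟩
  · rintro ⟨i, rfl, h1, h2⟩; exact ⟨i, ⟨h1, h2⟩, rfl⟩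

open Classical in
lemma unhit {ι : Type*} [Fintype ι] {T : ℤ} {K : ℕ} (P : Finset ι → ℤ → Prop)
    (w : ↥(Finset.Icc (1:ℤ) T) × Fin K → Finset ι → ℝ) (hw0 : ∀ i a, 0 ≤ w i a)
    (hw1 : ∀ i, ∑ a, w i a = 1) (j : ι) (z : ℤ → ℝ)
    (hz : ∀ i, z i.1 ≤ ∑ S ∈ Finset.univ.filter (fun S => P S i.1 ∧ j ∈ S), w i S)
    (G : Finset ℤ) (hG : G ⊆ Finset.Icc 1 T) :
    Ex w (fun ω => if Disjoint G (cov P ω j) then 1 else 0) ≤ Real.exp (-(K * ∑ t ∈ G, z t)) := by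
  set g : ↥(Finset.Icc (1:ℤ) T) × Fin K → Finset ι → ℝ :=
    fun i S => if (i.1 : ℤ) ∈ G ∧ P S i.1 ∧ j ∈ S then 0 else 1 with hg
  have h1 : Ex w (fun ω => if Disjoint G (cov P ω j) then 1 else 0)
      ≤ Ex w (fun ω => ∏ i, g i (ω i)) := by
    apply Ex_mono hw0
    intro ω
    split_ifs with hd
    · rw [Finset.prod_eq_one]
      intro i _
      simp only [hg]
      rw [if_neg]
      rintro ⟨a1, a2, a3⟩
      exact Finset.disjoint_left.1 hd a1 (mem_cov.2 ⟨i, rfl, a2, a3⟩)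
    · apply Finset.prod_nonneg
      intro i _
      simp only [hg]
      split_ifs <;> norm_num
  refine h1.trans ?_
  rw [Ex_prod]
  have h2 : ∀ i, ∑ a, w i a * g i a ≤ Real.exp (if (i.1:ℤ) ∈ G then - z i.1 else 0) := by
    intro i
    split_ifs with hi
    · have e : ∑ a, w i a * g i a = 1 - ∑ S ∈ Finset.univ.filter (fun S => P S i.1 ∧ j ∈ S), w i S := by
        rw [← hw1 i, Finset.sum_filter, ← Finset.sum_sub_distrib]
        apply Finset.sum_congr rfl
        intro S _
        simp only [hg, hi, true_and]
        split_ifs <;> simp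
      rw [e]
      have := Real.add_one_le_exp (- z i.1)
      linarith [hz i]
    · simp only [hg, hi, false_and, if_false, mul_one, hw1, Real.exp_zero, le_refl]
  calc ∏ i, ∑ a, w i a * g i a ≤ ∏ i : ↥(Finset.Icc (1:ℤ) T) × Fin K, Real.exp (if (i.1:ℤ) ∈ G then - z i.1 else 0) := by
        apply Finset.prod_le_prod
        · intro i _
          apply Finset.sum_nonneg
          intro a _
          apply mul_nonneg (hw0 _ _)
          simp only [hg]
          split_ifs <;> norm_num
        · exact fun i _ => h2 i
    _ = _ := by
        rw [← Real.exp_sum, Fintype.sum_prod_type]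
        congr 1
        simp only [Finset.sum_const, Finset.card_univ, Fintype.card_fin, nsmul_eq_mul]
        rw [Finset.sum_coe_sort (Finset.Icc (1:ℤ) T) (fun t => (K:ℝ) * if t ∈ G then - z t else 0), ← Finset.mul_sum,
          ← Finset.sum_filter]
        rw [Finset.filter_mem_eq_inter, Finset.inter_eq_right.2 hG, Finset.sum_neg_distrib]
        ring

open Classical in
lemma q_diff {ι : Type*} [Fintype ι] {T : ℤ} {K : ℕ} (P : Finset ι → ℤ → Prop)
    (p : ℕ) (j : ι) (ω : ↥(Finset.Icc (1:ℤ) T) × Fin K → Finset ι) (i) (a : Finset ι) :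
    ((p - (cov P ω j).card : ℕ) : ℝ) ≤ ((p - (cov P (Function.update ω i a) j).card : ℕ) : ℝ)
      + if P a i.1 ∧ j ∈ a then 1 else 0 := by
  split_ifs with h
  · have : cov P (Function.update ω i a) j ⊆ insert (i.1:ℤ) (cov P ω j) := by
      intro t ht
      obtain ⟨k, hk, h1, h2⟩ := mem_cov.1 ht
      by_cases hki : k = i
      · subst hki; rw [← hk]; exact Finset.mem_insert_self _ _
      · rw [Function.update_of_ne hki] at h1 h2
        exact Finset.mem_insert_of_mem (mem_cov.2 ⟨k, hk, h1, h2⟩)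
    have h3 := (Finset.card_le_card this).trans (Finset.card_insert_le _ _)
    have : p - (cov P ω j).card ≤ (p - (cov P (Function.update ω i a) j).card) + 1 := by omega
    exact_mod_cast this
  · have : cov P (Function.update ω i a) j ⊆ cov P ω j := by
      intro t ht
      obtain ⟨k, hk, h1, h2⟩ := mem_cov.1 ht
      by_cases hki : k = i
      · subst hki
        rw [Function.update_self] at h1 h2
        rw [← hk] at h1
        exact absurd ⟨h1, h2⟩ h
      · rw [Function.update_of_ne hki] at h1 h2
        exact (mem_cov.2 ⟨k, hk, h1, h2⟩)
    have h3 := (Finset.card_le_card this)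
    have : p - (cov P ω j).card ≤ (p - (cov P (Function.update ω i a) j).card) := by omega
    rw [add_zero]
    exact_mod_cast this

/-- Final assembly of a schedule. -/
lemma assemble {ι : Type*} [Fintype ι] {d : ℕ} (k : ℕ) {H : Type*} (φ : H → Fin k)
    (hφ : Function.Injective φ)
    (r dd : ι → ℤ) (p : ι → ℕ) (s : ι → Fin d → ℝ) (Tj : ι → Finset ℤ) (h : ι → ℤ → H)
    [DecidableEq H]
    (h1 : ∀ j : ι, Tj j ⊆ Finset.Icc (r j) (dd j) ∧ (Tj j).card = p j)
    (h2 : ∀ (i : H) (t : ℤ) (c : Fin d),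
      ∑ j ∈ Finset.univ.filter (fun j : ι => t ∈ Tj j ∧ h j t = i), s j c ≤ 1) :
    SchedulableD k r dd p s := by
  refine ⟨Tj, fun j t => φ (h j t), h1, fun i t c => ?_⟩
  by_cases hi : ∃ a, φ a = i
  · obtain ⟨a, rfl⟩ := hi
    simp only [hφ.eq_iff]
    exact h2 a t c
  · have : Finset.univ.filter (fun j : ι => t ∈ Tj j ∧ φ (h j t) = i) = ∅ := by
      rw [Finset.filter_eq_empty_iff]
      rintro j _ ⟨_, hj⟩
      exact hi ⟨_, hj⟩
    rw [this]; simp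

open Classical in
/-- The sampling phase. -/
lemma phase1 {ι : Type*} [Fintype ι] (T : ℤ) (d m K : ℕ) (hd : 2 ≤ d) (hT : 2 ≤ T) (hm : 1 ≤ m)
    (hK1 : 8 * m * Real.log d ≤ K) (hK2 : (K:ℝ) ≤ 10 * m * Real.log d)
    (P : Finset ι → ℤ → Prop) (σ : ι → ℝ) (h0 : ∀ j, 0 ≤ σ j)
    (r dd : ι → ℤ) (p : ι → ℕ)
    (hP1 : ∀ S t, P S t → ∑ j ∈ S, σ j ≤ d)
    (hP2 : ∀ S t, P S t → ∀ j ∈ S, r j ≤ t ∧ t ≤ dd j)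
    (w : ↥(Finset.Icc (1:ℤ) T) × Fin K → Finset ι → ℝ) (hw0 : ∀ i a, 0 ≤ w i a)
    (hw1 : ∀ i, ∑ a, w i a = 1) (y : ι → ℤ → ℝ) (hy0 : ∀ j t, 0 ≤ y j t) (hy1 : ∀ j t, y j t ≤ 1)
    (hyw : ∀ j i, y j i.1 / m ≤ ∑ S ∈ Finset.univ.filter (fun S => P S i.1 ∧ j ∈ S), w i S)
    (hyp : ∀ j, (p j : ℝ) ≤ ∑ t ∈ Finset.Icc 1 T, y j t)
    (hyσ : ∀ t, ∑ j, σ j * y j t ≤ m * d)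
    (hys : ∀ j t, y j t ≠ 0 → r j ≤ t ∧ t ≤ dd j) :
    ∃ ω : ↥(Finset.Icc (1:ℤ) T) × Fin K → Finset ι, ∀ a b : ℤ, 1 ≤ a → b ≤ T → 
      (5120 * d ^ 2 * Real.log d * Real.log (Real.sqrt 2 * T) / m : ℝ) ≤ ((b - a + 1 : ℤ) : ℝ) →
      ∑ j ∈ Finset.univ.filter (fun i => a ≤ r i ∧ dd i ≤ b),
        ((p j - (cov P ω j).card : ℕ) : ℝ) * σ j ≤ m * ((b - a + 1 : ℤ) : ℝ) / 4 := by
  set f : ℤ → ℤ → (↥(Finset.Icc (1:ℤ) T) × Fin K → Finset ι) → ℝ := fun a b ω =>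
    ∑ j ∈ Finset.univ.filter (fun i => a ≤ r i ∧ dd i ≤ b),
        ((p j - (cov P ω j).card : ℕ) : ℝ) * σ j with hf
  have hd' : (2:ℝ) ≤ d := by exact_mod_cast hd
  have hm' : (1:ℝ) ≤ m := by exact_mod_cast hm
  have hT' : (2:ℝ) ≤ T := by exact_mod_cast hT
  have hlog2 : (1:ℝ)/2 ≤ Real.log 2 := by linarith [Real.log_two_gt_d9]
  have hlogd : (1:ℝ)/2 ≤ Real.log d := hlog2.trans (Real.log_le_log (by norm_num) hd')
  have hEj : ∀ j, Ex w (fun ω => ((p j - (cov P ω j).card : ℕ) : ℝ)) ≤ p j * (1 / (8 * d)) := by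
    intro j
    obtain ⟨G, hG1, hG2, hG3⟩ := groups (y j) (hy0 j) (hy1 j) (p j) (Finset.Icc 1 T) (by linarith [hyp j])
    have hexp : ∀ g, Ex w (fun ω => if Disjoint (G g) (cov P ω j) then (1:ℝ) else 0) ≤ 1 / (8 * d) := by
      intro g
      refine (unhit P w hw0 hw1 j (fun t => y j t / m) (hyw j) (G g) (hG1 g)).trans ?_
      have e1 : (4 : ℝ) * Real.log d ≤ K * ∑ t ∈ G g, y j t / m := by
        rw [← Finset.sum_div]
        have : 8 * m * Real.log d * ((1/2) / m) ≤ K * ((∑ t ∈ G g, y j t) / m) := by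
          apply mul_le_mul hK1 _ (by positivity) (by positivity)
          gcongr
          exact hG2 g
        calc (4 : ℝ) * Real.log d = 8 * m * Real.log d * ((1/2) / m) := by field_simp; ring
          _ ≤ _ := this
      calc Real.exp (-(K * ∑ t ∈ G g, y j t / m)) ≤ Real.exp (-(4 * Real.log d)) := by
            apply Real.exp_le_exp.2; linarith
        _ = ((d:ℝ)^4)⁻¹ := by
            rw [Real.exp_neg, show (4:ℝ) * Real.log d = ((4:ℕ):ℝ) * Real.log d by norm_num, Real.exp_nat_mul, Real.exp_log (by linarith)]
        _ ≤ _ := by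
            rw [one_div]
            apply inv_anti₀ (by positivity)
            have : (2:ℝ)^3 ≤ d^3 := by gcongr
            nlinarith
    calc Ex w (fun ω => ((p j - (cov P ω j).card : ℕ) : ℝ))
        ≤ Ex w (fun ω => ∑ g, if Disjoint (G g) (cov P ω j) then (1:ℝ) else 0) := by
          apply Ex_mono hw0
          intro ω
          have hnn : (0:ℝ) ≤ ∑ g, if Disjoint (G g) (cov P ω j) then (1:ℝ) else 0 :=
            Finset.sum_nonneg (fun g _ => by split_ifs <;> norm_num)
          have h3 := hG3 (cov P ω j)
          have h4 : ((cov P ω j ∩ Finset.Icc 1 T).card : ℝ) ≤ (cov P ω j).card := by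
            exact_mod_cast Finset.card_le_card Finset.inter_subset_left
          rcases le_total (cov P ω j).card (p j) with hle | hle
          · rw [Nat.cast_sub hle]; linarith
          · rw [Nat.sub_eq_zero_of_le hle]; simpa using hnn
      _ = ∑ g, Ex w (fun ω => if Disjoint (G g) (cov P ω j) then (1:ℝ) else 0) := Ex_sum _ _ _
      _ ≤ ∑ g : Fin (p j), 1 / (8 * (d:ℝ)) := Finset.sum_le_sum (fun g _ => hexp g)
      _ = _ := by simp
  have hEf : ∀ a b, a ≤ b + 1 → Ex w (f a b) ≤ m * ((b - a + 1 : ℤ) : ℝ) / 8 := by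
    intro a b hab
    have hcard : (((Finset.Icc a b).card : ℕ) : ℝ) = ((b - a + 1 : ℤ) : ℝ) := by
      rw [Int.card_Icc]
      have : (((b + 1 - a).toNat : ℤ)) = b - a + 1 := by omega
      exact_mod_cast this
    have e1 : Ex w (f a b) = ∑ j ∈ Finset.univ.filter (fun i => a ≤ r i ∧ dd i ≤ b),
        σ j * Ex w (fun ω => ((p j - (cov P ω j).card : ℕ) : ℝ)) := by
      simp only [hf]
      rw [Ex_sum]
      apply Finset.sum_congr rfl
      intro j _
      rw [← Ex_mul]
      congr 1
      ext ω
      ring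
    have e2 : ∀ j ∈ Finset.univ.filter (fun i => a ≤ r i ∧ dd i ≤ b),
        (p j : ℝ) ≤ ∑ t ∈ Finset.Icc a b, y j t := by
      intro j hj
      have hj := (Finset.mem_filter.1 hj).2
      refine (hyp j).trans ?_
      rw [← Finset.sum_filter_ne_zero]
      apply Finset.sum_le_sum_of_subset_of_nonneg
      · intro t ht
        have := hys j t (Finset.mem_filter.1 ht).2
        rw [Finset.mem_Icc]
        omega
      · exact fun t _ _ => hy0 j t
    rw [e1]
    calc ∑ j ∈ Finset.univ.filter (fun i => a ≤ r i ∧ dd i ≤ b),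
        σ j * Ex w (fun ω => ((p j - (cov P ω j).card : ℕ) : ℝ))
        ≤ ∑ j ∈ Finset.univ.filter (fun i => a ≤ r i ∧ dd i ≤ b),
        σ j * ((∑ t ∈ Finset.Icc a b, y j t) * (1 / (8 * d))) := by
          apply Finset.sum_le_sum
          intro j hj
          apply mul_le_mul_of_nonneg_left _ (h0 j)
          exact (hEj j).trans (mul_le_mul_of_nonneg_right (e2 j hj) (by positivity))
      _ ≤ ∑ j, σ j * ((∑ t ∈ Finset.Icc a b, y j t) * (1 / (8 * d))) := by
          apply Finset.sum_le_sum_of_subset_of_nonneg (Finset.filter_subset _ _)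
          intro j _ _
          have := Finset.sum_nonneg (s := Finset.Icc a b) (fun t _ => hy0 j t)
          have := h0 j
          positivity
      _ = (∑ t ∈ Finset.Icc a b, ∑ j, σ j * y j t) * (1 / (8 * d)) := by
          rw [Finset.sum_comm, Finset.sum_mul]
          apply Finset.sum_congr rfl
          intro j _
          rw [← Finset.mul_sum]
          ring
      _ ≤ (∑ t ∈ Finset.Icc a b, (m * d : ℝ)) * (1 / (8 * d)) := by
          apply mul_le_mul_of_nonneg_right _ (by positivity)
          exact Finset.sum_le_sum (fun t _ => hyσ t)
      _ = _ := by
          rw [Finset.sum_const, nsmul_eq_mul, hcard]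
          field_simp
  have hdiff : ∀ a b i ω S, f a b ω ≤ f a b (Function.update ω i S) +
      if (i.1 : ℤ) ∈ Finset.Icc a b then (d:ℝ) else 0 := by
    intro a b i ω S
    have e1 : f a b ω ≤ f a b (Function.update ω i S) +
        ∑ j ∈ Finset.univ.filter (fun i => a ≤ r i ∧ dd i ≤ b), if P S i.1 ∧ j ∈ S then σ j else 0 := by
      simp only [hf]
      rw [← Finset.sum_add_distrib]
      apply Finset.sum_le_sum
      intro j _
      have := mul_le_mul_of_nonneg_right (q_diff P (p j) j ω i S) (h0 j)
      rw [add_mul] at this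
      refine this.trans (le_of_eq ?_)
      split_ifs <;> simp
    refine e1.trans ?_
    gcongr
    by_cases hS : P S i.1
    · split_ifs with hi
      · refine le_trans ?_ (hP1 S i.1 hS)
        simp only [hS, true_and]
        rw [← Finset.sum_filter]
        apply Finset.sum_le_sum_of_subset_of_nonneg
        · intro j hj; exact (Finset.mem_filter.1 hj).2
        · exact fun j _ _ => h0 j
      · apply le_of_eq
        apply Finset.sum_eq_zero
        intro j hj
        rw [if_neg]
        rintro ⟨_, hjS⟩
        have h1 := hP2 S i.1 hS j hjS
        have h2 := (Finset.mem_filter.1 hj).2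
        apply hi
        rw [Finset.mem_Icc]
        omega
    · simp only [hS, false_and, if_false, Finset.sum_const_zero]
      split_ifs
      · linarith
      · exact le_refl _
  set sp : ℝ := 1 / (160 * d ^ 2 * Real.log d) with hsp
  have hlp : 0 < Real.log d := by linarith
  have hsp0 : 0 < sp := by positivity
  have hsd : sp * d ≤ 1 := by
    rw [hsp, one_div_mul_eq_div, div_le_one (by positivity)]
    nlinarith [mul_le_mul hd' hlogd (by norm_num) (by linarith)]
  have hLT : 0 < Real.log (Real.sqrt 2 * T) := by
    apply Real.log_pos
    have : 1 ≤ Real.sqrt 2 := Real.one_le_sqrt.2 (by norm_num)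
    nlinarith
  have htail : ∀ a b : ℤ, 1 ≤ a → b ≤ T → 
      (5120 * d ^ 2 * Real.log d * Real.log (Real.sqrt 2 * T) / m : ℝ) ≤ ((b - a + 1 : ℤ) : ℝ) →
      Ex w (fun ω => Real.exp (sp * f a b ω - sp * (m * ((b - a + 1 : ℤ) : ℝ) / 4)))
        ≤ 1 / (2 * T ^ 2) := by
    intro a b ha hb hab
    set n : ℝ := ((b - a + 1 : ℤ) : ℝ) with hn
    have hn0 : 0 < n := lt_of_lt_of_le (by positivity) hab
    have hab' : a ≤ b + 1 := by
      rw [hn] at hn0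
      have : (0:ℤ) < b - a + 1 := by exact_mod_cast hn0
      omega
    have hcard : (((Finset.Icc a b).card : ℕ) : ℝ) = n := by
      rw [Int.card_Icc, hn]
      have : (((b + 1 - a).toNat : ℤ)) = b - a + 1 := by omega
      exact_mod_cast this
    set cc : ℤ → ℝ := fun t => if t ∈ Finset.Icc a b then sp * d else 0 with hcc
    have h1 := mcd w hw0 hw1 (fun ω => sp * f a b ω)
      (fun i => cc i.1)
      (fun i => by
        simp only [hcc]
        split_ifs
        · exact hsd
        · norm_num)
      (fun i ω S => by
        have := mul_le_mul_of_nonneg_left (hdiff a b i ω S) hsp0.le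
        rw [mul_add] at this
        refine this.trans (le_of_eq ?_)
        simp only [hcc]
        split_ifs <;> simp)
    rw [Ex_mul] at h1
    have h2 : ∑ i : ↥(Finset.Icc (1:ℤ) T) × Fin K, cc i.1 ^ 2
        = n * K * (sp * d) ^ 2 := by
      rw [Fintype.sum_prod_type]
      simp only [Finset.sum_const, Finset.card_univ, Fintype.card_fin, nsmul_eq_mul]
      rw [Finset.sum_coe_sort (Finset.Icc (1:ℤ) T) (fun t => (K:ℝ) * cc t ^ 2),
        ← Finset.mul_sum]
      simp only [hcc, ite_pow, ne_eq, OfNat.ofNat_ne_zero, not_false_eq_true, zero_pow]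
      rw [← Finset.sum_filter, Finset.filter_mem_eq_inter, Finset.inter_eq_right.2 (Finset.Icc_subset_Icc ha hb),
        Finset.sum_const, nsmul_eq_mul, hcard]
      ring
    rw [h2] at h1
    have h3 : n * K * (sp * d) ^ 2 ≤ sp * (m * n / 16) := by
      calc n * K * (sp * d) ^ 2 ≤ n * (10 * m * Real.log d) * (sp * d) ^ 2 := by gcongr
        _ = sp * (m * n / 16) * (160 * d ^ 2 * Real.log d * sp) := by ring
        _ = _ := by rw [hsp]; field_simp
    have h4 : sp * Ex w (f a b) ≤ sp * (m * n / 8) := mul_le_mul_of_nonneg_left (hEf a b hab') hsp0.le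
    have h5 : 2 * Real.log (Real.sqrt 2 * T) ≤ sp * (m * n / 16) := by
      have : sp * (m * (5120 * d ^ 2 * Real.log d * Real.log (Real.sqrt 2 * T) / m) / 16) ≤ sp * (m * n / 16) := by gcongr
      refine le_trans (le_of_eq ?_) this
      rw [hsp]; field_simp; norm_num
    have h6 : Ex w (fun ω => Real.exp (sp * f a b ω - sp * (m * n / 4)))
        = Real.exp (-(sp * (m * n / 4))) * Ex w (fun ω => Real.exp (sp * f a b ω)) := by
      rw [← Ex_mul]
      congr 1; ext ω
      rw [← Real.exp_add]; ring_nf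
    rw [h6]
    calc _ ≤ Real.exp (-(sp * (m * n / 4))) * Real.exp (sp * Ex w (f a b) + n * K * (sp * d) ^ 2) :=
          mul_le_mul_of_nonneg_left h1 (Real.exp_pos _).le
      _ = Real.exp (-(sp * (m * n / 4)) + (sp * Ex w (f a b) + n * K * (sp * d) ^ 2)) := by rw [← Real.exp_add]
      _ ≤ Real.exp (-(2 * Real.log (Real.sqrt 2 * T))) := by
          apply Real.exp_le_exp.2
          have : sp * (m * n / 4) = 4 * (sp * (m * n / 16)) := by ring
          have : sp * (m * n / 8) = 2 * (sp * (m * n / 16)) := by ring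
          linarith
      _ = _ := by
          rw [Real.exp_neg, show (2:ℝ) * Real.log (Real.sqrt 2 * T) = ((2:ℕ):ℝ) * Real.log (Real.sqrt 2 * T) by norm_num,
            Real.exp_nat_mul, Real.exp_log (by positivity), mul_pow, Real.sq_sqrt (by norm_num), one_div]
  set Good := ((Finset.Icc (1:ℤ) T) ×ˢ (Finset.Icc (1:ℤ) T)).filter (fun ab =>
    (5120 * d ^ 2 * Real.log d * Real.log (Real.sqrt 2 * T) / m : ℝ) ≤ ((ab.2 - ab.1 + 1 : ℤ) : ℝ)) with hGood
  set Φ : (↥(Finset.Icc (1:ℤ) T) × Fin K → Finset ι) → ℝ := fun ω => ∑ ab ∈ Good,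
    Real.exp (sp * f ab.1 ab.2 ω - sp * (m * ((ab.2 - ab.1 + 1 : ℤ) : ℝ) / 4)) with hΦ
  have hEΦ : Ex w Φ ≤ 1/2 := by
    rw [hΦ, Ex_sum]
    calc _ ≤ ∑ ab ∈ Good, (1 / (2 * T ^ 2) : ℝ) := by
          apply Finset.sum_le_sum
          rintro ⟨a, b⟩ hab
          simp only [hGood, Finset.mem_filter, Finset.mem_product, Finset.mem_Icc] at hab
          exact htail a b (by omega) (by omega) hab.2
      _ = (Good.card : ℝ) * (1 / (2 * T ^ 2)) := by simp
      _ ≤ (T:ℝ)^2 * (1 / (2 * T ^ 2)) := by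
          gcongr
          have h1 : Good.card ≤ T.toNat * T.toNat := by
            refine (Finset.card_filter_le _ _).trans ?_
            rw [Finset.card_product, Int.card_Icc]
            simp
          have h2 : ((T.toNat : ℕ) : ℝ) = T := by
            have : ((T.toNat : ℕ) : ℤ) = T := by omega
            exact_mod_cast this
          calc (Good.card : ℝ) ≤ ((T.toNat * T.toNat : ℕ) : ℝ) := by exact_mod_cast h1
            _ = _ := by push_cast; rw [h2]; ring
      _ = _ := by field_simp
  obtain ⟨ω, hω⟩ : ∃ ω, Φ ω < 1 := by
    by_contra! hc
    have := Ex_mono hw0 hc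
    rw [Ex_one hw1] at this
    linarith
  refine ⟨ω, fun a b ha hb hab => ?_⟩
  have hmem : (a, b) ∈ Good := by
    have hn0 : (0:ℝ) < ((b - a + 1 : ℤ) : ℝ) := lt_of_lt_of_le (by positivity) hab
    have : (0:ℤ) < b - a + 1 := by exact_mod_cast hn0
    simp only [hGood, Finset.mem_filter, Finset.mem_product, Finset.mem_Icc]
    exact ⟨by omega, hab⟩
  have h1 := Finset.single_le_sum (f := fun ab : ℤ × ℤ =>
    Real.exp (sp * f ab.1 ab.2 ω - sp * (m * ((ab.2 - ab.1 + 1 : ℤ) : ℝ) / 4)))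
    (fun _ _ => (Real.exp_pos _).le) hmem
  have h2 := lt_of_le_of_lt h1 hω
  simp only at h2
  rw [Real.exp_lt_one_iff] at h2
  have h3 : sp * f a b ω ≤ sp * (m * ((b - a + 1 : ℤ) : ℝ) / 4) := by linarith
  exact le_of_mul_le_mul_left h3 hsp0

theorem stmt_16 (lam : ℝ) (hlam0 : 0 < lam) (hlam1 : lam < 1/4) :
    ∃ c θ : ℝ, 1 < c ∧ 0 < θ ∧
      ∀ (ι : Type) (_ : Fintype ι) (_ : DecidableEq ι) (d : ℕ) (T : ℤ)
        (r dd : ι → ℤ) (p : ι → ℕ) (s : ι → Fin d → ℝ) (m : ℕ)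
        (x : Finset ι → ℤ → ℝ),
        2 ≤ d → 2 ≤ T → 1 ≤ m →
        (∀ j, 1 ≤ r j ∧ dd j ≤ T ∧ r j ≤ dd j) →
        (∀ j, 1 ≤ p j ∧ (p j : ℤ) ≤ dd j - r j + 1) →
        (∀ j i, 0 ≤ s j i ∧ s j i ≤ 1) →
        (∀ j, (p j : ℝ) ≤ lam * ((dd j - r j + 1 : ℤ) : ℝ)) →
        (∀ j, θ * d ^ 2 * Real.log d * Real.log (Real.sqrt 2 * T) / m
          ≤ ((dd j - r j + 1 : ℤ) : ℝ)) →
        ConfigLP T r dd p s x m →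
        SchedulableD (⌈c * m * Real.log d⌉₊ + m) r dd p s := by
  refine ⟨16, 5120, by norm_num, by norm_num, ?_⟩
  intro ι _ _ d T r dd p s m x hd hT hm hw hp hs hlam hlen ⟨hx0, hxv, hxm, hx1, hxp⟩
  have hd' : (2:ℝ) ≤ d := by exact_mod_cast hd
  have hm' : (1:ℝ) ≤ m := by exact_mod_cast hm
  have hlogd : (1:ℝ)/2 ≤ Real.log d := by
    have := Real.log_le_log (by norm_num) hd'
    linarith [Real.log_two_gt_d9]
  have hml : (1:ℝ)/2 ≤ m * Real.log d := by nlinarith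
  set K := ⌈8 * m * Real.log d⌉₊ with hK
  have hK1 : 8 * m * Real.log d ≤ (K:ℝ) := Nat.le_ceil _
  have hK2 : (K:ℝ) ≤ 10 * m * Real.log d := by
    have := (Nat.ceil_lt_add_one (a := 8 * m * Real.log d) (by nlinarith)).le
    linarith
  set σ : ι → ℝ := fun j => min 1 (∑ i, s j i) with hσ
  have hsum0 : ∀ j, 0 ≤ ∑ i, s j i := fun j => Finset.sum_nonneg (fun i _ => (hs j i).1)
  have h0 : ∀ j, 0 ≤ σ j := fun j => le_min (by norm_num) (hsum0 j)
  have h1 : ∀ j, σ j ≤ 1 := fun j => min_le_left _ _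
  have hsσ : ∀ j c, s j c ≤ σ j := fun j c => le_min (hs j c).2
    (Finset.single_le_sum (f := fun i => s j i) (fun i _ => (hs j i).1) (Finset.mem_univ c))
  have hP1 : ∀ S t, ValidConfig r dd s S t → ∑ j ∈ S, σ j ≤ d := by
    intro S t hS
    calc ∑ j ∈ S, σ j ≤ ∑ j ∈ S, ∑ i, s j i := Finset.sum_le_sum (fun j _ => min_le_right _ _)
      _ = ∑ i, ∑ j ∈ S, s j i := Finset.sum_comm
      _ ≤ ∑ i : Fin d, (1:ℝ) := Finset.sum_le_sum (fun i _ => hS.2 i)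
      _ = d := by simp
  have hP2 : ∀ S t, ValidConfig r dd s S t → ∀ j ∈ S, r j ≤ t ∧ t ≤ dd j :=
    fun S t hS j hj => Finset.mem_Icc.1 (hS.1 j hj)
  set y : ι → ℤ → ℝ := fun j t => ∑ S ∈ Finset.univ.filter (fun S : Finset ι => j ∈ S), x S t with hy
  set w : ↥(Finset.Icc (1:ℤ) T) × Fin K → Finset ι → ℝ := fun i S =>
    x S i.1 / m + if S = ∅ then 1 - (∑ S : Finset ι, x S i.1) / m else 0 with hwdef
  have hw0' : ∀ i, (0:ℝ) ≤ 1 - (∑ S : Finset ι, x S i) / m := by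
    intro i
    rw [sub_nonneg, div_le_one (by linarith)]
    exact hxm i
  have hw0 : ∀ i a, 0 ≤ w i a := by
    intro i S
    have h2 := hw0' i.1
    have h3 := hx0 S i.1
    have h4 : 0 ≤ x S i.1 / m := by positivity
    simp only [hwdef]
    split_ifs <;> linarith
  have hw1 : ∀ i, ∑ a, w i a = 1 := by
    intro i
    simp only [hwdef]
    rw [Finset.sum_add_distrib, ← Finset.sum_div]
    simp
  have hyw : ∀ (j : ι) (i : ↥(Finset.Icc (1:ℤ) T) × Fin K), y j i.1 / m ≤
      ∑ S ∈ @Finset.filter _ (fun S => ValidConfig r dd s S i.1 ∧ j ∈ S)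
        (fun _ => Classical.propDecidable _) Finset.univ, w i S := by
    intro j i
    simp only [hy]
    rw [Finset.sum_div, ← Finset.sum_filter_ne_zero]
    have : ∀ S, x S i.1 / m ≤ w i S := by
      intro S
      have := hw0' i.1
      simp only [hwdef]
      split_ifs <;> linarith
    refine (Finset.sum_le_sum (fun S _ => this S)).trans ?_
    apply Finset.sum_le_sum_of_subset_of_nonneg
    · intro S hS
      simp only [Finset.mem_filter, Finset.mem_univ, true_and] at hS ⊢
      refine ⟨hxv S _ ?_, hS.1⟩
      intro h; apply hS.2; rw [h]; simp
    · exact fun S _ _ => hw0 i S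
  have hyσ : ∀ t, ∑ j, σ j * y j t ≤ m * d := by
    intro t
    have e : ∑ j, σ j * y j t = ∑ S : Finset ι, x S t * ∑ j ∈ S, σ j := by
      simp only [hy, Finset.mul_sum, Finset.sum_filter]
      rw [Finset.sum_comm]
      apply Finset.sum_congr rfl
      intro S _
      rw [← Finset.sum_subset (Finset.subset_univ S)]
      · apply Finset.sum_congr rfl
        intro j hj
        simp [hj, mul_comm]
      · intro j _ hj; simp [hj]
    rw [e]
    calc ∑ S : Finset ι, x S t * ∑ j ∈ S, σ j ≤ ∑ S : Finset ι, x S t * d := by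
          apply Finset.sum_le_sum
          intro S _
          by_cases hxs : x S t = 0
          · simp [hxs]
          · exact mul_le_mul_of_nonneg_left (hP1 S t (hxv S t hxs)) (hx0 S t)
      _ = (∑ S : Finset ι, x S t) * d := by rw [Finset.sum_mul]
      _ ≤ _ := mul_le_mul_of_nonneg_right (hxm t) (by linarith)
  have hys : ∀ j t, y j t ≠ 0 → r j ≤ t ∧ t ≤ dd j := by
    intro j t h
    obtain ⟨S, hS, hne⟩ := Finset.exists_ne_zero_of_sum_ne_zero h
    exact hP2 S t (hxv S t hne) j (Finset.mem_filter.1 hS).2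
  obtain ⟨ω, hω⟩ := phase1 T d m K hd hT hm hK1 hK2 (ValidConfig r dd s) σ h0 r dd p hP1 hP2 w hw0 hw1
    y (fun j t => Finset.sum_nonneg (fun S _ => hx0 S t)) hx1 (by convert hyw) hxp hyσ hys
  set A : ι → Finset ℤ := fun j => cov (ValidConfig r dd s) ω j with hA
  obtain ⟨B, hB1, hB2⟩ := greedy σ m hm h0 h1 r dd T hw A (fun j => p j - (A j).card)
    (by
      intro j hq
      have h2 : (((A j).card : ℝ) + ((p j - (A j).card : ℕ) : ℝ)) = p j := by
        have : (A j).card + (p j - (A j).card) = p j := by omega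
        exact_mod_cast this
      rw [h2]
      have h3 : (0:ℝ) ≤ ((dd j - r j + 1 : ℤ) : ℝ) := by
        have := (hw j).2.2
        have : (0:ℤ) ≤ dd j - r j + 1 := by omega
        exact_mod_cast this
      nlinarith [hlam j])
    Finset.univ
    (by
      intro j a b ha hb har hdb
      apply hω a b ha hb
      refine (hlen j).trans ?_
      have : dd j - r j + 1 ≤ b - a + 1 := by omega
      exact_mod_cast this)
    Finset.univ (Finset.Subset.refl _)
  have hAsub : ∀ j, A j ⊆ Finset.Icc (r j) (dd j) := by
    intro j t ht
    obtain ⟨i, hi, h2, h3⟩ := mem_cov.1 ht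
    exact h2.1 j h3
  have hA' : ∀ j, ∃ A' ⊆ A j, A'.card = min (p j) (A j).card :=
    fun j => Finset.exists_subset_card_eq (min_le_right _ _)
  choose A' hA'1 hA'2 using hA'
  have hpack : ∀ t, ∃ h : ι → Fin (4 * m), ∀ i,
      ∑ j ∈ (Finset.univ.filter (fun j => t ∈ B j)).filter (fun j => h j = i), σ j ≤ 1 :=
    fun t => binpack σ m hm h0 h1 _ (hB2 t)
  choose hb hhb using hpack
  have hhost : ∀ j t, ∃ k : Fin K ⊕ Fin (4 * m), 
      (t ∈ A' j → ∃ k', k = Sum.inl k' ∧ ∃ ht : t ∈ Finset.Icc 1 T,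
        ValidConfig r dd s (ω (⟨t, ht⟩, k')) t ∧ j ∈ ω (⟨t, ht⟩, k')) ∧
      (t ∉ A' j → k = Sum.inr (hb t j)) := by
    intro j t
    by_cases ht : t ∈ A' j
    · obtain ⟨⟨⟨t', ht'⟩, k⟩, hi, h2, h3⟩ := mem_cov.1 (hA'1 j ht)
      simp only at hi
      subst hi
      exact ⟨Sum.inl k, fun _ => ⟨k, rfl, ht', h2, h3⟩, fun h => absurd ht h⟩
    · exact ⟨Sum.inr (hb t j), fun h => absurd h ht, fun _ => rfl⟩
  choose h hh1 hh2 using hhost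
  have hcardle : K + 4 * m ≤ ⌈16 * m * Real.log d⌉₊ + m := by
    have h2 : ((K + 3 * m : ℕ) : ℝ) ≤ 16 * m * Real.log d := by
      push_cast
      nlinarith
    have h3 : ((K + 3 * m : ℕ) : ℝ) ≤ (⌈16 * m * Real.log d⌉₊ : ℝ) := h2.trans (Nat.le_ceil _)
    have h4 : K + 3 * m ≤ ⌈16 * m * Real.log d⌉₊ := by exact_mod_cast h3
    omega
  refine assemble _ (fun a : Fin K ⊕ Fin (4 * m) => Fin.castLE hcardle (finSumFinEquiv a))
    ((Fin.castLE_injective hcardle).comp finSumFinEquiv.injective) r dd p s (fun j => A' j ∪ B j) h ?_ ?_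
  · intro j
    obtain ⟨b1, b2, b3⟩ := hB1 j (Finset.mem_univ j)
    refine ⟨Finset.union_subset ((hA'1 j).trans (hAsub j)) b1, ?_⟩
    rw [Finset.card_union_of_disjoint (Finset.disjoint_of_subset_left (hA'1 j) b2), hA'2, b3]
    omega
  · rintro (k | k) t c
    · by_cases hT : t ∈ Finset.Icc 1 T ∧ ∃ ht, ValidConfig r dd s (ω (⟨t, ht⟩, k)) t
      · obtain ⟨_, ht, hv⟩ := hT
        refine le_trans ?_ (hv.2 c)
        apply Finset.sum_le_sum_of_subset_of_nonneg
        · intro j hj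
          obtain ⟨_, h3⟩ := (Finset.mem_filter.1 hj).2
          by_cases hjA : t ∈ A' j
          · obtain ⟨k', e, ht', h4, h5⟩ := hh1 j t hjA
            rw [h3] at e
            cases e
            exact h5
          · rw [hh2 j t hjA] at h3; cases h3
        · exact fun j _ _ => (hs j c).1
      · rw [Finset.filter_eq_empty_iff.2]
        · simp
        · rintro j _ ⟨_, h3⟩
          by_cases hjA : t ∈ A' j
          · obtain ⟨k', e, ht', h4, h5⟩ := hh1 j t hjA
            rw [h3] at e
            cases e
            exact hT ⟨ht', ht', h4⟩
          · rw [hh2 j t hjA] at h3; cases h3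
    · refine le_trans ?_ (hhb t k)
      refine (Finset.sum_le_sum (fun j _ => hsσ j c)).trans ?_
      apply Finset.sum_le_sum_of_subset_of_nonneg
      · intro j hj
        obtain ⟨h2, h3⟩ := (Finset.mem_filter.1 hj).2
        by_cases hjA : t ∈ A' j
        · obtain ⟨k', e, _⟩ := hh1 j t hjA
          rw [h3] at e; cases e
        · rw [hh2 j t hjA] at h3
          simp only [Finset.mem_filter, Finset.mem_univ, true_and]
          refine ⟨(Finset.mem_union.1 h2).resolve_left hjA, Sum.inr_injective h3⟩
      · exact fun j _ _ => h0 j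
end

section
/- For every real λ ∈ (0,1/4) there exists a constant C > 0 (depending only on λ) with the following property. Let d ≥ 2 and let (J, T, d) be a d-dimensional MinR instance with T ≥ 2 satisfying p_j ≤ λ·|χ_j| for every job j, and let m ≥ 1 be an integer such that the instance admits a fractional configuration-LP solution of value m. Then all jobs of J can be feasibly scheduled on at most ⌈C·m·(log d)·(1 + log* T)⌉ hosts, where log* T is the least integer k such that the k-fold iterate of log₂ applied to T is at most 1. -/
open Finset

/-- `k`-fold iterate of the base-2 logarithm. -/
noncomputable def iterLog2 : ℕ → ℝ → ℝ
  | 0, x => x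
  | (k + 1), x => Real.logb 2 (iterLog2 k x)

/-- `log* x`: the least `k` such that the `k`-fold iterate of `log₂` applied
to `x` is at most `1`. -/
noncomputable def logStar (x : ℝ) : ℕ := sInf {k : ℕ | iterLog2 k x ≤ 1}



section EOp
variable {c Ω : Type} [DecidableEq c] [Fintype Ω]

noncomputable def avgAt (w : c → Ω → ℝ) (t : c) (f : (c → Ω) → ℝ) : (c → Ω) → ℝ :=
  fun ω => ∑ o, w t o * f (Function.update ω t o)

noncomputable def EE (w : c → Ω → ℝ) : List c → ((c → Ω) → ℝ) → ((c → Ω) → ℝ)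
  | [], f => f
  | t :: l, f => EE w l (avgAt w t f)

variable {w : c → Ω → ℝ}

lemma EE_mono (hw : ∀ t o, 0 ≤ w t o) (l : List c) :
    ∀ (f g : (c → Ω) → ℝ), (∀ ω, f ω ≤ g ω) → ∀ ω, EE w l f ω ≤ EE w l g ω := by
  induction l with
  | nil => intro f g h ω; exact h ω
  | cons t l ih =>
    intro f g h ω
    apply ih
    intro ω
    exact Finset.sum_le_sum fun o _ => mul_le_mul_of_nonneg_left (h _) (hw t o)

lemma EE_const_mul (l : List c) (a : ℝ) :
    ∀ (f : (c → Ω) → ℝ), EE w l (fun ω => a * f ω) = fun ω => a * EE w l f ω := by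
  induction l with
  | nil => intro f; rfl
  | cons t l ih =>
    intro f
    have : avgAt w t (fun ω => a * f ω) = fun ω => a * avgAt w t f ω := by
      funext ω
      simp only [avgAt, Finset.mul_sum]
      exact Finset.sum_congr rfl fun o _ => by ring
    simp only [EE]
    rw [this, ih]

lemma EE_sum {α : Type} (l : List c) (A : Finset α) :
    ∀ (f : α → (c → Ω) → ℝ), EE w l (fun ω => ∑ i ∈ A, f i ω) = fun ω => ∑ i ∈ A, EE w l (f i) ω := by
  induction l with
  | nil => intro f; rfl
  | cons t l ih =>
    intro f
    have : avgAt w t (fun ω => ∑ i ∈ A, f i ω) = fun ω => ∑ i ∈ A, avgAt w t (f i) ω := by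
      funext ω
      simp only [avgAt, Finset.mul_sum]
      rw [Finset.sum_comm]
    simp only [EE]
    rw [this, ih]

lemma EE_exists (hw : ∀ t o, 0 ≤ w t o) (hw1 : ∀ t, ∑ o, w t o = 1) (l : List c) :
    ∀ (f : (c → Ω) → ℝ) ω, ∃ ω', f ω' ≤ EE w l f ω := by
  induction l with
  | nil => intro f ω; exact ⟨ω, le_rfl⟩
  | cons t l ih =>
    intro f ω
    obtain ⟨ω', h⟩ := ih (avgAt w t f) ω
    by_contra! hc
    have h1 : ∀ o, EE w (t :: l) f ω < f (Function.update ω' t o) := fun o => hc _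
    have h2 : ∑ o, w t o * EE w (t :: l) f ω < ∑ o, w t o * f (Function.update ω' t o) := by
      apply Finset.sum_lt_sum
      · intro o _
        exact mul_le_mul_of_nonneg_left (h1 o).le (hw t o)
      · have : ∃ o, w t o ≠ 0 := by
          by_contra! h0
          have := hw1 t
          simp [h0] at this
        obtain ⟨o, ho⟩ := this
        exact ⟨o, Finset.mem_univ _, mul_lt_mul_of_pos_left (h1 o) (lt_of_le_of_ne (hw t o) (Ne.symm ho))⟩
    rw [← Finset.sum_mul, hw1, one_mul] at h2
    exact absurd h2 (not_lt.mpr h)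

lemma EE_prod (hw1 : ∀ t, ∑ o, w t o = 1) (D : Finset c) (l : List c) :
    ∀ (φ : c → Ω → ℝ) ω, EE w l (fun ω => ∏ t ∈ D, φ t (ω t)) ω
      = ∏ t ∈ D, (if t ∈ l then ∑ o, w t o * φ t o else φ t (ω t)) := by
  induction l with
  | nil => intro φ ω; simp [EE]
  | cons t l ih =>
    intro φ ω
    have : avgAt w t (fun ω => ∏ t ∈ D, φ t (ω t))
        = fun ω => ∏ t' ∈ D, (Function.update φ t (fun _ => ∑ o, w t o * φ t o)) t' (ω t') := by
      funext ω
      simp only [avgAt]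
      by_cases ht : t ∈ D
      · simp only [← Finset.mul_prod_erase D _ ht, Function.update_self]
        rw [Finset.sum_mul]
        refine Finset.sum_congr rfl fun o _ => ?_
        rw [mul_assoc]
        congr 2
        refine Finset.prod_congr rfl fun t' h' => ?_
        have : t' ≠ t := Finset.ne_of_mem_erase h'
        simp [this]
      · have : ∀ o, ∏ t' ∈ D, φ t' (Function.update ω t o t') = ∏ t' ∈ D, φ t' (ω t') := by
          intro o
          refine Finset.prod_congr rfl fun t' h' => ?_
          have : t' ≠ t := by rintro rfl; exact ht h'
          simp [this]
        simp only [this]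
        rw [← Finset.sum_mul, hw1, one_mul]
        refine Finset.prod_congr rfl fun t' h' => ?_
        have : t' ≠ t := by rintro rfl; exact ht h'
        simp [this]
    simp only [EE]
    rw [this, ih]
    refine Finset.prod_congr rfl fun t' h' => ?_
    by_cases h : t' = t
    · subst h
      simp only [Function.update_self, List.mem_cons, true_or, if_true]
      rw [← Finset.sum_mul, hw1, one_mul]
      simp
    · simp [h]

lemma exp_quad {x : ℝ} (hx : |x| ≤ 1) : Real.exp x ≤ 1 + x + x ^ 2 := by
  have := Real.abs_exp_sub_one_sub_id_le hx
  rw [abs_le] at this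
  linarith [this.2]

lemma mgf_step (w : Ω → ℝ) (hw : ∀ o, 0 ≤ w o) (hw1 : ∑ o, w o = 1) (g : Ω → ℝ) (s C : ℝ)
    (hs : 0 ≤ s) (hsC : s * C ≤ 1) (hg : ∀ o o', g o - g o' ≤ C) :
    ∑ o, w o * Real.exp (s * g o) ≤ Real.exp (s * (∑ o, w o * g o) + s ^ 2 * C ^ 2) := by
  set μ := ∑ o, w o * g o with hμ
  have hdev : ∀ o, |g o - μ| ≤ C := by
    intro o
    have e1 : g o - μ = ∑ o', w o' * (g o - g o') := by
      simp only [mul_sub, Finset.sum_sub_distrib, ← Finset.sum_mul, hw1, one_mul, hμ]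
    rw [abs_le]
    constructor
    · rw [e1]
      calc -C = ∑ o', w o' * (-C) := by rw [← Finset.sum_mul, hw1, one_mul]
        _ ≤ _ := Finset.sum_le_sum fun o' _ =>
          mul_le_mul_of_nonneg_left (by linarith [hg o' o]) (hw o')
    · rw [e1]
      calc _ ≤ ∑ o', w o' * C := Finset.sum_le_sum fun o' _ =>
          mul_le_mul_of_nonneg_left (hg o o') (hw o')
        _ = C := by rw [← Finset.sum_mul, hw1, one_mul]
  have hpt : ∀ o, Real.exp (s * g o) ≤ Real.exp (s * μ) * (1 + s * (g o - μ) + s ^ 2 * C ^ 2) := by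
    intro o
    have e : s * g o = s * μ + s * (g o - μ) := by ring
    rw [e, Real.exp_add]
    apply mul_le_mul_of_nonneg_left _ (Real.exp_pos _).le
    have ha : |s * (g o - μ)| ≤ s * C := by
      rw [abs_mul, abs_of_nonneg hs]
      exact mul_le_mul_of_nonneg_left (hdev o) hs
    have h1 := exp_quad (ha.trans hsC)
    have h2 : (s * (g o - μ)) ^ 2 ≤ (s * C) ^ 2 := by
      rw [← sq_abs (s * (g o - μ))]
      exact pow_le_pow_left₀ (abs_nonneg _) ha 2
    nlinarith
  clear_value μ
  calc ∑ o, w o * Real.exp (s * g o)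
      ≤ ∑ o, w o * (Real.exp (s * μ) * (1 + s * (g o - μ) + s ^ 2 * C ^ 2)) :=
        Finset.sum_le_sum fun o _ => mul_le_mul_of_nonneg_left (hpt o) (hw o)
    _ = Real.exp (s * μ) * ((∑ o, w o) + s * ((∑ o, w o * g o) - (∑ o, w o) * μ)
          + (∑ o, w o) * (s ^ 2 * C ^ 2)) := by
        rw [Finset.sum_mul, Finset.sum_mul, ← Finset.sum_sub_distrib, Finset.mul_sum,
          ← Finset.sum_add_distrib, ← Finset.sum_add_distrib, Finset.mul_sum]
        exact Finset.sum_congr rfl fun o _ => by ring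
    _ = Real.exp (s * μ) * (s ^ 2 * C ^ 2 + 1) := by rw [hw1, ← hμ]; ring
    _ ≤ Real.exp (s * μ) * Real.exp (s ^ 2 * C ^ 2) :=
        mul_le_mul_of_nonneg_left (Real.add_one_le_exp _) (Real.exp_pos _).le
    _ = _ := by rw [← Real.exp_add]

lemma EE_exp (hw : ∀ t o, 0 ≤ w t o) (hw1 : ∀ t, ∑ o, w t o = 1) (C : c → ℝ) (s : ℝ)
    (hs : 0 ≤ s) (hsC : ∀ t, s * C t ≤ 1) (l : List c) :
    ∀ (f : (c → Ω) → ℝ),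
      (∀ t ω o o', f (Function.update ω t o) - f (Function.update ω t o') ≤ C t) →
      ∀ ω, EE w l (fun ω => Real.exp (s * f ω)) ω
        ≤ Real.exp (s * EE w l f ω + s ^ 2 * (l.map fun t => C t ^ 2).sum) := by
  induction l with
  | nil => intro f _ ω; simp [EE]
  | cons t l ih =>
    intro f hf ω
    have hC : ∀ t, 0 ≤ C t := by
      intro t
      have : ∃ o : Ω, True := by
        by_contra! h0
        have h1 := hw1 t
        have : IsEmpty Ω := ⟨fun o => h0 o⟩
        simp at h1
      obtain ⟨o, _⟩ := this
      have := hf t (fun _ => o) o o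
      simpa using this
    have hg : ∀ t' ω o o', avgAt w t f (Function.update ω t' o)
        - avgAt w t f (Function.update ω t' o') ≤ C t' := by
      intro t' ω o o'
      by_cases h : t' = t
      · subst h
        simp only [avgAt, Function.update_idem, sub_self]
        exact hC _
      · simp only [avgAt]
        rw [← Finset.sum_sub_distrib]
        calc _ ≤ ∑ a, w t a * C t' := by
              refine Finset.sum_le_sum fun a _ => ?_
              rw [← mul_sub, Function.update_comm h, Function.update_comm h]
              exact mul_le_mul_of_nonneg_left (hf _ _ _ _) (hw t a)
          _ = C t' := by rw [← Finset.sum_mul, hw1, one_mul]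
    have h1 : ∀ ω, avgAt w t (fun ω => Real.exp (s * f ω)) ω
        ≤ Real.exp (s ^ 2 * C t ^ 2) * Real.exp (s * avgAt w t f ω) := by
      intro ω
      rw [← Real.exp_add, add_comm]
      exact mgf_step (w t) (hw t) (hw1 t) _ s (C t) hs (hsC t) (fun o o' => hf t ω o o')
    have h2 := EE_mono hw l _ _ h1 ω
    simp only [EE]
    refine h2.trans ?_
    rw [EE_const_mul]
    have h3 := ih (avgAt w t f) hg ω
    calc _ ≤ Real.exp (s ^ 2 * C t ^ 2) * _ := mul_le_mul_of_nonneg_left h3 (Real.exp_pos _).le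
      _ = _ := by rw [← Real.exp_add]; congr 1; simp; ring

end EOp

/-- One-dimensional bin packing. -/
lemma bin_pack {ι : Type} [DecidableEq ι] (σ : ι → ℝ) (h0 : ∀ j, 0 ≤ σ j) (h1 : ∀ j, σ j ≤ 1)
    (k : ℕ) (A : Finset ι) (hk : 2 * ∑ j ∈ A, σ j < k) :
    ∃ f : ι → ℕ, (∀ j, f j < k) ∧ ∀ i, ∑ j ∈ A.filter (fun j => f j = i), σ j ≤ 1 := by
  induction A using Finset.induction_on_min_value σ with
  | empty =>
    have : 0 < k := by simpa using hk
    exact ⟨fun _ => 0, fun _ => this, fun i => by simp⟩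
  | insert a A ha hmin ih =>
    rw [Finset.sum_insert ha] at hk
    obtain ⟨f, hf, hload⟩ := ih (by linarith [h0 a])
    by_cases hex : ∃ i < k, ∑ j ∈ A.filter (fun j => f j = i), σ j + σ a ≤ 1
    · obtain ⟨i, hi, hle⟩ := hex
      refine ⟨Function.update f a i, ?_, ?_⟩
      · intro j
        by_cases h : j = a
        · subst h; simpa using hi
        · simpa [h] using hf j
      · intro i'
        have hfil : A.filter (fun j => Function.update f a i j = i') = A.filter (fun j => f j = i') := by
          refine Finset.filter_congr fun j hj => ?_
          have : j ≠ a := by rintro rfl; exact ha hj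
          simp [this]
        rw [Finset.filter_insert, hfil]
        by_cases h : i = i'
        · subst h
          simp only [Function.update_self, if_true]
          rw [Finset.sum_insert (by simp [ha])]
          linarith
        · simpa [h] using hload i'
    · exfalso
      push Not at hex
      have hb : ∀ i ∈ Finset.range k, (1/2 : ℝ) ≤ ∑ j ∈ A.filter (fun j => f j = i), σ j := by
        intro i hi
        have h2 := hex i (Finset.mem_range.mp hi)
        by_cases hs : σ a ≤ 1/2
        · linarith
        · have hne : (A.filter (fun j => f j = i)).Nonempty := by
            by_contra hne
            rw [Finset.not_nonempty_iff_eq_empty] at hne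
            rw [hne] at h2
            simp at h2
            linarith [h1 a]
          obtain ⟨j, hj⟩ := hne
          have := Finset.single_le_sum (f := σ) (fun j _ => h0 j) hj
          have := hmin j (Finset.mem_filter.mp hj).1
          linarith
      have hs := Finset.sum_le_sum hb
      rw [Finset.sum_fiberwise_of_maps_to (fun j _ => Finset.mem_range.mpr (hf j))] at hs
      simp at hs
      linarith [h0 a]

/-- Splitting a fractional mass into units. -/
lemma units (y : ℤ → ℝ) (h1 : ∀ t, y t ≤ 1) (p : ℕ) :
    ∀ X : Finset ℤ, (p : ℝ) ≤ ∑ t ∈ X, y t →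
    ∃ U : ℕ → Finset ℤ, (∀ u, U u ⊆ X) ∧ (∀ u v, u ≠ v → Disjoint (U u) (U v)) ∧
      ∀ u < p, (1/2 : ℝ) ≤ ∑ t ∈ U u, y t := by
  induction p with
  | zero => intro X _; exact ⟨fun _ => ∅, by simp, by simp, by simp⟩
  | succ p ih =>
    intro X hX
    push_cast at hX
    have hne : (X.powerset.filter (fun V => (1/2 : ℝ) ≤ ∑ t ∈ V, y t)).Nonempty :=
      ⟨X, by simp; have : (0:ℝ) ≤ p := p.cast_nonneg; linarith⟩
    obtain ⟨V, hV, hmin⟩ := Finset.exists_min_image _ Finset.card hne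
    simp only [Finset.mem_filter, Finset.mem_powerset] at hV hmin
    have hVle : ∑ t ∈ V, y t ≤ 1 := by
      by_contra! hgt
      have hVne : V.Nonempty := by
        by_contra hne
        rw [Finset.not_nonempty_iff_eq_empty] at hne
        rw [hne] at hgt
        norm_num at hgt
      obtain ⟨t, ht⟩ := hVne
      have e := Finset.add_sum_erase V y ht
      have hlt : (1/2 : ℝ) > ∑ t ∈ V.erase t, y t := by
        by_contra! hc
        have := hmin (V.erase t) ⟨(Finset.erase_subset _ _).trans hV.1, hc⟩
        have := Finset.card_erase_lt_of_mem ht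
        omega
      have hty : (1/2 : ℝ) ≤ y t := by linarith
      have h5 := hmin {t} ⟨by simpa using hV.1 ht, by simpa using hty⟩
      have hc : V.card = 1 := by
        have := Finset.card_pos.mpr ⟨t, ht⟩
        rw [Finset.card_singleton] at h5
        omega
      obtain ⟨t', rfl⟩ := Finset.card_eq_one.mp hc
      simp at hgt
      linarith [h1 t']
    have hsd : (p : ℝ) ≤ ∑ t ∈ X \ V, y t := by
      have := Finset.sum_sdiff hV.1 (f := y)
      linarith
    obtain ⟨U, hU1, hU2, hU3⟩ := ih (X \ V) hsd
    refine ⟨fun u => if u = p then V else if u < p then U u else ∅, ?_, ?_, ?_⟩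
    · intro u
      dsimp only
      split_ifs
      · exact hV.1
      · exact (hU1 u).trans Finset.sdiff_subset
      · simp
    · intro u v huv
      have hd : ∀ u, Disjoint V (U u) := fun u =>
        Finset.disjoint_of_subset_right (hU1 u) Finset.disjoint_sdiff
      dsimp only
      split_ifs <;> first | omega | simp | exact hd _ | exact (hd _).symm | exact hU2 _ _ huv
    · intro u hu
      dsimp only
      split_ifs with h h'
      · exact hV.2
      · exact hU3 u h'
      · omega

/-- Greedy placement of residual demands. -/
lemma greedy_s17 {ι : Type} [DecidableEq ι] (χ : ι → Finset ℤ) (p : ι → ℕ) (A : ι → Finset ℤ)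
    (q : ι → ℕ) (σ : ι → ℝ) (h0 : ∀ j, 0 ≤ σ j) (h1 : ∀ j, σ j ≤ 1) (m : ℝ) (hm : 0 < m)
    (hq : ∀ j, (A j).card + q j = p j)
    (hp1 : ∀ j, 1 ≤ p j)
    (hp : ∀ j, (p j : ℝ) ≤ (χ j).card / 4) (B : Finset ι)
    (hR : ∀ j ∈ B, ∑ i ∈ B.filter (fun i => (χ i).card ≤ (χ j).card ∧ (χ i ∩ χ j).Nonempty),
      σ i * q i ≤ m * (χ j).card / 2) :
    ∃ Q : ι → Finset ℤ, (∀ j ∈ B, Q j ⊆ χ j \ A j ∧ (Q j).card = q j) ∧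
      ∀ t, ∑ j ∈ B.filter (fun j => t ∈ Q j), σ j ≤ m + 1 := by
  induction B using Finset.induction_on_max_value (fun j => (χ j).card) with
  | empty => exact ⟨fun _ => ∅, by simp, fun t => by simp; linarith⟩
  | insert a B ha hmax ih =>
    have hmono : ∀ j ∈ insert a B, ∑ i ∈ B.filter (fun i => (χ i).card ≤ (χ j).card ∧ (χ i ∩ χ j).Nonempty),
      σ i * q i ≤ m * (χ j).card / 2 := by
      intro j hj
      refine le_trans ?_ (hR j hj)
      apply Finset.sum_le_sum_of_subset_of_nonneg
      · exact Finset.filter_subset_filter _ (Finset.subset_insert _ _)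
      · intro i _ _; exact mul_nonneg (h0 i) (Nat.cast_nonneg _)
    obtain ⟨Q, hQ, hload⟩ := ih (fun j hj => hmono j (Finset.mem_insert_of_mem hj))
    set ld : ℤ → ℝ := fun t => ∑ j ∈ B.filter (fun j => t ∈ Q j), σ j with hld
    have hld0 : ∀ t, 0 ≤ ld t := fun t => Finset.sum_nonneg fun j _ => h0 j
    set G := (χ a \ A a).filter (fun t => ld t ≤ m) with hG
    have hGc : q a ≤ G.card := by
      by_contra! hlt
      set Fu := (χ a).filter (fun t => ¬ ld t ≤ m) with hFu
      have hsub : χ a ⊆ A a ∪ (G ∪ Fu) := by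
        intro t ht
        simp only [hG, hFu, Finset.mem_union, Finset.mem_filter, Finset.mem_sdiff]
        tauto
      have hc1 := Finset.card_le_card hsub
      have hc2 := Finset.card_union_le (A a) (G ∪ Fu)
      have hc3 := Finset.card_union_le G Fu
      have hc4 : (χ a).card ≤ p a + Fu.card := by have := hq a; omega
      have hc5 : ((χ a).card : ℝ) ≤ p a + Fu.card := by exact_mod_cast hc4
      have hlow : m * Fu.card ≤ ∑ t ∈ χ a, ld t := by
        calc m * Fu.card = ∑ t ∈ Fu, m := by simp [mul_comm]
          _ ≤ ∑ t ∈ Fu, ld t := Finset.sum_le_sum fun t ht => by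
              have := (Finset.mem_filter.mp ht).2; linarith
          _ ≤ _ := Finset.sum_le_sum_of_subset_of_nonneg (Finset.filter_subset _ _)
              (fun t _ _ => hld0 t)
      have hup : ∑ t ∈ χ a, ld t ≤ m * (χ a).card / 2 := by
        refine le_trans ?_ (hmono a (Finset.mem_insert_self _ _))
        have e : ∑ t ∈ χ a, ld t = ∑ j ∈ B, σ j * ((χ a).filter (fun t => t ∈ Q j)).card := by
          simp only [hld, Finset.sum_filter]
          rw [Finset.sum_comm]
          refine Finset.sum_congr rfl fun j _ => ?_
          rw [← Finset.sum_filter]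
          simp [mul_comm]
        rw [e, Finset.sum_filter]
        refine Finset.sum_le_sum fun j hj => ?_
        split_ifs with hh
        · apply mul_le_mul_of_nonneg_left _ (h0 j)
          rw [← (hQ j hj).2]
          exact_mod_cast Finset.card_le_card (fun t ht => (Finset.mem_filter.mp ht).2)
        · have : (χ a).filter (fun t => t ∈ Q j) = ∅ := by
            rw [Finset.filter_eq_empty_iff]
            intro t ht htQ
            apply hh
            refine ⟨hmax j hj, t, ?_⟩
            have := (hQ j hj).1 htQ
            simp at this
            simp [this, ht]
          rw [this]; simp
      have hpa := hp a
      have hp1a : (1 : ℝ) ≤ p a := by exact_mod_cast hp1 a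
      have : m * Fu.card ≥ m * ((χ a).card * (3/4)) := mul_le_mul_of_nonneg_left (by linarith) hm.le
      have : 0 < m * (χ a).card := mul_pos hm (by linarith)
      nlinarith
    obtain ⟨Z, hZ1, hZ2⟩ := Finset.exists_subset_card_eq hGc
    have hfil : ∀ t, B.filter (fun j => t ∈ Function.update Q a Z j) = B.filter (fun j => t ∈ Q j) := by
      intro t
      refine Finset.filter_congr fun j hj => ?_
      have : j ≠ a := by rintro rfl; exact ha hj
      simp [this]
    refine ⟨Function.update Q a Z, ?_, ?_⟩
    · intro j hj
      rcases Finset.mem_insert.mp hj with rfl | hj'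
      · simp only [Function.update_self]
        exact ⟨hZ1.trans (Finset.filter_subset _ _), hZ2⟩
      · have : j ≠ a := fun e => ha (e ▸ hj')
        simpa [this] using hQ j hj'
    · intro t
      rw [Finset.filter_insert, hfil]
      simp only [Function.update_self]
      split_ifs with ht
      · rw [Finset.sum_insert (by simp [ha])]
        have := (Finset.mem_filter.mp (hZ1 ht)).2
        have h1a := h1 a
        simp only [hld] at this
        linarith
      · exact hload t

section InstSec
set_option linter.unusedSectionVars false
variable {ι : Type} [Fintype ι] [DecidableEq ι] {d : ℕ}

/-- Fractional amount of job `j` processed at time `t`. -/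
noncomputable def yy (x : Finset ι → ℤ → ℝ) (j : ι) (t : ℤ) : ℝ :=
  ∑ S ∈ Finset.univ.filter (fun S : Finset ι => j ∈ S), x S t

structure Inst (r dd : ι → ℤ) (p : ι → ℕ) (s : ι → Fin d → ℝ) (σ : ι → ℝ)
    (x : Finset ι → ℤ → ℝ) (m : ℕ) : Prop where
  hm : 1 ≤ m
  hp1 : ∀ j, 1 ≤ p j
  hp : ∀ j, (p j : ℝ) ≤ ((Finset.Icc (r j) (dd j)).card : ℝ) / 4
  s0 : ∀ j i, 0 ≤ s j i
  σ0 : ∀ j, 0 ≤ σ j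
  σ1 : ∀ j, σ j ≤ 1
  sσ : ∀ j i, s j i ≤ σ j
  σs : ∀ j, σ j ≤ ∑ i, s j i
  x0 : ∀ S t, 0 ≤ x S t
  xv : ∀ S t, x S t ≠ 0 → ValidConfig r dd s S t
  xm : ∀ t, ∑ S : Finset ι, x S t ≤ (m : ℝ)
  y1 : ∀ j t, yy x j t ≤ 1
  yp : ∀ j, (p j : ℝ) ≤ ∑ t ∈ Finset.Icc (r j) (dd j), yy x j t

open Classical in
/-- A set, replaced by the empty set when it is not a valid configuration. -/
noncomputable def eff (r dd : ι → ℤ) (s : ι → Fin d → ℝ) (S : Finset ι) (t : ℤ) : Finset ι :=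
  if ValidConfig r dd s S t then S else ∅

/-- The sampling distribution of a pick at a coordinate. -/
noncomputable def wt (x : Finset ι → ℤ → ℝ) (m : ℕ) (c : ℤ × ℕ) (S : Finset ι) : ℝ :=
  x S c.1 / m + if S = ∅ then 1 - (∑ S', x S' c.1) / m else 0

variable {r dd : ι → ℤ} {p : ι → ℕ} {s : ι → Fin d → ℝ} {σ : ι → ℝ}
  {x : Finset ι → ℤ → ℝ} {m : ℕ}

lemma eff_valid (S : Finset ι) (t : ℤ) : ValidConfig r dd s (eff r dd s S t) t := by
  unfold eff
  split_ifs with h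
  · exact h
  · exact ⟨by simp, by simp⟩

lemma sum_sigma_le (I : Inst r dd p s σ x m) (S : Finset ι) (t : ℤ) (h : ValidConfig r dd s S t) :
    ∑ j ∈ S, σ j ≤ d := by
  calc ∑ j ∈ S, σ j ≤ ∑ j ∈ S, ∑ i, s j i := Finset.sum_le_sum fun j _ => I.σs j
    _ = ∑ i, ∑ j ∈ S, s j i := Finset.sum_comm
    _ ≤ ∑ i : Fin d, (1 : ℝ) := Finset.sum_le_sum fun i _ => h.2 i
    _ = d := by simp

lemma wt_nonneg (I : Inst r dd p s σ x m) (c : ℤ × ℕ) (S : Finset ι) : 0 ≤ wt x m c S := by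
  have hm : (0 : ℝ) < m := by exact_mod_cast I.hm
  unfold wt
  have h1 : 0 ≤ x S c.1 / m := div_nonneg (I.x0 _ _) hm.le
  split_ifs
  · have : (∑ S', x S' c.1) / m ≤ 1 := (div_le_one hm).mpr (I.xm _)
    linarith
  · linarith

lemma wt_sum (c : ℤ × ℕ) : ∑ S, wt x m c S = 1 := by
  unfold wt
  rw [Finset.sum_add_distrib, ← Finset.sum_div]
  simp

lemma wt_miss (I : Inst r dd p s σ x m) (c : ℤ × ℕ) (j : ι) :
    ∑ S, wt x m c S * (if j ∈ eff r dd s S c.1 then 0 else 1) = 1 - yy x j c.1 / m := by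
  have h1 : ∀ S, wt x m c S * (if j ∈ eff r dd s S c.1 then (0 : ℝ) else 1)
      = wt x m c S - (if j ∈ S then x S c.1 / m else 0) := by
    intro S
    by_cases hv : ValidConfig r dd s S c.1
    · simp only [eff, hv, if_true]
      by_cases hj : j ∈ S
      · have : S ≠ ∅ := by rintro rfl; simp at hj
        simp [hj, wt, this]
      · simp [hj]
    · have hx : x S c.1 = 0 := by
        by_contra h; exact hv (I.xv _ _ h)
      simp [eff, hv, hx]
  simp only [h1]
  rw [Finset.sum_sub_distrib, wt_sum, ← Finset.sum_filter, ← Finset.sum_div]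
  rfl

lemma yy_nonneg (I : Inst r dd p s σ x m) (j : ι) (t : ℤ) : 0 ≤ yy x j t :=
  Finset.sum_nonneg fun S _ => I.x0 _ _

lemma volume_le (I : Inst r dd p s σ x m) (A : Finset ι) (W : Finset ℤ)
    (hA : ∀ j ∈ A, Finset.Icc (r j) (dd j) ⊆ W) :
    ∑ j ∈ A, σ j * p j ≤ d * m * W.card := by
  calc ∑ j ∈ A, σ j * p j ≤ ∑ j ∈ A, ∑ t ∈ W, σ j * yy x j t := by
        refine Finset.sum_le_sum fun j hj => ?_
        rw [← Finset.mul_sum]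
        refine mul_le_mul_of_nonneg_left ((I.yp j).trans ?_) (I.σ0 j)
        exact Finset.sum_le_sum_of_subset_of_nonneg (hA j hj) fun t _ _ => yy_nonneg I j t
    _ = ∑ t ∈ W, ∑ S, x S t * ∑ j ∈ A.filter (fun j => j ∈ S), σ j := by
        rw [Finset.sum_comm]
        refine Finset.sum_congr rfl fun t _ => ?_
        simp only [yy, Finset.sum_filter, Finset.mul_sum]
        rw [Finset.sum_comm]
        refine Finset.sum_congr rfl fun S _ => Finset.sum_congr rfl fun j _ => ?_
        split_ifs <;> ring
    _ ≤ ∑ t ∈ W, ∑ S, x S t * d := by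
        refine Finset.sum_le_sum fun t _ => Finset.sum_le_sum fun S _ => ?_
        by_cases h : x S t = 0
        · simp [h]
        · refine mul_le_mul_of_nonneg_left ?_ (I.x0 _ _)
          refine le_trans ?_ (sum_sigma_le I S t (I.xv _ _ h))
          exact Finset.sum_le_sum_of_subset_of_nonneg
            (fun j hj => (Finset.mem_filter.mp hj).2) fun j _ _ => I.σ0 j
    _ ≤ ∑ t ∈ W, (m : ℝ) * d := by
        refine Finset.sum_le_sum fun t _ => ?_
        rw [← Finset.sum_mul]
        exact mul_le_mul_of_nonneg_right (I.xm t) (Nat.cast_nonneg _)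
    _ = _ := by simp; ring

/-- Indicator that unit `u` of job `j` is missed by all picks. -/
noncomputable def unc (r dd : ι → ℤ) (s : ι → Fin d → ℝ) (U : ι → ℕ → Finset ℤ) (M : ℕ)
    (j : ι) (u : ℕ) (ω : ℤ × ℕ → Finset ι) : ℝ :=
  ∏ c ∈ U j u ×ˢ Finset.range M, (if j ∈ eff r dd s (ω c) c.1 then 0 else 1)

/-- Weighted residual of a set of jobs. -/
noncomputable def resid (r dd : ι → ℤ) (p : ι → ℕ) (s : ι → Fin d → ℝ) (σ : ι → ℝ)
    (U : ι → ℕ → Finset ℤ) (M : ℕ) (A : Finset ι) (ω : ℤ × ℕ → Finset ι) : ℝ :=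
  ∑ j ∈ A, σ j * ∑ u ∈ Finset.range (p j), unc r dd s U M j u ω

lemma unc_nonneg (U : ι → ℕ → Finset ℤ) (M : ℕ) (j : ι) (u : ℕ) (ω : ℤ × ℕ → Finset ι) :
    0 ≤ unc r dd s U M j u ω :=
  Finset.prod_nonneg fun c _ => by split_ifs <;> norm_num

lemma unc_le_one (U : ι → ℕ → Finset ℤ) (M : ℕ) (j : ι) (u : ℕ) (ω : ℤ × ℕ → Finset ι) :
    unc r dd s U M j u ω ≤ 1 :=
  Finset.prod_le_one (fun c _ => by split_ifs <;> norm_num) fun c _ => by split_ifs <;> norm_num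

structure JobUnits (r dd : ι → ℤ) (p : ι → ℕ) (x : Finset ι → ℤ → ℝ)
    (U : ι → ℕ → Finset ℤ) : Prop where
  sub : ∀ j u, U j u ⊆ Finset.Icc (r j) (dd j)
  disj : ∀ j u v, u ≠ v → Disjoint (U j u) (U j v)
  half : ∀ j, ∀ u < p j, (1/2 : ℝ) ≤ ∑ t ∈ U j u, yy x j t

lemma exists_units (I : Inst r dd p s σ x m) : ∃ U, JobUnits r dd p x U := by
  have := fun j => units (yy x j) (I.y1 j) (p j) _ (I.yp j)
  choose U h1 h2 h3 using this
  exact ⟨U, h1, h2, h3⟩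

variable {U : ι → ℕ → Finset ℤ}

lemma mean_unc (I : Inst r dd p s σ x m) (hU : JobUnits r dd p x U) (κ : ℕ) (l : List (ℤ × ℕ))
    (j : ι) (u : ℕ) (hu : u < p j)
    (hl : ∀ t ∈ U j u, ∀ i < m * κ, (t, i) ∈ l) (ω : ℤ × ℕ → Finset ι) :
    EE (wt x m) l (unc r dd s U (m * κ) j u) ω ≤ Real.exp (-(κ / 2 : ℝ)) := by
  have hm : (0 : ℝ) < m := by exact_mod_cast I.hm
  have hm1 : (1 : ℝ) ≤ m := by exact_mod_cast I.hm
  unfold unc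
  rw [EE_prod (w := wt x m) wt_sum _ l
    (fun c S => if j ∈ eff r dd s S c.1 then (0 : ℝ) else 1) ω]
  calc _ ≤ ∏ c ∈ U j u ×ˢ Finset.range (m * κ), Real.exp (- (yy x j c.1 / m)) := by
        refine Finset.prod_le_prod ?_ ?_
        · intro c _
          split_ifs
          · exact Finset.sum_nonneg fun S _ => mul_nonneg (wt_nonneg I _ _) (by split_ifs <;> norm_num)
          · norm_num
          · norm_num
        · intro c hc
          rw [Finset.mem_product, Finset.mem_range] at hc
          rw [if_pos (hl c.1 hc.1 c.2 hc.2), wt_miss I]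
          have := Real.add_one_le_exp (-(yy x j c.1 / m))
          linarith
    _ = Real.exp (-(κ * ∑ t ∈ U j u, yy x j t)) := by
        rw [← Real.exp_sum, Finset.sum_product]
        congr 1
        simp only [Finset.sum_const, Finset.card_range, nsmul_eq_mul]
        rw [Finset.mul_sum, ← Finset.sum_neg_distrib]
        refine Finset.sum_congr rfl fun t _ => ?_
        push_cast
        field_simp
    _ ≤ _ := by
        apply Real.exp_le_exp.mpr
        have := mul_le_mul_of_nonneg_left (hU.half j u hu) (Nat.cast_nonneg κ : (0:ℝ) ≤ κ)
        linarith

lemma mean_resid (I : Inst r dd p s σ x m) (hU : JobUnits r dd p x U) (κ : ℕ) (l : List (ℤ × ℕ))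
    (A : Finset ι) (W : Finset ℤ) (hA : ∀ j ∈ A, Finset.Icc (r j) (dd j) ⊆ W)
    (hl : ∀ j ∈ A, ∀ t ∈ Finset.Icc (r j) (dd j), ∀ i < m * κ, (t, i) ∈ l)
    (ω : ℤ × ℕ → Finset ι) :
    EE (wt x m) l (resid r dd p s σ U (m * κ) A) ω
      ≤ Real.exp (-(κ / 2 : ℝ)) * (d * m * W.card) := by
  have e : EE (wt x m) l (resid r dd p s σ U (m * κ) A) ω
      = ∑ j ∈ A, σ j * ∑ u ∈ Finset.range (p j), EE (wt x m) l (unc r dd s U (m * κ) j u) ω := by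
    unfold resid
    rw [EE_sum]
    refine Finset.sum_congr rfl fun j _ => ?_
    rw [EE_const_mul, EE_sum]
  rw [e]
  calc _ ≤ ∑ j ∈ A, σ j * ∑ u ∈ Finset.range (p j), Real.exp (-(κ / 2 : ℝ)) := by
        refine Finset.sum_le_sum fun j hj => mul_le_mul_of_nonneg_left ?_ (I.σ0 j)
        refine Finset.sum_le_sum fun u hu => ?_
        exact mean_unc I hU κ l j u (Finset.mem_range.mp hu)
          (fun t ht i hi => hl j hj t (hU.sub j u ht) i hi) ω
    _ = Real.exp (-(κ / 2 : ℝ)) * ∑ j ∈ A, σ j * p j := by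
        rw [Finset.mul_sum]
        refine Finset.sum_congr rfl fun j _ => ?_
        simp; ring
    _ ≤ _ := mul_le_mul_of_nonneg_left (volume_le I A W hA) (Real.exp_pos _).le

lemma unc_update_notMem (M : ℕ) (j : ι) (u : ℕ) (ω : ℤ × ℕ → Finset ι) (c : ℤ × ℕ) (S : Finset ι)
    (hc : c.1 ∉ U j u) :
    unc r dd s U M j u (Function.update ω c S) = unc r dd s U M j u ω := by
  unfold unc
  refine Finset.prod_congr rfl fun c' hc' => ?_
  have : c' ≠ c := by
    rintro rfl
    exact hc (Finset.mem_product.mp hc').1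
  simp [this]

lemma bdd_resid (I : Inst r dd p s σ x m) (hU : JobUnits r dd p x U) (M : ℕ)
    (A : Finset ι) (W : Finset ℤ) (hA : ∀ j ∈ A, Finset.Icc (r j) (dd j) ⊆ W)
    (c : ℤ × ℕ) (ω : ℤ × ℕ → Finset ι) (S S' : Finset ι) :
    resid r dd p s σ U M A (Function.update ω c S) - resid r dd p s σ U M A (Function.update ω c S')
      ≤ if c.1 ∈ W then (d : ℝ) else 0 := by
  unfold resid
  rw [← Finset.sum_sub_distrib]
  split_ifs with hW
  · have key : ∀ j ∈ A, σ j * ∑ u ∈ Finset.range (p j), unc r dd s U M j u (Function.update ω c S)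
        - σ j * ∑ u ∈ Finset.range (p j), unc r dd s U M j u (Function.update ω c S')
        ≤ if j ∈ eff r dd s S' c.1 then σ j else 0 := by
      intro j _
      rw [← mul_sub, ← Finset.sum_sub_distrib]
      split_ifs with hj
      · have : ∑ u ∈ Finset.range (p j), (unc r dd s U M j u (Function.update ω c S)
            - unc r dd s U M j u (Function.update ω c S')) ≤ 1 := by
          calc _ ≤ ∑ u ∈ Finset.range (p j), (if c.1 ∈ U j u then (1 : ℝ) else 0) := by
                refine Finset.sum_le_sum fun u _ => ?_
                split_ifs with h
                · linarith [unc_le_one (r := r) (dd := dd) (s := s) U M j u (Function.update ω c S),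
                    unc_nonneg (r := r) (dd := dd) (s := s) U M j u (Function.update ω c S')]
                · rw [unc_update_notMem _ _ _ _ _ _ h, unc_update_notMem _ _ _ _ _ _ h, sub_self]
            _ ≤ 1 := by
                rw [← Finset.sum_filter]
                simp only [Finset.sum_const, nsmul_eq_mul, mul_one]
                have : ((Finset.range (p j)).filter (fun u => c.1 ∈ U j u)).card ≤ 1 := by
                  rw [Finset.card_le_one]
                  intro a ha b hb
                  by_contra hab
                  exact Finset.disjoint_left.mp (hU.disj j a b hab) (Finset.mem_filter.mp ha).2
                    (Finset.mem_filter.mp hb).2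
                exact_mod_cast this
        nlinarith [I.σ0 j]
      · have : ∑ u ∈ Finset.range (p j), (unc r dd s U M j u (Function.update ω c S)
            - unc r dd s U M j u (Function.update ω c S')) ≤ 0 := by
          refine Finset.sum_nonpos fun u _ => ?_
          rw [sub_nonpos]
          unfold unc
          refine Finset.prod_le_prod (fun c' _ => by split_ifs <;> norm_num) fun c' _ => ?_
          by_cases h : c' = c
          · subst h
            simp only [Function.update_self, hj, if_false]
            split_ifs <;> norm_num
          · simp [h]
        nlinarith [I.σ0 j]
    refine (Finset.sum_le_sum key).trans ?_
    rw [← Finset.sum_filter]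
    refine le_trans ?_ (sum_sigma_le I _ c.1 (eff_valid (r := r) (dd := dd) (s := s) S' c.1))
    exact Finset.sum_le_sum_of_subset_of_nonneg
      (fun j hj => (Finset.mem_filter.mp hj).2) fun j _ _ => I.σ0 j
  · refine Finset.sum_nonpos fun j hj => ?_
    have h : ∀ u, c.1 ∉ U j u := fun u h => hW (hA j hj (hU.sub j u h))
    simp only [unc_update_notMem _ _ _ _ _ _ (h _), sub_self, le_refl]

open Classical in
/-- Slots at which `j` is picked. -/
noncomputable def hits (r dd : ι → ℤ) (s : ι → Fin d → ℝ) (M : ℕ) (ω : ℤ × ℕ → Finset ι) (j : ι) : Finset ℤ :=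
  (Finset.Icc (r j) (dd j)).filter (fun t => ∃ i < M, j ∈ eff r dd s (ω (t, i)) t)

lemma deficit_le (hU : JobUnits r dd p x U) (M : ℕ) (ω : ℤ × ℕ → Finset ι) (j : ι) :
    ((p j - (hits r dd s M ω j).card : ℕ) : ℝ) ≤ ∑ u ∈ Finset.range (p j), unc r dd s U M j u ω := by
  set H := hits r dd s M ω j with hH
  have hnn : 0 ≤ ∑ u ∈ Finset.range (p j), unc r dd s U M j u ω :=
    Finset.sum_nonneg fun u _ => unc_nonneg U M j u ω
  have h1 : ∀ u ∈ Finset.range (p j), 1 - unc r dd s U M j u ω ≤ ((U j u ∩ H).card : ℝ) := by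
    intro u _
    by_cases h : ∃ c ∈ U j u ×ˢ Finset.range M, j ∈ eff r dd s (ω c) c.1
    · obtain ⟨c, hc, hj⟩ := h
      rw [Finset.mem_product, Finset.mem_range] at hc
      have hmem : c.1 ∈ U j u ∩ H := by
        rw [Finset.mem_inter]
        refine ⟨hc.1, ?_⟩
        simp only [hH, hits, Finset.mem_filter]
        exact ⟨hU.sub j u hc.1, c.2, hc.2, hj⟩
      have : 1 ≤ (U j u ∩ H).card := Finset.card_pos.mpr ⟨_, hmem⟩
      have : (1 : ℝ) ≤ (U j u ∩ H).card := by exact_mod_cast this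
      linarith [unc_nonneg (r := r) (dd := dd) (s := s) U M j u ω]
    · push Not at h
      have : unc r dd s U M j u ω = 1 := Finset.prod_eq_one fun c hc => by simp [h c hc]
      rw [this]; simp
  have h2 : ∑ u ∈ Finset.range (p j), (U j u ∩ H).card ≤ H.card := by
    rw [← Finset.card_biUnion]
    · exact Finset.card_le_card (Finset.biUnion_subset.mpr fun u _ => Finset.inter_subset_right)
    · intro a _ b _ hab
      exact Finset.disjoint_of_subset_left Finset.inter_subset_left
        (Finset.disjoint_of_subset_right Finset.inter_subset_left (hU.disj j a b hab))
  have h3 := Finset.sum_le_sum h1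
  rw [Finset.sum_sub_distrib] at h3
  have h4 : (∑ u ∈ Finset.range (p j), ((U j u ∩ H).card : ℝ)) ≤ H.card := by exact_mod_cast h2
  simp at h3
  rcases le_total (p j) H.card with h | h
  · rw [Nat.sub_eq_zero_of_le h]; simpa using hnn
  · rw [Nat.cast_sub h]; linarith

end InstSec

/-- `logStar` facts. -/
noncomputable def tow : ℕ → ℝ
  | 0 => 1
  | k + 1 => (2 : ℝ) ^ tow k

lemma tow_ge_one (k : ℕ) : 1 ≤ tow k := by
  induction k with
  | zero => simp [tow]
  | succ k ih => exact Real.one_le_rpow (by norm_num) (by linarith)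

lemma logb_le_sub_one {y : ℝ} (hy : 2 ≤ y) : Real.logb 2 y ≤ y - 1 := by
  rw [Real.logb_le_iff_le_rpow (by norm_num) (by linarith)]
  have := one_add_mul_self_le_rpow_one_add (s := 1) (by norm_num) (p := y - 1) (by linarith)
  norm_num at this
  linarith

lemma logStar_nonempty (x : ℝ) : {k : ℕ | iterLog2 k x ≤ 1}.Nonempty := by
  by_contra hne
  rw [Set.not_nonempty_iff_eq_empty, Set.eq_empty_iff_forall_notMem] at hne
  simp only [Set.mem_ofPred_eq, not_le] at hne
  have h2 : ∀ k, 2 ≤ iterLog2 k x := by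
    intro k
    by_contra! h
    have h1 := hne (k + 1)
    have h0 := hne k
    simp only [iterLog2] at h1
    rw [Real.lt_logb_iff_rpow_lt (by norm_num) (by linarith)] at h1
    norm_num at h1
    linarith
  have h3 : ∀ k : ℕ, iterLog2 k x ≤ x - k := by
    intro k
    induction k with
    | zero => simp [iterLog2]
    | succ k ih =>
      have := logb_le_sub_one (h2 k)
      simp only [iterLog2]
      push_cast
      linarith
  obtain ⟨n, hn⟩ := exists_nat_gt x
  linarith [h3 n, h2 n]

lemma le_tow_logStar (x : ℝ) : x ≤ tow (logStar x) := by
  have hmem : iterLog2 (logStar x) x ≤ 1 := Nat.sInf_mem (logStar_nonempty x)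
  have hlt : ∀ k < logStar x, 1 < iterLog2 k x := by
    intro k hk
    have := Nat.notMem_of_lt_sInf hk
    simpa using this
  have h : ∀ i ≤ logStar x, iterLog2 (logStar x - i) x ≤ tow i := by
    intro i
    induction i with
    | zero => intro _; simpa [tow] using hmem
    | succ i ih =>
      intro hi
      have h1 := ih (by omega)
      have e : logStar x - i = (logStar x - (i + 1)) + 1 := by omega
      rw [e] at h1
      simp only [iterLog2] at h1
      have hpos := hlt (logStar x - (i + 1)) (by omega)
      rw [Real.logb_le_iff_le_rpow (by norm_num) (by linarith)] at h1
      exact h1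
  have := h _ le_rfl
  simpa [iterLog2] using this

/-- Class thresholds. -/
noncomputable def beta (b : ℝ) : ℕ → ℝ
  | 0 => b
  | k + 1 => Real.exp (Real.sqrt (beta b k))

lemma aux_exp {y : ℝ} (hy : 1 ≤ y) : (6 * (2 : ℝ) ^ y) ^ 2 ≤ Real.exp (6 * y) := by
  have h1 : (2 : ℝ) ^ y ≤ Real.exp y := by
    rw [Real.rpow_def_of_pos (by norm_num)]
    apply Real.exp_le_exp.mpr
    have := Real.log_two_lt_d9
    nlinarith
  have h2 : (36 : ℝ) ≤ Real.exp (4 * y) := by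
    have h4 : Real.exp 4 ≤ Real.exp (4 * y) := Real.exp_le_exp.mpr (by linarith)
    have h5 : (2.7 : ℝ) ≤ Real.exp 1 := by linarith [Real.exp_one_gt_d9]
    have h6 : Real.exp 4 = Real.exp 1 ^ 4 := by rw [← Real.exp_nat_mul]; norm_num
    have h7 : (2.7 : ℝ) ^ 4 ≤ Real.exp 1 ^ 4 := pow_le_pow_left₀ (by norm_num) h5 4
    norm_num at h7
    linarith
  have h3 : Real.exp (6 * y) = Real.exp (4 * y) * Real.exp y ^ 2 := by
    rw [← Real.exp_nat_mul, ← Real.exp_add]; congr 1; push_cast; ring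
  have h8 : ((2 : ℝ) ^ y) ^ 2 ≤ Real.exp y ^ 2 := pow_le_pow_left₀ (by positivity) h1 2
  rw [h3, mul_pow]
  have : (0:ℝ) ≤ ((2 : ℝ) ^ y) ^ 2 := by positivity
  nlinarith

lemma beta_ge (b : ℝ) (hb : 36 ≤ b) (k : ℕ) : (6 * tow k) ^ 2 ≤ beta b k := by
  induction k with
  | zero => simp [tow, beta]; linarith
  | succ k ih =>
    have h1 : 6 * tow k ≤ Real.sqrt (beta b k) := Real.le_sqrt_of_sq_le ih
    calc (6 * tow (k+1)) ^ 2 ≤ Real.exp (6 * tow k) := aux_exp (tow_ge_one k)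
      _ ≤ _ := Real.exp_le_exp.mpr h1

lemma tow_le_beta (b : ℝ) (hb : 36 ≤ b) (k : ℕ) : tow k ≤ beta b k := by
  have := beta_ge b hb k
  have := tow_ge_one k
  nlinarith

lemma le_exp_sqrt {y : ℝ} (hy : 36 ≤ y) : y ≤ Real.exp (Real.sqrt y) := by
  have h0 : 0 ≤ Real.sqrt y := Real.sqrt_nonneg y
  have h6 : 6 ≤ Real.sqrt y := Real.le_sqrt_of_sq_le (by norm_num; exact hy)
  have h1 := Real.sum_le_exp_of_nonneg h0 4
  simp [Finset.sum_range_succ, Nat.factorial] at h1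
  have h2 : Real.sqrt y ^ 2 = y := Real.sq_sqrt (by linarith)
  have h3 : Real.sqrt y ^ 3 = y * Real.sqrt y := by rw [pow_succ, h2]
  rw [h2, h3] at h1
  nlinarith

lemma beta_ge_b (b : ℝ) (hb : 36 ≤ b) (k : ℕ) : b ≤ beta b k := by
  induction k with
  | zero => simp [beta]
  | succ k ih => exact ih.trans (le_exp_sqrt (hb.trans ih))

section Sched
set_option linter.unusedSectionVars false
variable {ι : Type} [Fintype ι] [DecidableEq ι] {d : ℕ}

/-- Schedulability of a subset of the jobs. -/
def SchedSub (k : ℕ) (r dd : ι → ℤ) (p : ι → ℕ) (s : ι → Fin d → ℝ) (B : Finset ι) : Prop :=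
  ∃ (Tj : ι → Finset ℤ) (h : ι → ℤ → ℕ),
    (∀ j ∈ B, Tj j ⊆ Finset.Icc (r j) (dd j) ∧ (Tj j).card = p j ∧ ∀ t, h j t < k) ∧
    ∀ (i : ℕ) (t : ℤ) (c : Fin d),
      ∑ j ∈ B.filter (fun j : ι => t ∈ Tj j ∧ h j t = i), s j c ≤ 1

lemma combine (k G : ℕ) (r dd : ι → ℤ) (p : ι → ℕ) (s : ι → Fin d → ℝ)
    (s0 : ∀ j i, 0 ≤ s j i) (g : ι → ℕ) (b : ι → ℤ) (hg : ∀ j, g j < G)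
    (hdis : ∀ j j', g j = g j' → b j ≠ b j' →
      Disjoint (Finset.Icc (r j) (dd j)) (Finset.Icc (r j') (dd j')))
    (hs : ∀ a e, SchedSub k r dd p s (Finset.univ.filter fun j => g j = a ∧ b j = e))
    (K : ℕ) (hK : G * k ≤ K) : SchedulableD K r dd p s := by
  choose Tj h h1 h2 using hs
  have hself : ∀ j, j ∈ (Finset.univ.filter fun j' => g j' = g j ∧ b j' = b j) := by simp
  have hlt : ∀ j t, g j * k + h (g j) (b j) j t < K := by
    intro j t
    have a1 := (h1 (g j) (b j) j (hself j)).2.2 t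
    have a2 := hg j
    calc g j * k + h (g j) (b j) j t < g j * k + k := by omega
      _ = (g j + 1) * k := by ring
      _ ≤ G * k := Nat.mul_le_mul_right _ a2
      _ ≤ K := hK
  refine ⟨fun j => Tj (g j) (b j) j, fun j t => ⟨_, hlt j t⟩, ?_, ?_⟩
  · intro j
    exact ⟨(h1 _ _ j (hself j)).1, (h1 _ _ j (hself j)).2.1⟩
  · intro i t c
    set X := Finset.univ.filter (fun j : ι => t ∈ Tj (g j) (b j) j ∧
      (⟨g j * k + h (g j) (b j) j t, hlt j t⟩ : Fin K) = i) with hX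
    rcases X.eq_empty_or_nonempty with he | ⟨j0, hj0⟩
    · rw [he]; simp
    · refine le_trans ?_ (h2 (g j0) (b j0) (h (g j0) (b j0) j0 t) t c)
      refine Finset.sum_le_sum_of_subset_of_nonneg ?_ fun j _ _ => s0 j c
      intro j hj
      simp only [hX, Finset.mem_filter, Finset.mem_univ, true_and] at hj hj0
      have a1 := (h1 (g j) (b j) j (hself j)).2.2 t
      have a2 := (h1 (g j0) (b j0) j0 (hself j0)).2.2 t
      have e : g j * k + h (g j) (b j) j t = g j0 * k + h (g j0) (b j0) j0 t := by
        have := hj.2.trans hj0.2.symm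
        simpa using this
      have hk : 0 < k := by omega
      have eg : g j = g j0 := by
        have e1 : (g j * k + h (g j) (b j) j t) / k = g j := by
          rw [Nat.add_comm, Nat.add_mul_div_right _ _ hk, Nat.div_eq_of_lt a1, zero_add]
        have e2 : (g j0 * k + h (g j0) (b j0) j0 t) / k = g j0 := by
          rw [Nat.add_comm, Nat.add_mul_div_right _ _ hk, Nat.div_eq_of_lt a2, zero_add]
        rw [← e1, ← e2, e]
      have eb : b j = b j0 := by
        by_contra hb
        exact Finset.disjoint_left.mp (hdis j j0 eg hb)
          ((h1 _ _ j (hself j)).1 hj.1) ((h1 _ _ j0 (hself j0)).1 hj0.1)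
      simp only [Finset.mem_filter, Finset.mem_univ, true_and]
      have hj1 := hj.1
      rw [eg, eb] at hj1 e
      exact ⟨⟨eg, eb⟩, hj1, Nat.add_left_cancel e⟩

variable {r dd : ι → ℤ} {p : ι → ℕ} {s : ι → Fin d → ℝ} {σ : ι → ℝ}
  {x : Finset ι → ℤ → ℝ} {m : ℕ} {U : ι → ℕ → Finset ℤ}

/-- Jobs of `B` with window meeting `W`, of size at most `W.card`. -/
noncomputable def near (r dd : ι → ℤ) (B : Finset ι) (W : Finset ℤ) : Finset ι :=
  B.filter (fun i => (Finset.Icc (r i) (dd i)).card ≤ W.card ∧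
    (Finset.Icc (r i) (dd i) ∩ W).Nonempty)

lemma sched_of_resid (I : Inst r dd p s σ x m) (hU : JobUnits r dd p x U) (M : ℕ)
    (ω : ℤ × ℕ → Finset ι) (B : Finset ι)
    (hR : ∀ j ∈ B, resid r dd p s σ U M (near r dd B (Finset.Icc (r j) (dd j))) ω
      ≤ m * ((Finset.Icc (r j) (dd j)).card : ℝ) / 2) :
    SchedSub (M + 5 * m) r dd p s B := by
  have hm : (1 : ℝ) ≤ m := by exact_mod_cast I.hm
  have hA : ∀ j, ∃ A ⊆ hits r dd s M ω j, A.card = min (p j) (hits r dd s M ω j).card :=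
    fun j => Finset.exists_subset_card_eq (min_le_right _ _)
  choose A hA1 hA2 using hA
  have hAw : ∀ j, A j ⊆ Finset.Icc (r j) (dd j) :=
    fun j => (hA1 j).trans (Finset.filter_subset _ _)
  obtain ⟨Q, hQ1, hQ2⟩ := greedy_s17 (fun j => Finset.Icc (r j) (dd j)) p A
    (fun j => p j - (hits r dd s M ω j).card) σ I.σ0 I.σ1 m (by linarith)
    (fun j => by have := hA2 j; omega) I.hp1 I.hp B
    (by
      intro j hj
      refine le_trans ?_ (hR j hj)
      exact Finset.sum_le_sum fun i _ =>
        mul_le_mul_of_nonneg_left (deficit_le hU M ω i) (I.σ0 i))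
  have hbin : ∀ t, ∃ f : ι → ℕ, (∀ j, f j < 5 * m) ∧ ∀ i,
      ∑ j ∈ (B.filter (fun j => t ∈ Q j)).filter (fun j => f j = i), σ j ≤ 1 := by
    intro t
    by_cases hlt : 2 * ∑ j ∈ B.filter (fun j => t ∈ Q j), σ j < ((5 * m : ℕ) : ℝ)
    · exact bin_pack σ I.σ0 I.σ1 (5 * m) _ hlt
    · have := hQ2 t
      push_cast at hlt
      exfalso; apply hlt; linarith
  choose f hf1 hf2 using hbin
  have hpick : ∀ j t, ∃ i, t ∈ A j → i < M ∧ j ∈ eff r dd s (ω (t, i)) t := by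
    intro j t
    by_cases ht : t ∈ A j
    · obtain ⟨i, hi⟩ := (Finset.mem_filter.mp (hA1 j ht)).2
      exact ⟨i, fun _ => hi⟩
    · exact ⟨0, fun h => absurd h ht⟩
  choose a ha using hpick
  refine ⟨fun j => A j ∪ Q j, fun j t => if t ∈ A j then a j t else M + f t j, ?_, ?_⟩
  · intro j hj
    have hdj : Disjoint (A j) (Q j) :=
      Finset.disjoint_of_subset_right (hQ1 j hj).1 Finset.disjoint_sdiff
    refine ⟨?_, ?_, ?_⟩
    · exact Finset.union_subset (hAw j) ((hQ1 j hj).1.trans Finset.sdiff_subset)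
    · rw [Finset.card_union_of_disjoint hdj, hA2, (hQ1 j hj).2]
      omega
    · intro t
      dsimp only
      split_ifs with h
      · have := (ha j t h).1; omega
      · have := hf1 t j; omega
  · intro i t c
    by_cases hi : i < M
    · have hv := (eff_valid (r := r) (dd := dd) (s := s) (ω (t, i)) t).2 c
      refine le_trans ?_ hv
      refine Finset.sum_le_sum_of_subset_of_nonneg ?_ fun j _ _ => I.s0 j c
      intro j hj
      obtain ⟨_, _, hj3⟩ := Finset.mem_filter.mp hj
      dsimp only at hj3
      split_ifs at hj3 with h
      · rw [← hj3]; exact (ha j t h).2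
      · omega
    · refine le_trans (Finset.sum_le_sum fun j _ => I.sσ j c) ?_
      refine le_trans ?_ (hf2 t (i - M))
      refine Finset.sum_le_sum_of_subset_of_nonneg ?_ fun j _ _ => I.σ0 j
      intro j hj
      obtain ⟨hj1, hj2, hj3⟩ := Finset.mem_filter.mp hj
      dsimp only at hj3
      split_ifs at hj3 with h
      · have := (ha j t h).1; omega
      · simp only [Finset.mem_filter]
        have : t ∈ Q j := by
          rcases Finset.mem_union.mp hj2 with h' | h'
          · exact absurd h' h
          · exact h'
        exact ⟨⟨hj1, this⟩, by omega⟩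

/-- Small windows. -/
lemma class_zero (I : Inst r dd p s σ x m) (κ N : ℕ) (lo : ℤ) (B : Finset ι)
    (hB : ∀ j ∈ B, lo ≤ r j ∧ dd j < lo + 2 * N)
    (hκ : Real.exp (-(κ / 2 : ℝ)) * (d * (2 * N)) ≤ 1 / 2) :
    SchedSub (m * κ + 5 * m) r dd p s B := by
  obtain ⟨U, hU⟩ := exists_units I
  have hm : (1 : ℝ) ≤ m := by exact_mod_cast I.hm
  set W := Finset.Ico lo (lo + 2 * N) with hW
  have hWc : (W.card : ℝ) = 2 * N := by
    have : W.card = 2 * N := by rw [hW, Int.card_Ico]; omega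
    exact_mod_cast this
  have hBW : ∀ j ∈ B, Finset.Icc (r j) (dd j) ⊆ W := by
    intro j hj t ht
    have := hB j hj
    simp only [hW, Finset.mem_Ico, Finset.mem_Icc] at ht ⊢
    omega
  set l := (W ×ˢ Finset.range (m * κ)).toList with hl
  obtain ⟨ω, hω⟩ := EE_exists (w := wt x m) (wt_nonneg I) wt_sum l
    (resid r dd p s σ U (m * κ) B) (fun _ => ∅)
  have hmean := mean_resid I hU κ l B W hBW (by
    intro j hj t ht i hi
    simp only [hl, Finset.mem_toList, Finset.mem_product, Finset.mem_range]
    exact ⟨hBW j hj ht, hi⟩) (fun _ => ∅)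
  have htot : resid r dd p s σ U (m * κ) B ω ≤ m / 2 := by
    refine hω.trans (hmean.trans ?_)
    rw [hWc]
    nlinarith
  refine sched_of_resid I hU (m * κ) ω B fun j hj => ?_
  have h1 : resid r dd p s σ U (m * κ) (near r dd B (Finset.Icc (r j) (dd j))) ω
      ≤ resid r dd p s σ U (m * κ) B ω :=
    Finset.sum_le_sum_of_subset_of_nonneg (Finset.filter_subset _ _) fun i _ _ =>
      mul_nonneg (I.σ0 i) (Finset.sum_nonneg fun u _ => unc_nonneg U _ i u ω)
  have h2 := I.hp j
  have h3 : (1 : ℝ) ≤ p j := by exact_mod_cast I.hp1 j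
  nlinarith

lemma near_sub (B : Finset ι) (a b : ℤ) (i : ι) (hi : i ∈ near r dd B (Finset.Icc a b)) :
    Finset.Icc (r i) (dd i) ⊆ Finset.Icc (a - (b - a)) (b + (b - a)) := by
  obtain ⟨_, h1, t, ht⟩ := Finset.mem_filter.mp hi
  simp only [Int.card_Icc, Finset.mem_inter, Finset.mem_Icc] at h1 ht
  intro t' ht'
  simp only [Finset.mem_Icc] at ht' ⊢
  omega

/-- Large windows. -/
lemma class_succ (I : Inst r dd p s σ x m) (hd : 2 ≤ d) (κ N : ℕ) (hκ1 : 1 ≤ κ) (L : ℝ) (lo : ℤ)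
    (B : Finset ι)
    (hB : ∀ j ∈ B, lo ≤ r j ∧ dd j < lo + 2 * N)
    (hL : ∀ j ∈ B, L ≤ ((Finset.Icc (r j) (dd j)).card : ℝ))
    (hκ : Real.exp (-(κ / 2 : ℝ)) * (d * 3) ≤ 1 / 4)
    (hN : (2 * N : ℝ) ^ 2 * Real.exp (-(L / (192 * d ^ 2 * κ))) < 1) :
    SchedSub (m * κ + 5 * m) r dd p s B := by
  obtain ⟨U, hU⟩ := exists_units I
  have hm : (1 : ℝ) ≤ m := by exact_mod_cast I.hm
  have hdR : (2 : ℝ) ≤ d := by exact_mod_cast hd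
  have hκR : (1 : ℝ) ≤ κ := by exact_mod_cast hκ1
  set W := Finset.Ico lo (lo + 2 * N) with hW
  have hWc : W.card = 2 * N := by rw [hW, Int.card_Ico]; omega
  have hBW : ∀ j ∈ B, Finset.Icc (r j) (dd j) ⊆ W := by
    intro j hj t ht
    have := hB j hj
    simp only [hW, Finset.mem_Ico, Finset.mem_Icc] at ht ⊢
    omega
  set l := (W ×ˢ Finset.range (m * κ)).toList with hl
  set sp : ℝ := 1 / (24 * d ^ 2 * κ) with hsp
  have hsp0 : 0 < sp := by positivity
  -- index set of windows
  set P := (W ×ˢ W).filter (fun ab => L ≤ ((Finset.Icc ab.1 ab.2).card : ℝ) ∧ ab.1 ≤ ab.2) with hP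
  let F : ℤ × ℤ → (ℤ × ℕ → Finset ι) → ℝ := fun ab =>
    resid r dd p s σ U (m * κ) (near r dd B (Finset.Icc ab.1 ab.2))
  have hone : ∀ ab ∈ P, EE (wt x m) l (fun ω => Real.exp (sp * F ab ω)) (fun _ => ∅)
      ≤ Real.exp (sp * (m * ((Finset.Icc ab.1 ab.2).card : ℝ) / 2))
        * Real.exp (-(L / (192 * d ^ 2 * κ))) := by
    rintro ⟨a, b⟩ hab
    obtain ⟨_, hLab, hle⟩ := Finset.mem_filter.mp hab
    dsimp only at hLab hle ⊢
    set n : ℝ := ((Finset.Icc a b).card : ℝ) with hn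
    set V := Finset.Icc (a - (b - a)) (b + (b - a)) with hV
    have hVc : (V.card : ℝ) ≤ 3 * n := by
      have : V.card ≤ 3 * (Finset.Icc a b).card := by
        simp only [hV, Int.card_Icc]; omega
      rw [hn]; exact_mod_cast this
    have hnear := near_sub (r := r) (dd := dd) B a b
    have hmean := mean_resid I hU κ l (near r dd B (Finset.Icc a b)) V hnear (by
      intro j hj t ht i hi
      simp only [hl, Finset.mem_toList, Finset.mem_product, Finset.mem_range]
      exact ⟨hBW j (Finset.mem_filter.mp hj).1 ht, hi⟩) (fun _ => ∅)
    have hbd := bdd_resid I hU (m * κ) (near r dd B (Finset.Icc a b)) V hnear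
    have hmgf := EE_exp (w := wt x m) (wt_nonneg I) wt_sum
      (fun c => if c.1 ∈ V then (d : ℝ) else 0) sp hsp0.le (by
        intro c
        split_ifs
        · rw [hsp, div_mul_eq_mul_div, one_mul, div_le_one (by positivity)]
          nlinarith [mul_le_mul hdR hκR (by norm_num) (by linarith)]
        · simp) l _ hbd (fun _ => ∅)
    refine hmgf.trans ?_
    rw [← Real.exp_add]
    apply Real.exp_le_exp.mpr
    have hn0 : 0 ≤ n := Nat.cast_nonneg _
    have hsum : (l.map fun c => (if c.1 ∈ V then (d : ℝ) else 0) ^ 2).sum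
        ≤ 3 * n * (m * κ) * d ^ 2 := by
      rw [hl, Finset.sum_map_toList, Finset.sum_product]
      have hin : ∀ t ∈ W, ∑ i ∈ Finset.range (m * κ),
          (if ((t, i) : ℤ × ℕ).1 ∈ V then (d : ℝ) else 0) ^ 2
          = ((m * κ : ℕ) : ℝ) * (if t ∈ V then (d : ℝ) else 0) ^ 2 := by
        intro t _
        by_cases h : t ∈ V <;> simp [h]
      rw [Finset.sum_congr rfl hin]
      calc ∑ t ∈ W, ((m * κ : ℕ) : ℝ) * (if t ∈ V then (d : ℝ) else 0) ^ 2
          = ∑ t ∈ W.filter (fun t => t ∈ V), ((m * κ : ℕ) : ℝ) * (d : ℝ) ^ 2 := by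
            rw [Finset.sum_filter]
            refine Finset.sum_congr rfl fun t _ => ?_
            split_ifs <;> simp
        _ = ((W.filter (fun t => t ∈ V)).card : ℝ) * (((m * κ : ℕ) : ℝ) * (d : ℝ) ^ 2) := by simp
        _ ≤ (3 * n) * (((m * κ : ℕ) : ℝ) * (d : ℝ) ^ 2) := by
            refine mul_le_mul_of_nonneg_right ?_ (by positivity)
            refine le_trans ?_ hVc
            exact_mod_cast Finset.card_le_card (fun t ht => (Finset.mem_filter.mp ht).2)
        _ = _ := by push_cast; ring
    have hmean2 : EE (wt x m) l (resid r dd p s σ U (m * κ) (near r dd B (Finset.Icc a b)))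
        (fun _ => ∅) ≤ m * n / 4 := by
      refine hmean.trans ?_
      calc _ ≤ Real.exp (-(κ / 2 : ℝ)) * (d * m * (3 * n)) := by gcongr
        _ = (Real.exp (-(κ / 2 : ℝ)) * (d * 3)) * (m * n) := by ring
        _ ≤ 1 / 4 * (m * n) := mul_le_mul_of_nonneg_right hκ (by positivity)
        _ = _ := by ring
    calc _ ≤ sp * (m * n / 4) + sp ^ 2 * (3 * n * (m * κ) * d ^ 2) := by gcongr
      _ = sp * (m * n / 2) - m * n / (192 * d ^ 2 * κ) := by
          rw [hsp]; field_simp; ring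
      _ ≤ sp * (m * n / 2) - L / (192 * d ^ 2 * κ) := by
          have : L ≤ m * n := by nlinarith
          gcongr
      _ = _ := by ring
  obtain ⟨ω, hω⟩ := EE_exists (w := wt x m) (wt_nonneg I) wt_sum l
    (fun ω => ∑ ab ∈ P, Real.exp (-(sp * (m * ((Finset.Icc ab.1 ab.2).card : ℝ) / 2)))
      * Real.exp (sp * F ab ω)) (fun _ => ∅)
  rw [EE_sum] at hω
  have hlt : ∑ ab ∈ P, Real.exp (-(sp * (m * ((Finset.Icc ab.1 ab.2).card : ℝ) / 2)))
      * Real.exp (sp * F ab ω) < 1 := by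
    refine lt_of_le_of_lt hω ?_
    refine lt_of_le_of_lt ?_ hN
    calc _ ≤ ∑ ab ∈ P, Real.exp (-(L / (192 * d ^ 2 * κ))) := by
          refine Finset.sum_le_sum fun ab hab => ?_
          rw [EE_const_mul]
          have := mul_le_mul_of_nonneg_left (hone ab hab)
            (Real.exp_pos (-(sp * (m * ((Finset.Icc ab.1 ab.2).card : ℝ) / 2)))).le
          refine this.trans (le_of_eq ?_)
          rw [← mul_assoc, ← Real.exp_add, neg_add_cancel, Real.exp_zero, one_mul]
      _ = P.card * Real.exp (-(L / (192 * d ^ 2 * κ))) := by simp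
      _ ≤ _ := by
          refine mul_le_mul_of_nonneg_right ?_ (Real.exp_pos _).le
          have : P.card ≤ (2 * N) ^ 2 := by
            refine (Finset.card_filter_le _ _).trans ?_
            rw [Finset.card_product, hWc, sq]
          exact_mod_cast this
  refine sched_of_resid I hU (m * κ) ω B fun j hj => ?_
  have hjj : (p j : ℝ) ≤ _ := I.hp j
  have hjne : r j ≤ dd j := by
    by_contra! h
    have h1 : (1 : ℝ) ≤ p j := by exact_mod_cast I.hp1 j
    have h2 := I.hp j
    rw [Finset.Icc_eq_empty (by omega)] at h2
    simp at h2
    have := I.hp1 j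
    omega
  have hmem : (r j, dd j) ∈ P := by
    refine Finset.mem_filter.mpr ⟨?_, hL j hj, hjne⟩
    rw [Finset.mem_product]
    exact ⟨hBW j hj (by simp [hjne]), hBW j hj (by simp [hjne])⟩
  have h1 := Finset.single_le_sum (f := fun ab : ℤ × ℤ =>
    Real.exp (-(sp * (m * ((Finset.Icc ab.1 ab.2).card : ℝ) / 2)))
      * Real.exp (sp * F ab ω)) (fun ab _ => by positivity) hmem
  have h2 := lt_of_le_of_lt h1 hlt
  dsimp only at h2
  rw [← Real.exp_add, Real.exp_lt_one_iff] at h2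
  have h3 : sp * F (r j, dd j) ω ≤ sp * (m * ((Finset.Icc (r j) (dd j)).card : ℝ) / 2) := by
    linarith
  exact le_of_mul_le_mul_left h3 hsp0

end Sched

lemma clog_facts (d : ℕ) (hd : 2 ≤ d) :
    1 ≤ Nat.clog 2 d ∧ Nat.clog 2 d ≤ d ∧ (Nat.clog 2 d : ℝ) ≤ 3 * Real.log d ∧
    (d : ℝ) ^ 50 ≤ Real.exp (50 * (Nat.clog 2 d : ℝ)) := by
  have hdR : (2 : ℝ) ≤ d := by exact_mod_cast hd
  refine ⟨Nat.clog_pos (by norm_num) hd, Nat.clog_le_of_le_pow Nat.lt_two_pow_self.le, ?_, ?_⟩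
  · have h1 : 2 ^ (Nat.clog 2 d - 1) < d := Nat.pow_pred_clog_lt_self (by norm_num) (by omega)
    have h2 : (2 : ℝ) ^ (Nat.clog 2 d - 1) ≤ d := by exact_mod_cast h1.le
    have h3 := Real.log_le_log (by positivity) h2
    rw [Real.log_pow] at h3
    have h4 : 1 ≤ Nat.clog 2 d := Nat.clog_pos (by norm_num) hd
    rw [Nat.cast_sub h4] at h3
    have h5 := Real.log_two_gt_d9
    have h6 : Real.log 2 ≤ Real.log d := Real.log_le_log (by norm_num) hdR
    push_cast at h3
    by_contra! h
    nlinarith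
  · have h1 : (d : ℝ) ≤ 2 ^ (Nat.clog 2 d) := by
      exact_mod_cast Nat.le_pow_clog (by norm_num) d
    have h2 : (2 : ℝ) ≤ Real.exp 1 := by linarith [Real.exp_one_gt_d9]
    have h3 : (d : ℝ) ≤ Real.exp (Nat.clog 2 d : ℝ) := by
      refine h1.trans ?_
      rw [← mul_one (Nat.clog 2 d : ℝ), Real.exp_nat_mul]
      exact pow_le_pow_left₀ (by norm_num) h2 _
    have h4 := pow_le_pow_left₀ (by positivity) h3 50
    rw [← Real.exp_nat_mul] at h4
    exact_mod_cast h4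

/-- Base threshold. -/
noncomputable def bb (d : ℕ) : ℝ := (76800 * (d : ℝ) ^ 3) ^ 2

lemma arith_zero (d N : ℕ) (hd : 2 ≤ d) (hN : (N : ℝ) ≤ bb d) :
    Real.exp (-(((100 * Nat.clog 2 d : ℕ) : ℝ) / 2)) * (d * (2 * N)) ≤ 1 / 2 := by
  obtain ⟨_, _, _, h4⟩ := clog_facts d hd
  have hdR : (2 : ℝ) ≤ d := by exact_mod_cast hd
  have e : ((100 * Nat.clog 2 d : ℕ) : ℝ) / 2 = 50 * (Nat.clog 2 d : ℝ) := by push_cast; ring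
  rw [e, Real.exp_neg, inv_mul_le_iff₀ (Real.exp_pos _)]
  have h5 : (2 : ℝ) ^ 43 ≤ (d : ℝ) ^ 43 := pow_le_pow_left₀ (by norm_num) hdR 43
  have h6 : (d : ℝ) ^ 50 = (d : ℝ) ^ 43 * (d : ℝ) ^ 7 := by ring
  have h7 : (0 : ℝ) < (d : ℝ) ^ 7 := by positivity
  have h8 : (d : ℝ) * (2 * N) ≤ d * (2 * bb d) := by gcongr
  have h9 : (d : ℝ) * (2 * bb d) = 2 * 76800 ^ 2 * (d : ℝ) ^ 7 := by unfold bb; ring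
  have h10 : (2 * 76800 ^ 2 * 2 : ℝ) * (d : ℝ) ^ 7 ≤ (d : ℝ) ^ 43 * (d : ℝ) ^ 7 :=
    mul_le_mul_of_nonneg_right (le_trans (by norm_num) h5) h7.le
  linarith

lemma arith_succ (d N : ℕ) (hd : 2 ≤ d) (L : ℝ) (hL : bb d ≤ L)
    (hN : (N : ℝ) ≤ Real.exp (Real.sqrt L)) :
    (2 * N : ℝ) ^ 2 * Real.exp (-(L / (192 * d ^ 2 * ((100 * Nat.clog 2 d : ℕ) : ℝ)))) < 1 := by
  obtain ⟨h1, h2, _, _⟩ := clog_facts d hd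
  have hdR : (2 : ℝ) ≤ d := by exact_mod_cast hd
  have h1R : (1 : ℝ) ≤ (Nat.clog 2 d : ℝ) := by exact_mod_cast h1
  have h2R : (Nat.clog 2 d : ℝ) ≤ d := by exact_mod_cast h2
  have hd3 : (8 : ℝ) ≤ (d : ℝ) ^ 3 := by
    have := pow_le_pow_left₀ (by norm_num) hdR 3; norm_num at this; exact this
  have hs : 76800 * (d : ℝ) ^ 3 ≤ Real.sqrt L := Real.le_sqrt_of_sq_le hL
  have hL0 : 0 ≤ L := le_trans (by unfold bb; positivity) hL
  have hLs : Real.sqrt L * Real.sqrt L = L := Real.mul_self_sqrt hL0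
  have hq : 4 * Real.sqrt L ≤ L / (192 * d ^ 2 * ((100 * Nat.clog 2 d : ℕ) : ℝ)) := by
    rw [le_div_iff₀ (by push_cast; positivity)]
    have h5 : 4 * (192 * (d : ℝ) ^ 2 * ((100 * Nat.clog 2 d : ℕ) : ℝ)) ≤ Real.sqrt L := by
      refine le_trans ?_ hs
      push_cast
      have : (d : ℝ) ^ 2 * (Nat.clog 2 d : ℝ) ≤ (d : ℝ) ^ 2 * d := by gcongr
      nlinarith
    nlinarith [Real.sqrt_nonneg L]
  have hN2 : (2 * N : ℝ) ^ 2 ≤ 4 * Real.exp (2 * Real.sqrt L) := by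
    have : (2 * N : ℝ) ^ 2 ≤ (2 * Real.exp (Real.sqrt L)) ^ 2 := by gcongr
    refine this.trans (le_of_eq ?_)
    rw [mul_pow, ← Real.exp_nat_mul]; norm_num
  calc _ ≤ 4 * Real.exp (2 * Real.sqrt L) * Real.exp (-(4 * Real.sqrt L)) := by
        refine mul_le_mul hN2 (Real.exp_le_exp.mpr (by linarith)) (Real.exp_pos _).le (by positivity)
    _ = 4 * Real.exp (-(2 * Real.sqrt L)) := by
        rw [mul_assoc, ← Real.exp_add]; congr 2; ring
    _ < 1 := by
        rw [Real.exp_neg, mul_inv_lt_iff₀ (Real.exp_pos _)]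
        have := Real.add_one_le_exp (2 * Real.sqrt L)
        linarith

lemma arith_mean (d : ℕ) (hd : 2 ≤ d) :
    Real.exp (-(((100 * Nat.clog 2 d : ℕ) : ℝ) / 2)) * (d * 3) ≤ 1 / 4 := by
  have hdR : (2 : ℝ) ≤ d := by exact_mod_cast hd
  have hd3 : (8 : ℝ) ≤ (d : ℝ) ^ 3 := by
    have := pow_le_pow_left₀ (by norm_num) hdR 3; norm_num at this; exact this
  have h := arith_zero d 6 hd (by unfold bb; push_cast; nlinarith)
  push_cast at h ⊢
  nlinarith

section Final
variable {ι : Type} [Fintype ι] [DecidableEq ι] {d : ℕ}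
variable {r dd : ι → ℤ} {p : ι → ℕ} {s : ι → Fin d → ℝ} {σ : ι → ℝ}
  {x : Finset ι → ℤ → ℝ} {m : ℕ}

lemma main_inst (I : Inst r dd p s σ x m) (hd : 2 ≤ d) (T : ℝ)
    (hT : ∀ j, ((Finset.Icc (r j) (dd j)).card : ℝ) ≤ T) :
    SchedulableD (⌈(630 : ℝ) * m * Real.log d * (1 + (logStar T : ℝ))⌉₊) r dd p s := by
  classical
  have hdR : (2 : ℝ) ≤ d := by exact_mod_cast hd
  have hd3 : (8 : ℝ) ≤ (d : ℝ) ^ 3 := by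
    have := pow_le_pow_left₀ (by norm_num) hdR 3; norm_num at this; exact this
  have hb : 36 ≤ bb d := by unfold bb; nlinarith
  have hle : ∀ j, ((Finset.Icc (r j) (dd j)).card : ℝ) ≤ beta (bb d) (logStar T) := fun j =>
    (hT j).trans ((le_tow_logStar T).trans (tow_le_beta _ hb _))
  have hex : ∀ j, ∃ k, ((Finset.Icc (r j) (dd j)).card : ℝ) ≤ beta (bb d) k :=
    fun j => ⟨_, hle j⟩
  obtain ⟨cls, hc1, hc2, hc3⟩ : ∃ cls : ι → ℕ, (∀ j, cls j ≤ logStar T) ∧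
      (∀ j, ((Finset.Icc (r j) (dd j)).card : ℝ) ≤ beta (bb d) (cls j)) ∧
      (∀ j k, cls j = k + 1 → beta (bb d) k ≤ ((Finset.Icc (r j) (dd j)).card : ℝ)) := by
    refine ⟨fun j => Nat.find (hex j), fun j => Nat.find_min' _ (hle j),
      fun j => Nat.find_spec (hex j), fun j k hk => ?_⟩
    have := Nat.find_min (hex j) (m := k) (by dsimp only at hk; omega)
    exact (not_le.mp this).le
  set N : ℕ → ℕ := fun k => ⌊beta (bb d) k⌋₊ with hNdef
  have hβ : ∀ k, bb d ≤ beta (bb d) k := beta_ge_b _ hb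
  have hNle : ∀ k, (N k : ℝ) ≤ beta (bb d) k := fun k =>
    Nat.floor_le (by linarith [hβ k])
  have hN1 : ∀ k, 1 ≤ N k := fun k => Nat.le_floor (by push_cast; linarith [hβ k])
  have hcN : ∀ j, (Finset.Icc (r j) (dd j)).card ≤ N (cls j) := fun j => Nat.le_floor (hc2 j)
  set q : ι → ℤ := fun j => r j / (N (cls j) : ℤ) with hq
  have hwin : ∀ j, q j * N (cls j) ≤ r j ∧ dd j < q j * N (cls j) + 2 * N (cls j) := by
    intro j
    have h1 : (0 : ℤ) < N (cls j) := by exact_mod_cast hN1 (cls j)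
    have h2 := Int.ediv_mul_le (r j) h1.ne'
    have h3 := Int.lt_ediv_add_one_mul_self (r j) h1
    have h4 := hcN j
    rw [Int.card_Icc] at h4
    rw [add_mul, one_mul] at h3
    change r j / (N (cls j) : ℤ) * N (cls j) ≤ r j ∧
      dd j < r j / (N (cls j) : ℤ) * N (cls j) + 2 * N (cls j)
    constructor <;> omega
  set Λ := Nat.clog 2 d with hΛ
  obtain ⟨hΛ1, _, hΛ3, _⟩ := clog_facts d hd
  refine combine (m * (100 * Λ) + 5 * m) (2 * (1 + logStar T)) r dd p s I.s0
    (fun j => 2 * cls j + (q j % 2).toNat) q ?_ ?_ ?_ _ ?_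
  · intro j
    have := hc1 j
    omega
  · intro j j' hg hne
    have e1 : cls j = cls j' := by omega
    have hwj := hwin j
    have hwj' := hwin j'
    rw [← e1] at hwj'
    set n : ℤ := (N (cls j) : ℤ) with hn
    have hn0 : 0 ≤ n := Int.natCast_nonneg _
    rw [Finset.disjoint_left]
    intro t ht ht'
    rw [Finset.mem_Icc] at ht ht'
    have hcase : q j + 2 ≤ q j' ∨ q j' + 2 ≤ q j := by omega
    rcases hcase with h | h
    · have := mul_le_mul_of_nonneg_right h hn0
      rw [add_mul] at this
      omega
    · have := mul_le_mul_of_nonneg_right h hn0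
      rw [add_mul] at this
      omega
  · intro a e
    have hmemB : ∀ j ∈ (Finset.univ.filter fun j => 2 * cls j + (q j % 2).toNat = a ∧ q j = e),
        cls j = a / 2 ∧ q j = e := by
      intro j hj
      obtain ⟨_, h1, h2⟩ := Finset.mem_filter.mp hj
      exact ⟨by omega, h2⟩
    have hBw : ∀ j ∈ (Finset.univ.filter fun j => 2 * cls j + (q j % 2).toNat = a ∧ q j = e),
        e * N (a / 2) ≤ r j ∧ dd j < e * N (a / 2) + 2 * N (a / 2) := by
      intro j hj
      obtain ⟨h1, h2⟩ := hmemB j hj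
      have := hwin j
      rwa [h1, h2] at this
    rcases hk : a / 2 with _ | k
    · rw [hk] at hBw
      exact class_zero I _ (N 0) (e * N 0) _ hBw (arith_zero d _ hd (hNle 0))
    · rw [hk] at hBw
      exact class_succ I hd _ (N (k + 1)) (by omega) (beta (bb d) k) (e * N (k + 1)) _ hBw
        (fun j hj => hc3 j k (by rw [(hmemB j hj).1, hk])) (arith_mean d hd)
        (arith_succ d _ hd _ (hβ k) (hNle (k + 1)))
  · have h1 : (((2 * (1 + logStar T)) * (m * (100 * Λ) + 5 * m) : ℕ) : ℝ)
        ≤ (630 : ℝ) * m * Real.log d * (1 + (logStar T : ℝ)) := by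
      push_cast
      have hΛR : (1 : ℝ) ≤ Λ := by exact_mod_cast hΛ1
      have h2 : (m : ℝ) * (100 * Λ) + 5 * m ≤ m * (315 * Real.log d) := by
        have : (0 : ℝ) ≤ m := Nat.cast_nonneg _
        nlinarith
      have h3 := mul_le_mul_of_nonneg_left h2
        (show (0 : ℝ) ≤ 2 * (1 + (logStar T : ℝ)) by positivity)
      refine h3.trans (le_of_eq (by ring))
    exact_mod_cast h1.trans (Nat.le_ceil _)

end Final

theorem stmt_17 (lam : ℝ) (hlam0 : 0 < lam) (hlam1 : lam < 1/4) :
    ∃ C : ℝ, 0 < C ∧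
      ∀ (ι : Type) (_ : Fintype ι) (_ : DecidableEq ι) (d : ℕ) (T : ℤ)
        (r dd : ι → ℤ) (p : ι → ℕ) (s : ι → Fin d → ℝ) (m : ℕ)
        (x : Finset ι → ℤ → ℝ),
        2 ≤ d → 2 ≤ T → 1 ≤ m →
        (∀ j, 1 ≤ r j ∧ dd j ≤ T ∧ r j ≤ dd j) →
        (∀ j, 1 ≤ p j ∧ (p j : ℤ) ≤ dd j - r j + 1) →
        (∀ j i, 0 ≤ s j i ∧ s j i ≤ 1) →
        (∀ j, (p j : ℝ) ≤ lam * ((dd j - r j + 1 : ℤ) : ℝ)) →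
        ConfigLP T r dd p s x m →
        SchedulableD (⌈C * m * Real.log d * (1 + (logStar (T : ℝ) : ℝ))⌉₊) r dd p s := by
  refine ⟨630, by norm_num, ?_⟩
  intro ι _ _ d T r dd p s m x hd hT hm hw hp hs hl ⟨x0, xv, xm, y1, yp⟩
  have hne : (Finset.univ : Finset (Fin d)).Nonempty := ⟨⟨0, by omega⟩, Finset.mem_univ _⟩
  have hcard : ∀ j, ((Finset.Icc (r j) (dd j)).card : ℝ) = ((dd j - r j + 1 : ℤ) : ℝ) := by
    intro j
    have h := hw j
    have : ((Finset.Icc (r j) (dd j)).card : ℤ) = dd j - r j + 1 := by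
      rw [Int.card_Icc]; omega
    exact_mod_cast this
  have I : Inst r dd p s (fun j => Finset.univ.sup' hne (s j)) x m :=
    { hm := hm
      hp1 := fun j => (hp j).1
      hp := by
        intro j
        have h1 := hl j
        rw [hcard j]
        have h2 : (0 : ℝ) ≤ ((dd j - r j + 1 : ℤ) : ℝ) := by
          rw [← hcard j]; positivity
        nlinarith
      s0 := fun j i => (hs j i).1
      σ0 := fun j => (hs j ⟨0, by omega⟩).1.trans (Finset.le_sup' (s j) (Finset.mem_univ _))
      σ1 := fun j => Finset.sup'_le _ _ fun i _ => (hs j i).2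
      sσ := fun j i => Finset.le_sup' (s j) (Finset.mem_univ i)
      σs := fun j => Finset.sup'_le _ _ fun i hi =>
        Finset.single_le_sum (f := s j) (fun i _ => (hs j i).1) hi
      x0 := x0
      xv := xv
      xm := xm
      y1 := y1
      yp := by
        intro j
        refine (yp j).trans (le_of_eq ?_)
        symm
        refine Finset.sum_subset ?_ ?_
        · intro t ht
          have := hw j
          rw [Finset.mem_Icc] at ht ⊢
          omega
        · intro t _ ht
          refine Finset.sum_eq_zero fun S hS => ?_
          by_contra h
          exact ht ((xv S t h).1 j (Finset.mem_filter.mp hS).2) }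
  refine main_inst I hd (T : ℝ) fun j => ?_
  rw [hcard j]
  have := hw j
  exact_mod_cast (by omega : dd j - r j + 1 ≤ T)
end
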